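/- Let r ≥ 3, k ≥ r+1, and write n = pk + q with p, q nonnegative integers and 0 ≤ q < k. Then the maximum number of hyperedges in an n-vertex r-uniform hypergraph containing no Berge path of length k equals p·C(k,r) + C(q,r), where C(a,b) denotes the binomial coefficient. -/

import Mathlib

/-- A Berge path of length `k` in a hypergraph with hyperedge set `E`:
`k` distinct hyperedges `h 0, …, h (k-1)` and `k+1` distinct vertices
`v 0, …, v k` with `v i, v (i+1) ∈ h i`. -/
def IsBergePath {V : Type*} (E : Finset (Finset V)) (k : ℕ)
    (v : Fin (k + 1) → V) (h : Fin k → Finset V) : Prop :=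
  Function.Injective v ∧ Function.Injective h ∧ (∀ i, h i ∈ E) ∧
    ∀ i : Fin k, v i.castSucc ∈ h i ∧ v i.succ ∈ h i

def HasBergePath {V : Type*} (E : Finset (Finset V)) (k : ℕ) : Prop :=
  ∃ v h, IsBergePath E k v h

set_option linter.unusedSectionVars false

section Arithmetic

theorem sum_range_exchange {M : ℕ → ℕ} (hM : Monotone M) {a b x y : ℕ} (h : a + b = x + y)
    (ha : a ≤ x) (hb : b ≤ x) :
    ∑ j ∈ Finset.range a, M j + ∑ j ∈ Finset.range b, M j ≤
      ∑ j ∈ Finset.range x, M j + ∑ j ∈ Finset.range y, M j := by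
  obtain ⟨e, rfl⟩ := Nat.exists_eq_add_of_le hb
  obtain rfl : a = y + e := by omega
  rw [Finset.sum_range_add, Finset.sum_range_add]
  have : ∑ i ∈ Finset.range e, M (y + i) ≤ ∑ i ∈ Finset.range e, M (b + i) :=
    Finset.sum_le_sum fun i _ => hM (by omega)
  omega

theorem blockSum_superadditive {F : ℕ → ℕ} {k A : ℕ} (hk : 0 < k)
    (h1 : ∀ a b, a + b < k → F a + F b ≤ F (a + b))
    (h2 : ∀ a b, a < k → b < k → k ≤ a + b → F a + F b ≤ A + F (a + b - k)) (a b : ℕ) :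
    (a / k * A + F (a % k)) + (b / k * A + F (b % k)) ≤ (a + b) / k * A + F ((a + b) % k) := by
  have ha := Nat.mod_lt a hk
  have hb := Nat.mod_lt b hk
  rw [Nat.add_div hk, Nat.add_mod]
  split_ifs with h
  · have := h2 _ _ ha hb h
    rw [Nat.mod_eq_sub_mod h, Nat.mod_eq_of_lt (a := a % k + b % k - k) (by omega)]
    simp only [Nat.add_mul, Nat.one_mul]
    omega
  · have := h1 (a % k) (b % k) (by omega)
    rw [Nat.mod_eq_of_lt (a := a % k + b % k) (by omega)]
    simp only [Nat.add_mul, Nat.zero_mul]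
    omega

theorem choose_eq_sum_range (n s : ℕ) :
    n.choose (s + 1) = ∑ j ∈ Finset.range n, j.choose s := by
  induction n with
  | zero => simp
  | succ n ih => rw [Finset.sum_range_succ, ← ih, Nat.choose_succ_succ']; omega

theorem blockChoose_superadditive {k r : ℕ} (hk : 0 < k) (hr : 1 ≤ r) (a b : ℕ) :
    (a / k * k.choose r + (a % k).choose r) + (b / k * k.choose r + (b % k).choose r) ≤
      (a + b) / k * k.choose r + ((a + b) % k).choose r := by
  obtain ⟨s, rfl⟩ : ∃ s, r = s + 1 := ⟨r - 1, by omega⟩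
  have hM : Monotone fun j : ℕ => j.choose s := fun _ _ h => Nat.choose_le_choose s h
  apply blockSum_superadditive (F := fun n => n.choose (s + 1)) hk
  · intro a b _
    have := sum_range_exchange hM (a := a) (b := b) (x := a + b) (y := 0) (by omega) (by omega) (by omega)
    simpa [choose_eq_sum_range] using this
  · intro a b ha hb hab
    have := sum_range_exchange hM (a := a) (b := b) (x := k) (y := a + b - k) (by omega) (by omega) (by omega)
    simpa only [choose_eq_sum_range] using this

/-- The maximal weight of a vertex of degree `j` in the red-blue graph. -/
def vertexWeight (r j : ℕ) : ℕ := max j (j.choose (r - 1))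

theorem monotone_vertexWeight (r : ℕ) : Monotone (vertexWeight r) := fun _ _ h =>
  max_le_max h (Nat.choose_le_choose _ h)

theorem vertexWeight_of_le {r j : ℕ} (hr : 3 ≤ r) (hj : j ≤ r) : vertexWeight r j = j := by
  unfold vertexWeight
  rw [max_eq_left_iff]
  rcases lt_or_eq_of_le hj with h | rfl
  · rcases lt_or_eq_of_le (Nat.le_sub_one_of_lt h) with h | h
    · rw [Nat.choose_eq_zero_of_lt h]; omega
    · rw [← h, Nat.choose_self]; omega
  · obtain ⟨s, rfl⟩ : ∃ s, j = s + 1 := ⟨j - 1, by omega⟩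
    simp [Nat.choose_succ_self_right]

theorem le_choose_of_lt {s j : ℕ} (hs : 1 ≤ s) (hj : s + 1 ≤ j) : j ≤ j.choose s := by
  induction j, hj using Nat.le_induction with
  | base => rw [Nat.choose_succ_self_right]
  | succ j hj ih =>
    obtain ⟨t, rfl⟩ : ∃ t, s = t + 1 := ⟨s - 1, by omega⟩
    rw [Nat.choose_succ_succ']
    have := Nat.choose_pos (n := j) (k := t) (by omega)
    omega

theorem vertexWeight_of_ge {r j : ℕ} (hr : 3 ≤ r) (hj : r ≤ j) :
    vertexWeight r j = j.choose (r - 1) :=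
  max_eq_right (le_choose_of_lt (by omega) (by omega))

theorem sum_vertexWeight_of_le {r n : ℕ} (hr : 3 ≤ r) (hn : n ≤ r + 1) :
    ∑ j ∈ Finset.range n, vertexWeight r j = n.choose 2 := by
  rw [choose_eq_sum_range]
  refine Finset.sum_congr rfl fun j hj => ?_
  rw [Finset.mem_range] at hj
  rw [vertexWeight_of_le hr (by omega), Nat.choose_one_right]

theorem sum_vertexWeight_of_ge {r n : ℕ} (hr : 3 ≤ r) (hn : r ≤ n) :
    ∑ j ∈ Finset.range n, vertexWeight r j + 1 = n.choose r + r.choose 2 := by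
  induction n, hn using Nat.le_induction with
  | base => rw [sum_vertexWeight_of_le hr (by omega), Nat.choose_self]; omega
  | succ n hn ih =>
    rw [Finset.sum_range_succ, vertexWeight_of_ge hr hn]
    obtain ⟨s, rfl⟩ : ∃ s, r = s + 1 := ⟨r - 1, by omega⟩
    rw [Nat.choose_succ_succ' n s, show s + 1 - 1 = s from rfl]
    omega

theorem choose_two_mul (n : ℕ) : n.choose 2 * 2 = n * (n - 1) := by
  rw [Nat.choose_two_right, Nat.div_mul_cancel (Nat.even_mul_pred_self n).two_dvd]

theorem choose_three_mul (n : ℕ) : (n + 2).choose 3 * 6 = (n + 2) * (n + 1) * n := by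
  induction n with
  | zero => simp
  | succ n ih =>
    rw [Nat.choose_succ_succ' (n + 2) 2]
    have := choose_two_mul (n + 2)
    have e : n + 2 - 1 = n + 1 := by omega
    rw [e] at this
    nlinarith

theorem two_mul_choose_two_le {r m : ℕ} (hr : 3 ≤ r) (hm : r + 1 ≤ m) :
    2 * r.choose 2 ≤ m.choose (r - 2) + 2 := by
  have h1 := Nat.choose_le_choose (r - 2) hm
  have h2 : (r + 1).choose (r - 2) = (r + 1).choose 3 := by
    rw [← Nat.choose_symm (by omega)]
    congr 1
    omega
  have h3 := choose_two_mul r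
  obtain ⟨t, rfl⟩ : ∃ t, r = t + 3 := ⟨r - 3, by omega⟩
  have h4 := choose_three_mul (t + 2)
  rw [h2] at h1
  have e : t + 3 - 1 = t + 2 := by omega
  rw [e] at h3
  have h5 : (t + 2 + 2) = t + 3 + 1 := by omega
  rw [h5] at h4
  have : 6 * ((t + 3) * (t + 2)) ≤ (t + 3 + 1) * (t + 2 + 1) * (t + 2) + 12 := by
    rcases t with _ | _ | t
    · norm_num
    · norm_num
    · nlinarith [sq_nonneg t, pow_pos (Nat.succ_pos t) 3]
  omega

theorem choose_add_ge (N r e : ℕ) : (N.choose (r + 1) + e * N.choose r ≤ (N + e).choose (r + 1)) := by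
  induction e with
  | zero => simp
  | succ e ih =>
    rw [← Nat.add_assoc, Nat.choose_succ_succ', Nat.succ_mul]
    have := Nat.choose_le_choose r (Nat.le_add_right N e)
    omega

theorem choose_add_ge_two (N r e : ℕ) :
    N.choose (r + 2) + e * N.choose (r + 1) + e.choose 2 * N.choose r ≤ (N + e).choose (r + 2) := by
  induction e with
  | zero => simp
  | succ e ih =>
    rw [← Nat.add_assoc, Nat.choose_succ_succ' (N + e) (r + 1), Nat.succ_mul]
    have := choose_add_ge N r e
    rw [Nat.choose_succ_succ' e 1, Nat.choose_one_right, Nat.add_mul]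
    simp only [show 1 + 1 = 2 from rfl, show r + 1 + 1 = r + 2 from rfl]
    omega

theorem choose_le_choose_of_le_half {n a b : ℕ} (hab : a ≤ b) (hb : 2 * b ≤ n) :
    n.choose a ≤ n.choose b := by
  induction b, hab using Nat.le_induction with
  | base => rfl
  | succ b hab ih =>
    exact (ih (by omega)).trans (Nat.choose_le_succ_of_lt_half_left (by omega))

theorem choose_three_le {n r : ℕ} (hr : 3 ≤ r) (hn : r + 3 ≤ n) : n.choose 3 ≤ n.choose r := by
  rcases le_total (2 * r) n with h | h
  · exact choose_le_choose_of_le_half hr h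
  · rw [← Nat.choose_symm (show r ≤ n by omega)]
    exact choose_le_choose_of_le_half (by omega) (by omega)

theorem two_mul_vertexWeight_add {r d N : ℕ} (hr : 3 ≤ r) (hd : 1 ≤ d) (hdN : d ≤ N)
    (hN : r + 1 ≤ N) :
    (d + 1) * vertexWeight r d + 2 * r.choose 2 ≤
      N.choose (r - 1) + (d + 1).choose 2 * N.choose (r - 2) + 2 := by
  have hY := two_mul_choose_two_le hr hN
  have h1 := choose_two_mul (d + 1)
  rw [Nat.add_sub_cancel] at h1
  rcases le_total d r with h | h
  · rw [vertexWeight_of_le hr h, ← h1]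
    have h2 : N ≤ N.choose (r - 2) := le_choose_of_lt (by omega) (by omega)
    have h3 : N ≤ N.choose (r - 1) := le_choose_of_lt (by omega) (by omega)
    have h4 : 1 ≤ (d + 1).choose 2 := Nat.choose_pos (by omega)
    nlinarith
  · rw [vertexWeight_of_ge hr h]
    obtain ⟨s, rfl⟩ : ∃ s, r = s + 3 := ⟨r - 3, by omega⟩
    obtain ⟨c, rfl⟩ : ∃ c, d = c + 1 := ⟨d - 1, by omega⟩
    simp only [show s + 3 - 1 = s + 2 from rfl,
      show s + 3 - 2 = s + 1 from rfl] at hY ⊢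
    have h2 := Nat.add_one_mul_choose_eq c (s + 1)
    have h3 : (c + 1).choose (s + 1) ≤ N.choose (s + 1) := Nat.choose_le_choose _ hdN
    have h4 := Nat.choose_succ_succ' c s
    have h5 : 1 ≤ c.choose s := Nat.choose_pos (by omega)
    have h6 : (s + 4).choose (s + 2) ≤ N.choose (s + 2) := Nat.choose_le_choose _ (by omega)
    have h7 : (s + 4).choose (s + 2) = (s + 4).choose 2 := by
      rw [← Nat.choose_symm (by omega)]; congr 1; omega
    have h8 := choose_two_mul (s + 4)
    have h9 := choose_two_mul (s + 3)
    simp only [show s + 4 - 1 = s + 3 from rfl, show s + 3 - 1 = s + 2 from rfl] at h8 h9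
    have h10 : 2 * (c + 1).choose (s + 2) ≤ (c + 1) * c.choose (s + 1) := by
      rw [h2]
      have := Nat.zero_le ((c + 1).choose (s + 1 + 1) * s)
      nlinarith
    have h11 : (c + 1 + 1) * (2 * (c + 1).choose (s + 2)) + (c + 1 + 1) * (c + 1) ≤
        (c + 1 + 1) * (c + 1) * N.choose (s + 1) := by
      have h12 : c.choose (s + 1) + 1 ≤ N.choose (s + 1) := by omega
      calc _ ≤ (c + 1 + 1) * ((c + 1) * c.choose (s + 1)) + (c + 1 + 1) * (c + 1) := by gcongr
        _ = (c + 1 + 1) * (c + 1) * (c.choose (s + 1) + 1) := by ring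
        _ ≤ _ := by gcongr
    rw [← h1] at h11
    have h13 : (s + 4) * (s + 3) ≤ (c + 1 + 1) * (c + 1) := Nat.mul_le_mul (by omega) (by omega)
    nlinarith

theorem peel_sum_le {r k N d : ℕ} (hr : 3 ≤ r) (hk : r + 3 ≤ k) (hd : 1 ≤ d) (hdN : d ≤ N)
    (hN : N + d + 1 = k) :
    ∑ j ∈ Finset.range N, vertexWeight r j + d * vertexWeight r N + (d + 1) * vertexWeight r d +
      r.choose 2 ≤ k.choose r + 1 := by
  rcases Nat.lt_or_ge r N with h | h'
  · have h1 := sum_vertexWeight_of_ge hr (show r ≤ N by omega)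
    have h2 := two_mul_vertexWeight_add hr hd hdN h
    have h3 := choose_add_ge_two N (r - 2) (d + 1)
    rw [← Nat.add_assoc, hN, show r - 2 + 2 = r by omega, show r - 2 + 1 = r - 1 by omega,
      Nat.succ_mul] at h3
    rw [vertexWeight_of_ge hr (by omega : r ≤ N)]
    omega
  · rw [sum_vertexWeight_of_le hr (by omega), vertexWeight_of_le hr h',
      vertexWeight_of_le hr (hdN.trans h')]
    have h1 := choose_three_le hr hk
    obtain ⟨x, rfl⟩ : ∃ x, k = x + 6 := ⟨k - 6, by omega⟩
    have h2 := choose_three_mul (x + 4)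
    have h3 := choose_two_mul r
    have h4 := choose_two_mul N
    obtain ⟨t, rfl⟩ : ∃ t, r = t + 1 := ⟨r - 1, by omega⟩
    obtain ⟨m, rfl⟩ : ∃ m, N = m + 1 := ⟨N - 1, by omega⟩
    simp only [Nat.add_sub_cancel] at h3 h4
    have h6 : (t + 1) * t ≤ (x + 3) * (x + 2) := Nat.mul_le_mul (by omega) (by omega)
    have h7 : 4 * (3 * d * d + 9 * d) ≤ 3 * (x + 5) * (x + 5) + 18 * (x + 5) := by
      have : 2 * d ≤ x + 5 := by omega
      nlinarith
    have h8 : m = x + 4 - d := by omega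
    have h9 : m * (m + 1) + 2 * d * (m + 1) + 2 * (d + 1) * d =
        (x + 5) * (x + 4) + d * d + 3 * d := by
      have : x + 4 = m + d := by omega
      rw [show x + 5 = m + d + 1 by omega, this]
      ring
    have h10 : (x + 4 + 2).choose 3 ≤ (x + 6).choose (t + 1) := h1
    nlinarith [pow_nonneg (Nat.zero_le x) 3]

end Arithmetic

section Arithmetic

/-- An upper bound for the weight of `n` vertices in the red-blue graph. -/
def weightBound (r k n : ℕ) : ℕ :=
  n / k * k.choose r + ∑ j ∈ Finset.range (n % k), vertexWeight r j

theorem weightBound_of_lt {r k n : ℕ} (h : n < k) :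
    weightBound r k n = ∑ j ∈ Finset.range n, vertexWeight r j := by
  rw [weightBound, Nat.div_eq_of_lt h, Nat.mod_eq_of_lt h]; simp

theorem weightBound_add_self {r k n : ℕ} (hk : 0 < k) :
    weightBound r k (k + n) = k.choose r + weightBound r k n := by
  rw [weightBound, weightBound, Nat.add_div_left _ hk, Nat.add_mod_left, Nat.succ_mul]
  omega

theorem sum_vertexWeight_overflow {r k a b : ℕ} (hr : 3 ≤ r) (hk : r + 3 ≤ k) (ha : a < k)
    (hb : b < k) (hab : k ≤ a + b) :
    ∑ j ∈ Finset.range a, vertexWeight r j + ∑ j ∈ Finset.range b, vertexWeight r j +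
      r.choose 2 ≤ k.choose r + ∑ j ∈ Finset.range (a + b - k), vertexWeight r j + 1 := by
  obtain ⟨m, rfl⟩ : ∃ m, k = m + 2 := ⟨k - 2, by omega⟩
  have h1 := sum_range_exchange (monotone_vertexWeight r) (a := a) (b := b) (x := m + 1)
    (y := a + b - (m + 2) + 1) (by omega) (by omega) (by omega)
  rw [Finset.sum_range_succ _ (a + b - (m + 2))] at h1
  have h2 := sum_vertexWeight_of_ge hr (show r ≤ m + 1 by omega)
  have h3 : vertexWeight r (a + b - (m + 2)) ≤ vertexWeight r m :=
    monotone_vertexWeight r (by omega)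
  rw [vertexWeight_of_ge hr (show r ≤ m by omega)] at h3
  have h4 := two_mul_choose_two_le hr (show r + 1 ≤ m by omega)
  obtain ⟨s, rfl⟩ : ∃ s, r = s + 2 := ⟨r - 2, by omega⟩
  simp only [show s + 2 - 1 = s + 1 from rfl, show s + 2 - 2 = s from rfl] at h3 h4
  have h5 := Nat.choose_succ_succ' (m + 1) (s + 1)
  have h6 := Nat.choose_succ_succ' m s
  simp only [show s + 1 + 1 = s + 2 from rfl, show m + 1 + 1 = m + 2 from rfl] at h5
  omega

theorem weightBound_superadditive {r k : ℕ} (hr : 3 ≤ r) (hk : r + 3 ≤ k) (a b : ℕ) :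
    weightBound r k a + weightBound r k b ≤ weightBound r k (a + b) := by
  refine blockSum_superadditive (F := fun n => ∑ j ∈ Finset.range n, vertexWeight r j) (by omega)
    ?_ ?_ a b
  · intro a b _
    have := sum_range_exchange (monotone_vertexWeight r) (a := a) (b := b) (x := a + b) (y := 0)
      (by omega) (by omega) (by omega)
    simpa using this
  · intro a b ha hb hab
    have := sum_vertexWeight_overflow hr hk ha hb hab
    have : 1 ≤ r.choose 2 := Nat.choose_pos (by omega)
    omega

theorem weightBound_add_of_lt {r k a b : ℕ} (hr : 3 ≤ r) (hk : r + 3 ≤ k) (ha : a < k)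
    (hb : b < k) (hab : k ≤ a + b) :
    weightBound r k a + weightBound r k b + r.choose 2 ≤ weightBound r k (a + b) + 1 := by
  have h := sum_vertexWeight_overflow hr hk ha hb hab
  obtain ⟨c, hc⟩ := Nat.exists_eq_add_of_le hab
  have hck : c < k := by omega
  rw [hc, weightBound_add_self (by omega), weightBound_of_lt ha, weightBound_of_lt hb,
    weightBound_of_lt hck]
  rw [hc, Nat.add_sub_cancel_left] at h
  omega

theorem mul_le_sum_range_add {M : ℕ → ℕ} (hM : Monotone M) (d q : ℕ) :
    q * M d ≤ ∑ j ∈ Finset.range q, M j + d * M d := by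
  rcases le_total q d with h | h
  · exact le_add_left (Nat.mul_le_mul_right _ h)
  · rw [← Finset.sum_range_add_sum_Ico _ h]
    have : (q - d) * M d ≤ ∑ j ∈ Finset.Ico d q, M j := by
      simpa using Finset.card_nsmul_le_sum (Finset.Ico d q) M (M d) (fun j hj => hM (by
        have := Finset.mem_Ico.1 hj; omega))
    have e : q * M d = (q - d) * M d + d * M d := by rw [← Nat.add_mul]; congr 1; omega
    omega

theorem peel_sum_le_weightBound {r k N d n : ℕ} (hr : 3 ≤ r) (hk : r + 3 ≤ k) (hd : 1 ≤ d)
    (hdN : d ≤ N) (hN : N + d + 1 = k) (hn : k ≤ n) :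
    ∑ j ∈ Finset.range N, vertexWeight r j + d * vertexWeight r N + (n - N - d) * vertexWeight r d +
      r.choose 2 ≤ weightBound r k n + 1 := by
  have h1 := peel_sum_le hr hk hd hdN hN
  have hM := monotone_vertexWeight r
  have hr2 : 1 ≤ r.choose 2 := Nat.choose_pos (by omega)
  obtain ⟨s, rfl⟩ := Nat.exists_eq_add_of_le hn
  rw [weightBound_add_self (by omega), show k + s - N - d = s + 1 by omega]
  have h2 : k * vertexWeight r d ≤ k.choose r := by
    have h3 := mul_le_sum_range_add hM d N
    have h4 := Nat.mul_le_mul_left d (hM hdN)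
    have e : k * vertexWeight r d = N * vertexWeight r d + (d + 1) * vertexWeight r d := by
      rw [← Nat.add_mul]; congr 1; omega
    omega
  have h5 : s * vertexWeight r d ≤ weightBound r k s + d * vertexWeight r d := by
    unfold weightBound
    have h6 := mul_le_sum_range_add hM d (s % k)
    have h7 := Nat.mul_le_mul_left (s / k) h2
    have e : s * vertexWeight r d = s / k * (k * vertexWeight r d) + s % k * vertexWeight r d := by
      rw [← Nat.mul_assoc, ← Nat.add_mul]; congr 1
      exact (Nat.div_add_mod' s k).symm
    omega
  simp only [Nat.add_mul] at h1 ⊢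
  omega

theorem weightBound_le {r k n : ℕ} (hr : 3 ≤ r) :
    weightBound r k n + 1 ≤ n / k * k.choose r + (n % k).choose r + r.choose 2 := by
  unfold weightBound
  have : ∑ j ∈ Finset.range (n % k), vertexWeight r j + 1 ≤ (n % k).choose r + r.choose 2 := by
    rcases lt_or_ge (n % k) r with h | h
    · rw [sum_vertexWeight_of_le hr (by omega)]
      have h1 := Nat.choose_le_choose 2 (Nat.le_sub_one_of_lt h)
      obtain ⟨t, rfl⟩ : ∃ t, r = t + 1 := ⟨r - 1, by omega⟩
      have h2 := Nat.choose_succ_succ' t 1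
      rw [Nat.choose_one_right] at h2
      simp only [Nat.add_sub_cancel, show 1 + 1 = 2 from rfl] at h1 h2
      omega
    · rw [sum_vertexWeight_of_ge hr h]
  omega

end Arithmetic

section ListPaths

variable {α : Type*} {R : α → α → Prop}

/-- A path in the relation `R`, given as the list of its vertices. -/
def IsPathList (R : α → α → Prop) (l : List α) : Prop := l.IsChain R ∧ l.Nodup

/-- A closed path in the relation `R`, given as the list of its vertices. -/
def IsCycleList (R : α → α → Prop) (l : List α) : Prop :=
  IsPathList R l ∧ ∀ x ∈ l.getLast?, ∀ y ∈ l.head?, R x y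

theorem isPathList_append {a b : List α} : IsPathList R (a ++ b) ↔
    IsPathList R a ∧ IsPathList R b ∧ a.Disjoint b ∧ ∀ x ∈ a.getLast?, ∀ y ∈ b.head?, R x y := by
  unfold IsPathList
  rw [List.isChain_append, List.nodup_append']
  tauto

theorem IsPathList.reverse (hR : ∀ x y, R x y → R y x) {l : List α} (h : IsPathList R l) :
    IsPathList R l.reverse := by
  refine ⟨?_, List.nodup_reverse.2 h.2⟩
  rw [List.isChain_reverse]
  exact h.1.imp fun x y hxy => hR x y hxy

theorem IsPathList.take {l : List α} (h : IsPathList R l) (i : ℕ) : IsPathList R (l.take i) :=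
  ⟨h.1.take i, h.2.sublist (List.take_sublist i l)⟩

theorem IsPathList.drop {l : List α} (h : IsPathList R l) (i : ℕ) : IsPathList R (l.drop i) :=
  ⟨h.1.drop i, h.2.sublist (List.drop_sublist i l)⟩

theorem isPathList_cons {x : α} {l : List α} : IsPathList R (x :: l) ↔
    IsPathList R l ∧ x ∉ l ∧ ∀ y ∈ l.head?, R x y := by
  unfold IsPathList
  rw [List.isChain_cons, List.nodup_cons]
  tauto

theorem isPathList_singleton (x : α) : IsPathList R [x] := by
  simp [IsPathList]

theorem IsCycleList.comm_append {a b : List α} (h : IsCycleList R (a ++ b)) :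
    IsCycleList R (b ++ a) := by
  rcases eq_or_ne a [] with rfl | ha
  · simpa using h
  rcases eq_or_ne b [] with rfl | hb
  · simpa using h
  obtain ⟨h1, h2⟩ := h
  rw [isPathList_append] at h1
  refine ⟨isPathList_append.2 ⟨h1.2.1, h1.1, h1.2.2.1.symm, ?_⟩, ?_⟩
  · intro x hx y hy
    exact h2 x (by simp_all) y (by simp_all)
  · intro x hx y hy
    exact h1.2.2.2 x (by simp_all) y (by simp_all)

theorem IsCycleList.reverse (hR : ∀ x y, R x y → R y x) {l : List α} (h : IsCycleList R l) :
    IsCycleList R l.reverse := by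
  refine ⟨h.1.reverse hR, ?_⟩
  intro x hx y hy
  exact hR _ _ (h.2 y (by simpa using hy) x (by simpa using hx))

theorem IsCycleList.exists_cons {l : List α} (h : IsCycleList R l) {y : α} (hy : y ∈ l) :
    ∃ l', IsCycleList R (y :: l') ∧ (y :: l').Perm l := by
  obtain ⟨s, t, rfl⟩ := List.append_of_mem hy
  exact ⟨t ++ s, h.comm_append, by simpa using List.perm_append_comm (l₁ := y :: t) (l₂ := s)⟩

theorem eq_getElem_of_mem_head?_drop {l : List α} {i : ℕ} {y : α} (h : y ∈ (l.drop i).head?)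
    (hi : i < l.length) : y = l[i] := by
  rw [List.head?_drop, List.getElem?_eq_getElem hi] at h
  simpa using h.symm

theorem eq_getElem_of_mem_getLast?_take {l : List α} {i : ℕ} {y : α}
    (h : y ∈ (l.take i).getLast?) (h0 : 0 < i) (hi : i ≤ l.length) :
    y = l[i - 1]'(by omega) := by
  rw [List.getLast?_take, if_neg (by omega), List.getElem?_eq_getElem (by omega)] at h
  simpa using h.symm

theorem eq_getElem_of_mem_head?_take {l : List α} {i : ℕ} {y : α}
    (h : y ∈ (l.take i).head?) (hi : 0 < l.length) : y = l[0] := by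
  have h2 : (l.take i).head? = if i = 0 then none else l.head? := List.head?_take
  rw [h2] at h
  split_ifs at h
  · simp at h
  · rw [List.head?_eq_getElem?, List.getElem?_eq_getElem hi] at h
    simpa using h.symm

theorem eq_getElem_of_mem_getLast?_drop {l : List α} {i : ℕ} {y : α}
    (h : y ∈ (l.drop i).getLast?) (hi : i < l.length) : y = l[l.length - 1]'(by omega) := by
  rw [List.getLast?_drop, if_neg (by omega), List.getLast?_eq_getElem?,
    List.getElem?_eq_getElem (by omega)] at h
  simpa using h.symm

theorem IsPathList.rotate (hR : ∀ x y, R x y → R y x) {l : List α} (h : IsPathList R l)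
    {i : ℕ} (hi : i < l.length) (hri : R (l[0]'(by omega)) l[i]) :
    IsPathList R ((l.take i).reverse ++ l.drop i) := by
  have h' := h
  rw [← List.take_append_drop i l, isPathList_append] at h'
  refine isPathList_append.2 ⟨h'.1.reverse hR, h'.2.1, ?_, ?_⟩
  · intro x hx
    exact h'.2.2.1 (by simpa using hx)
  · intro x hx y hy
    rw [List.getLast?_reverse] at hx
    rw [eq_getElem_of_mem_head?_take hx (by omega), eq_getElem_of_mem_head?_drop hy hi]
    exact hri

theorem IsPathList.cycle_of_crossing (hR : ∀ x y, R x y → R y x) {l : List α}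
    (h : IsPathList R l) {i j : ℕ} (hi : 0 < i) (hij : i ≤ j) (hj : j < l.length)
    (h1 : R (l[0]'(by omega)) l[j]) (h2 : R (l[i - 1]'(by omega)) (l[l.length - 1]'(by omega))) :
    IsCycleList R (l.drop j ++ (l.take i).reverse) := by
  refine ⟨isPathList_append.2 ⟨h.drop j, (h.take i).reverse hR, ?_, ?_⟩, ?_⟩
  · have := h.2
    rw [← List.take_append_drop j l, List.nodup_append'] at this
    intro x hx hx'
    refine this.2.2 ?_ hx
    rw [List.mem_reverse] at hx'
    exact (List.take_subset_take_left l hij) hx'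
  · intro x hx y hy
    rw [List.head?_reverse] at hy
    rw [eq_getElem_of_mem_getLast?_drop hx hj, eq_getElem_of_mem_getLast?_take hy hi (by omega)]
    exact hR _ _ h2
  · intro x hx y hy
    rw [List.getLast?_append_of_ne_nil _ (by simp; grind), List.getLast?_reverse] at hx
    rw [List.head?_append_of_ne_nil _ (by simp; omega)] at hy
    rw [eq_getElem_of_mem_head?_take hx (by omega), eq_getElem_of_mem_head?_drop hy hj]
    exact h1

end ListPaths

section GraphWeight

variable {α : Type*} [DecidableEq α] {R : α → α → Prop} [DecidableRel R]

theorem weight_le_sum_range {w : Finset α → ℕ} {M : ℕ → ℕ} (hM : Monotone M) (hw0 : w ∅ = 0)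
    (hirr : ∀ x, ¬ R x x)
    (hpeel : ∀ W v, v ∈ W → w W ≤ w (W.erase v) + M (W.filter (R v)).card) (W : Finset α) :
    w W ≤ ∑ j ∈ Finset.range W.card, M j := by
  induction W using Finset.induction_on with
  | empty => simp [hw0]
  | insert v W hv ih =>
    have h := hpeel (insert v W) v (Finset.mem_insert_self v W)
    rw [Finset.erase_insert hv] at h
    rw [Finset.card_insert_of_notMem hv, Finset.sum_range_succ]
    have h2 : ((insert v W).filter (R v)).card ≤ W.card := by
      apply Finset.card_le_card
      intro x hx
      rw [Finset.mem_filter, Finset.mem_insert] at hx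
      rcases hx.1 with rfl | h
      · exact absurd hx.2 (hirr _)
      · exact h
    have := hM h2
    omega

theorem weight_le_sdiff_add {w : Finset α → ℕ} {M : ℕ → ℕ} (hM : Monotone M)
    (hpeel : ∀ W v, v ∈ W → w W ≤ w (W.erase v) + M (W.filter (R v)).card) (W T : Finset α)
    (hT : T ⊆ W) (hind : ∀ x ∈ T, ∀ y ∈ T, ¬ R x y) :
    w W ≤ w (W \ T) + T.card * M (W.card - T.card) := by
  suffices H : ∀ S ⊆ T, w W ≤ w (W \ S) + S.card * M (W.card - T.card) from H T subset_rfl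
  intro S
  induction S using Finset.induction_on with
  | empty => simp
  | insert v S hv ih =>
    intro hS
    have hvT : v ∈ T := hS (Finset.mem_insert_self v S)
    have hST : S ⊆ T := (Finset.subset_insert v S).trans hS
    have h1 := ih hST
    have h2 := hpeel (W \ S) v (Finset.mem_sdiff.2 ⟨hT hvT, hv⟩)
    have h3 : (W \ S).erase v = W \ insert v S := by
      ext x; simp only [Finset.mem_erase, Finset.mem_sdiff, Finset.mem_insert]; tauto
    have h4 : ((W \ S).filter (R v)).card ≤ W.card - T.card := by
      rw [← Finset.card_sdiff_of_subset hT]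
      apply Finset.card_le_card
      intro x hx
      rw [Finset.mem_filter, Finset.mem_sdiff] at hx
      exact Finset.mem_sdiff.2 ⟨hx.1.1, fun hxT => hind v hvT x hxT hx.2⟩
    rw [h3] at h2
    have h5 := hM h4
    rw [Finset.card_insert_of_notMem hv, Nat.succ_mul]
    omega

theorem exists_cycle_of_degree (hR : ∀ x y, R x y → R y x) {u : α} {m : List α}
    (h : IsPathList R (u :: m)) (hd : 1 ≤ (m.toFinset.filter (R u)).card) :
    ∃ C, IsCycleList R C ∧ (∀ x ∈ C, x ∈ u :: m) ∧
      (m.toFinset.filter (R u)).card + 1 ≤ C.length := by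
  induction m using List.reverseRecOn with
  | nil => simp at hd
  | append_singleton m a ih =>
    by_cases hua : R u a
    · refine ⟨u :: (m ++ [a]), ⟨h, ?_⟩, fun x hx => hx, ?_⟩
      · intro x hx y hy
        simp only [List.head?_cons, Option.mem_def, Option.some.injEq] at hy
        rw [← List.cons_append, List.getLast?_concat] at hx
        simp only [Option.mem_def, Option.some.injEq] at hx
        subst hx hy
        exact hR _ _ hua
      · have h1 := Finset.card_filter_le ((m ++ [a]).toFinset) (R u)
        have h2 := List.toFinset_card_le (m ++ [a])
        simp only [List.length_cons]
        omega
    · have e : (m ++ [a]).toFinset.filter (R u) = m.toFinset.filter (R u) := by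
        ext x
        simp only [Finset.mem_filter, List.mem_toFinset, List.mem_append, List.mem_singleton]
        constructor
        · rintro ⟨h1 | rfl, h2⟩
          · exact ⟨h1, h2⟩
          · exact absurd h2 hua
        · rintro ⟨h1, h2⟩
          exact ⟨Or.inl h1, h2⟩
      rw [e] at hd ⊢
      rw [← List.cons_append, isPathList_append] at h
      obtain ⟨C, h1, h2, h3⟩ := ih h.1 hd
      refine ⟨C, h1, fun x hx => ?_, h3⟩
      have := h2 x hx
      simp only [List.mem_cons, List.mem_append] at this ⊢
      tauto

omit [DecidableEq α] [DecidableRel R] in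
theorem exists_crossing_of_chain {l : List α} (X : α → Prop) (h : l.IsChain R) {x : α} (hx : x ∈ l)
    (hxX : X x) (hlast : ∀ y ∈ l.getLast?, ¬ X y) :
    ∃ a ∈ l, ∃ b ∈ l, X a ∧ ¬ X b ∧ R a b := by
  induction l generalizing x with
  | nil => simp at hx
  | cons c l ih =>
    cases l with
    | nil =>
      simp only [List.mem_singleton] at hx
      subst hx
      exact absurd hxX (hlast x (by simp))
    | cons d l =>
      rw [List.isChain_cons_cons] at h
      by_cases hc : X c ∧ ¬ X d
      · exact ⟨c, by simp, d, by simp, hc.1, hc.2, h.1⟩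
      · have hx' : ∃ x' ∈ d :: l, X x' := by
          rcases List.mem_cons.1 hx with rfl | hx
          · refine ⟨d, by simp, ?_⟩
            tauto
          · exact ⟨x, hx, hxX⟩
        obtain ⟨x', h1, h2⟩ := hx'
        obtain ⟨a, ha, b, hb, h3⟩ := ih h.2 h1 h2 (by simpa using hlast)
        exact ⟨a, List.mem_cons_of_mem _ ha, b, List.mem_cons_of_mem _ hb, h3⟩

/-- A positive integer `d` for which the closed path `C` splits into at least `d` vertices and
an independent set of at most `d` further vertices, relative to the length bound `k`. -/
def IsPeelDegree (R : α → α → Prop) (k : ℕ) (C : List α) (d : ℕ) : Prop :=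
  1 ≤ d ∧ 2 * d + 1 ≤ k ∧ ∃ T ⊆ C.toFinset, (∀ x ∈ T, ∀ y ∈ T, ¬ R x y) ∧
    d + T.card ≤ C.length ∧ C.length + d + 1 ≤ k + T.card ∧ T.card ≤ d

omit [DecidableEq α] [DecidableRel R] in
theorem exists_longest_path (P : List α → Prop) (B : ℕ) (hB : ∀ l, P l → l.length ≤ B)
    (hne : ∃ l, P l) : ∃ l, P l ∧ ∀ l', P l' → l'.length ≤ l.length := by
  classical
  obtain ⟨l0, h0⟩ := hne
  have hex : ∃ n, ∃ l, P l ∧ l.length + n = B := ⟨B - l0.length, l0, h0, by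
    have := hB l0 h0; omega⟩
  obtain ⟨l, h1, h2⟩ := Nat.find_spec hex
  refine ⟨l, h1, fun l' h' => ?_⟩
  have h3 := Nat.find_min' hex ⟨l', h', Nat.add_sub_of_le (hB l' h')⟩
  have := hB l' h'
  omega

end GraphWeight

section
variable {α : Type*} [DecidableEq α] {R : α → α → Prop} [DecidableRel R]

theorem two_mul_card_le_of_no_consecutive {I : Finset ℕ} {A B : ℕ} (hI : ∀ i ∈ I, A ≤ i ∧ i + 1 ≤ B)
    (hcons : ∀ i ∈ I, i + 1 ∉ I) : 2 * I.card ≤ B + 1 - A := by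
  have h1 : Disjoint I (I.image (· + 1)) := by
    rw [Finset.disjoint_left]
    intro i hi hi'
    obtain ⟨j, hj, rfl⟩ := Finset.mem_image.1 hi'
    exact hcons j hj hi
  have h2 : I ∪ I.image (· + 1) ⊆ Finset.Ico A (B + 1) := by
    intro i hi
    rw [Finset.mem_Ico]
    rcases Finset.mem_union.1 hi with hi | hi
    · have := hI i hi; omega
    · obtain ⟨j, hj, rfl⟩ := Finset.mem_image.1 hi
      have := hI j hj; omega
  have h3 := Finset.card_le_card h2
  rw [Finset.card_union_of_disjoint h1, Finset.card_image_of_injective _ (add_left_injective 1),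
    Nat.card_Ico] at h3
  omega

omit [DecidableEq α] [DecidableRel R] in
theorem IsCycleList.insert_path {a b q : List α}
    (h : IsCycleList R (a ++ b)) (hq : IsPathList R q) (hdis : (a ++ b).Disjoint q)
    (h1 : ∀ x ∈ b.getLast?, ∀ y ∈ q.head?, R x y) (hb : b ≠ []) :
    IsPathList R (a ++ b ++ q) := by
  refine isPathList_append.2 ⟨h.1, hq, hdis, ?_⟩
  intro x hx y hy
  rw [List.getLast?_append_of_ne_nil _ hb] at hx
  exact h1 x hx y hy

omit [DecidableRel R] in
theorem exists_isPeelDegree_of_two_nbrs (hR : ∀ x y, R x y → R y x) (hirr : ∀ x, ¬ R x x)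
    {k : ℕ} {C l : List α} {u y : α} {D : Finset α}
    (hC : IsCycleList R (y :: C)) (hl : IsPathList R (u :: l))
    (hdisj : (y :: C).Disjoint (u :: l)) (hy : ∀ x ∈ (u :: l).getLast?, R x y)
    (hmax : ∀ C', IsCycleList R C' → (∀ x ∈ C', x ∈ y :: C ∨ x ∈ u :: l) →
      C'.length ≤ (y :: C).length)
    (hlen : (y :: C).length + (u :: l).length ≤ k)
    (hD : ∀ x ∈ D, R u x ∧ (x ∈ y :: C ∨ x ∈ l))
    (ha : ∃ a ∈ D, a ∈ C) (hd : 1 ≤ D.card) :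
    IsPeelDegree R k (y :: C) D.card := by
  set Z := y :: C with hZ
  set c := Z.length with hc
  set p := (u :: l).length with hp
  have hp1 : p = l.length + 1 := by simp [hp]
  have hc1 : c = C.length + 1 := by simp [hc, hZ]
  have hZ0 : ∀ h : 0 < Z.length, Z[0] = y := fun h => by simp [hZ]
  have hZn : Z.Nodup := hC.1.2
  set I := (Finset.range c).filter (fun i => Z.getD i y ∈ D) with hI
  have hget : ∀ i (h : i < c), Z.getD i y = Z[i] := fun i h => by
    rw [List.getD_eq_getElem?_getD, List.getElem?_eq_getElem h]; rfl
  have hIc : ∀ i ∈ I, ∃ h : i < c, Z[i] ∈ D := fun i hi => by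
    rw [hI, Finset.mem_filter, Finset.mem_range] at hi
    exact ⟨hi.1, hget i hi.1 ▸ hi.2⟩
  have hrev : IsPathList R (u :: l).reverse := hl.reverse hR
  have hdisr : Z.Disjoint (u :: l).reverse := fun x h1 h2 => hdisj h1 (List.mem_reverse.1 h2)
  have F1 : ∀ i ∈ I, 1 ≤ i → p + 1 ≤ i ∧ i + 1 + p ≤ c := by
    intro i hi h1
    obtain ⟨hic, hiD⟩ := hIc i hi
    have hadj := (hD _ hiD).1
    constructor
    · have hcyc : IsCycleList R (Z.drop i ++ [y] ++ (u :: l).reverse) := by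
        have hz : IsPathList R (Z.drop i ++ Z.take 1) := by
          refine isPathList_append.2 ⟨hC.1.drop i, hC.1.take 1, ?_, ?_⟩
          · intro x hx hx'
            have := hZn
            rw [← List.take_append_drop i Z, List.nodup_append'] at this
            exact this.2.2 (List.take_subset_take_left Z h1 hx') hx
          · intro x hx x' hx'
            refine hC.2 x ?_ x' ?_
            · rw [List.getLast?_drop, if_neg (by omega)] at hx
              exact hx
            · simpa [hZ] using hx'
        have hz1 : Z.take 1 = [y] := by simp [hZ]
        rw [hz1] at hz
        refine ⟨isPathList_append.2 ⟨hz, hrev, ?_, ?_⟩, ?_⟩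
        · intro x hx hx'
          refine hdisr (a := x) ?_ hx'
          rcases List.mem_append.1 hx with hx | hx
          · exact List.mem_of_mem_drop hx
          · simp only [List.mem_singleton] at hx
            simp [hZ, hx]
        · intro x hx x' hx'
          rw [List.getLast?_concat] at hx
          rw [List.head?_reverse] at hx'
          simp only [Option.mem_def, Option.some.injEq] at hx
          subst hx
          exact hR _ _ (hy x' hx')
        · intro x hx x' hx'
          rw [List.getLast?_append_of_ne_nil _ (by simp), List.getLast?_reverse] at hx
          rw [List.append_assoc, List.head?_append_of_ne_nil _ (by simp; omega)] at hx'
          simp only [List.head?_cons, Option.mem_def, Option.some.injEq] at hx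
          rw [eq_getElem_of_mem_head?_drop hx' hic, ← hx]
          exact hadj
      have := hmax _ hcyc (by
        intro x hx
        simp only [List.mem_append, List.mem_reverse, List.mem_singleton] at hx
        rcases hx with (hx | hx) | hx
        · exact Or.inl (List.mem_of_mem_drop hx)
        · left; simp [hZ, hx]
        · exact Or.inr hx)
      simp only [List.length_append, List.length_drop, List.length_reverse, List.length_singleton]
        at this
      omega
    · have hcyc : IsCycleList R ((Z.take (i + 1)).reverse ++ (u :: l).reverse) := by
        refine ⟨isPathList_append.2 ⟨(hC.1.take _).reverse hR, hrev, ?_, ?_⟩, ?_⟩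
        · intro x hx hx'
          exact hdisr (List.mem_of_mem_take (List.mem_reverse.1 hx)) hx'
        · intro x hx x' hx'
          rw [List.getLast?_reverse] at hx
          rw [List.head?_reverse] at hx'
          rw [eq_getElem_of_mem_head?_take hx (by omega), hZ0]
          exact hR _ _ (hy x' hx')
        · intro x hx x' hx'
          rw [List.getLast?_append_of_ne_nil _ (by simp), List.getLast?_reverse] at hx
          rw [List.head?_append_of_ne_nil _ (by simp), List.head?_reverse] at hx'
          simp only [List.head?_cons, Option.mem_def, Option.some.injEq] at hx
          rw [eq_getElem_of_mem_getLast?_take hx' (by omega) (by omega), ← hx]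
          simpa using hadj
      have := hmax _ hcyc (by
        intro x hx
        simp only [List.mem_append, List.mem_reverse] at hx
        rcases hx with hx | hx
        · exact Or.inl (List.mem_of_mem_take hx)
        · exact Or.inr hx)
      simp only [List.length_append, List.length_take, List.length_reverse] at this
      omega
  have hpath : ∀ i ∈ I, i + 1 < c → IsPathList R (Z.drop (i + 1) ++ Z.take (i + 1) ++ [u]) := by
    intro i hi hic
    obtain ⟨_, hiD⟩ := hIc i hi
    have hrot : IsCycleList R (Z.drop (i + 1) ++ Z.take (i + 1)) := by
      apply IsCycleList.comm_append
      rwa [List.take_append_drop]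
    refine hrot.insert_path (isPathList_singleton u) ?_ ?_ (by simp)
    · intro x hx hx'
      simp only [List.mem_singleton] at hx'
      subst hx'
      refine hdisj (a := x) ?_ (by simp)
      rcases List.mem_append.1 hx with hx | hx
      · exact List.mem_of_mem_drop hx
      · exact List.mem_of_mem_take hx
    · intro x hx x' hx'
      rw [eq_getElem_of_mem_getLast?_take hx (by omega) (by omega)]
      simp only [List.head?_cons, Option.mem_def, Option.some.injEq] at hx'
      subst hx'
      exact hR _ _ (by simpa using (hD _ hiD).1)
  have hpm : ∀ i x, x ∈ Z.drop (i + 1) ++ Z.take (i + 1) ++ [u] → x ∈ Z ∨ x ∈ u :: l := by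
    intro i x hx
    simp only [List.mem_append, List.mem_singleton] at hx
    rcases hx with (hx | hx) | hx
    · exact Or.inl (List.mem_of_mem_drop hx)
    · exact Or.inl (List.mem_of_mem_take hx)
    · right; simp [hx]
  have hpl : ∀ i, i + 1 < c → (Z.drop (i + 1) ++ Z.take (i + 1) ++ [u]).length = c + 1 := by
    intro i hi
    simp only [List.length_append, List.length_drop, List.length_take, List.length_singleton]
    omega
  have F2 : ∀ i ∈ I, i + 1 ∉ I := by
    intro i hi hi'
    obtain ⟨hic, hiD⟩ := hIc _ hi'
    have := hmax _ ⟨hpath i hi hic, by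
      intro x hx x' hx'
      rw [List.getLast?_concat] at hx
      rw [List.append_assoc, List.head?_append_of_ne_nil _ (by simp; omega)] at hx'
      simp only [Option.mem_def, Option.some.injEq] at hx
      rw [eq_getElem_of_mem_head?_drop hx' hic, ← hx]
      exact (hD _ hiD).1⟩ (hpm i)
    rw [hpl i hic] at this
    omega
  have F3 : ∀ i ∈ I, ∀ j ∈ I, ∀ _ : i < j, ∀ hj1 : j + 1 < c, ¬ R (Z[i + 1]'(by omega)) Z[j + 1] := by
    intro i hi j hj hij hj1 hadj
    obtain ⟨hjc, hjD⟩ := hIc _ hj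
    have h0 := hpath i hi (by omega)
    have hL := hpl i (by omega)
    have := hmax _ (h0.cycle_of_crossing hR (i := j - i) (j := j - i) (by omega) le_rfl (by omega) ?_ ?_) ?_
    · simp only [List.length_append, List.length_drop, List.length_take, List.length_singleton,
        List.length_reverse] at this
      omega
    · rw [List.getElem_append_left (by simp; omega), List.getElem_append_left (by simp; omega),
        List.getElem_append_left (by simp; omega), List.getElem_append_left (by simp; omega)]
      simp only [List.getElem_drop]
      convert hadj using 2
      omega
    · rw [List.getElem_append_left (by simp; omega), List.getElem_append_left (by simp; omega),
        List.getElem_append_right (by simp)]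
      simp only [List.getElem_drop, List.getElem_singleton]
      have e : i + 1 + (j - i - 1) = j := by omega
      simp only [e]
      exact hR _ _ (hD _ hjD).1
    · intro x hx
      apply hpm i
      rcases List.mem_append.1 hx with hx | hx
      · exact List.mem_of_mem_drop hx
      · exact List.mem_of_mem_take (List.mem_reverse.1 hx)
  obtain ⟨a, haD, haC⟩ := ha
  obtain ⟨i0, hi0, hi0a⟩ := List.getElem_of_mem haC
  have hi0I : i0 + 1 ∈ I := by
    rw [hI, Finset.mem_filter, Finset.mem_range, hget _ (by omega)]
    refine ⟨by omega, ?_⟩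
    simp only [hZ, List.getElem_cons_succ, hi0a, haD]
  have F4 : ∀ i ∈ I, i + 1 < c := by
    intro i hi
    have h1 := F1 _ hi0I (by omega)
    rcases Nat.eq_zero_or_pos i with h | h
    · omega
    · have := F1 i hi h; omega
  have hinj : ∀ i j, i < c → j < c → Z.getD i y = Z.getD j y → i = j := by
    intro i j hi hj h
    rw [hget i hi, hget j hj] at h
    exact (List.Nodup.getElem_inj_iff hZn).1 h
  set T := I.image (fun i => Z.getD (i + 1) y) with hT
  have hTc : T.card = I.card := by
    apply Finset.card_image_of_injOn
    intro i hi j hj h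
    have := hinj _ _ (F4 i hi) (F4 j hj) h
    omega
  have hIbound : 2 * (I.erase 0).card ≤ (c - p) + 1 - (p + 1) := by
    apply two_mul_card_le_of_no_consecutive
    · intro i hi
      rw [Finset.mem_erase] at hi
      have := F1 i hi.2 (by omega)
      omega
    · intro i hi hi'
      exact F2 i (Finset.mem_of_mem_erase hi) (Finset.mem_of_mem_erase hi')
  have hIe : I.card ≤ (I.erase 0).card + 1 := by
    have := Finset.pred_card_le_card_erase (s := I) (a := 0)
    omega
  have hDI : D.card ≤ I.card + (p - 1) := by
    have h1 : D ⊆ I.image (fun i => Z.getD i y) ∪ l.toFinset := by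
      intro x hx
      rw [Finset.mem_union, List.mem_toFinset]
      rcases (hD x hx).2 with h | h
      · left
        obtain ⟨i, hi, rfl⟩ := List.getElem_of_mem h
        refine Finset.mem_image.2 ⟨i, ?_, hget i hi⟩
        rw [hI, Finset.mem_filter, Finset.mem_range, hget i hi]
        exact ⟨hi, hx⟩
      · exact Or.inr h
    have h2 := Finset.card_le_card h1
    have h3 := Finset.card_union_le (I.image (fun i => Z.getD i y)) l.toFinset
    have h4 : (I.image (fun i => Z.getD i y)).card ≤ I.card := Finset.card_image_le
    have h5 := List.toFinset_card_le l
    omega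
  have hID : I.card ≤ D.card := by
    apply Finset.card_le_card_of_injOn (fun i => Z.getD i y)
    · intro i hi
      exact (Finset.mem_filter.1 hi).2
    · intro i hi j hj h
      obtain ⟨h1, _⟩ := hIc i hi
      obtain ⟨h2, _⟩ := hIc j hj
      exact hinj _ _ h1 h2 h
  have hb := F1 _ hi0I (by omega)
  refine ⟨hd, by omega, T, ?_, ?_, by omega, by omega, by omega⟩
  · intro x hx
    obtain ⟨i, hi, rfl⟩ := Finset.mem_image.1 hx
    rw [List.mem_toFinset, hget _ (F4 i hi)]
    exact List.getElem_mem _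
  · intro x hx x' hx'
    obtain ⟨i, hi, rfl⟩ := Finset.mem_image.1 hx
    obtain ⟨j, hj, rfl⟩ := Finset.mem_image.1 hx'
    rw [hget _ (F4 i hi), hget _ (F4 j hj)]
    rcases lt_trichotomy i j with h | h | h
    · exact F3 i hi j hj h (F4 j hj)
    · subst h; exact hirr _
    · exact fun hh => F3 j hj i hi h (F4 i hi) (hR _ _ hh)
end

section
variable {α : Type*} [DecidableEq α] {R : α → α → Prop} [DecidableRel R]

theorem exists_isPeelDegree_vertex (hR : ∀ x y, R x y → R y x) (hirr : ∀ x, ¬ R x x)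
    {k : ℕ} {C : List α} {U : Finset α} (hCU : ∀ x ∈ C, x ∈ U) (hC : IsCycleList R C)
    (hmax : ∀ C', IsCycleList R C' → (∀ x ∈ C', x ∈ U) → C'.length ≤ C.length)
    (hpath : ∀ l, IsPathList R l → (∀ x ∈ l, x ∈ U) → l.length ≤ k)
    (hatt : ∀ X ⊆ U, X.Nonempty → (∀ x ∈ X, x ∉ C) → ∃ x ∈ X, ∃ y ∈ U \ X, R x y)
    (hne : ∃ x ∈ U, x ∉ C) :
    ∃ u ∈ U, u ∉ C ∧ IsPeelDegree R k C (U.filter (R u)).card ∧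
      ∀ X ⊆ U.erase u, X.Nonempty → (∀ x ∈ X, x ∉ C) → ∃ x ∈ X, ∃ y ∈ U.erase u \ X, R x y := by
  let P : List α → Prop := fun l => IsPathList R l ∧ (∀ x ∈ l, x ∈ U ∧ x ∉ C) ∧
    ∃ x ∈ l.getLast?, ∃ y ∈ C, R x y
  obtain ⟨l, ⟨hl, hlU, z, hz, y, hyC, hzy⟩, hlmax⟩ := exists_longest_path P k
    (fun l h => hpath l h.1 fun x hx => (h.2.1 x hx).1) (by
      obtain ⟨x0, hx0U, hx0C⟩ := hne
      obtain ⟨x, hx, y, hy, hxy⟩ := hatt (U.filter (· ∉ C)) (Finset.filter_subset _ _)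
        ⟨x0, by simp [hx0U, hx0C]⟩ (fun x hx => (Finset.mem_filter.1 hx).2)
      rw [Finset.mem_filter] at hx
      simp only [Finset.mem_sdiff, Finset.mem_filter, not_and, not_not] at hy
      exact ⟨[x], isPathList_singleton x, by simpa using hx, x, by simp, y, hy.2 hy.1, hxy⟩)
  obtain ⟨C', hC', hperm⟩ := hC.exists_cons hyC
  have hmem : ∀ x, x ∈ y :: C' ↔ x ∈ C := fun x => hperm.mem_iff
  cases l with
  | nil => simp at hz
  | cons u l =>
  have hy : ∀ x ∈ (u :: l).getLast?, R x y := by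
    intro x hx
    rw [Option.mem_unique hx hz]
    exact hzy
  have huU := hlU u (by simp)
  have hnb : ∀ x ∈ U, R u x → x ∈ C ∨ x ∈ l := by
    intro x hx hux
    by_contra hcon
    push Not at hcon
    have hxu : x ≠ u := by
      rintro rfl
      exact hirr _ hux
    have := hlmax (x :: u :: l) ⟨isPathList_cons.2 ⟨hl, by simp [hxu, hcon.2], by simpa using hR _ _ hux⟩, by
      intro x' hx'
      rcases List.mem_cons.1 hx' with rfl | hx'
      · exact ⟨hx, hcon.1⟩
      · exact hlU x' hx', z, by simpa using hz, y, hyC, hzy⟩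
    simp at this
  have hdisj : (y :: C').Disjoint (u :: l) := fun x h1 h2 => (hlU x h2).2 ((hmem x).1 h1)
  have hmax' : ∀ C'', IsCycleList R C'' → (∀ x ∈ C'', x ∈ y :: C' ∨ x ∈ u :: l) →
      C''.length ≤ (y :: C').length := by
    intro C'' h1 h2
    rw [hperm.length_eq]
    refine hmax C'' h1 fun x hx => ?_
    rcases h2 x hx with h | h
    · exact hCU x ((hmem x).1 h)
    · exact (hlU x h).1
  have hrevl : IsPathList R ((u :: l) ++ (y :: C')) := by
    refine isPathList_append.2 ⟨hl, hC'.1, fun x h1 h2 => hdisj h2 h1, ?_⟩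
    intro x hx x' hx'
    simp only [List.head?_cons, Option.mem_def, Option.some.injEq] at hx'
    subst hx'
    exact hy x hx
  have hlen : (y :: C').length + (u :: l).length ≤ k := by
    have := hpath _ hrevl (by
      intro x hx
      rcases List.mem_append.1 hx with h | h
      · exact (hlU x h).1
      · exact hCU x ((hmem x).1 h))
    rw [List.length_append] at this
    omega
  have hly : IsPathList R (u :: (l ++ [y])) := by
    have h1 := hrevl.take (l.length + 2)
    rw [List.take_append] at h1
    simpa [List.take_of_length_le] using h1
  have hnext : ∃ x ∈ l ++ [y], R u x := by
    cases l with
    | nil => exact ⟨y, by simp, hy u (by simp)⟩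
    | cons b l => exact ⟨b, by simp, (List.isChain_cons_cons.1 hl.1).1⟩
  have hyU : y ∈ U := hCU y hyC
  have hyl : ∀ x ∈ l ++ [y], x ∈ U.erase u := by
    intro x hx
    have hxu : x ≠ u := by
      rintro rfl
      exact (isPathList_cons.1 hly).2.1 hx
    refine Finset.mem_erase.2 ⟨hxu, ?_⟩
    rcases List.mem_append.1 hx with h | h
    · exact (hlU x (List.mem_cons_of_mem _ h)).1
    · rw [List.mem_singleton.1 h]; exact hyU
  have hd : 1 ≤ (U.filter (R u)).card := by
    obtain ⟨x, hx, hux⟩ := hnext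
    exact Finset.card_pos.2 ⟨x, Finset.mem_filter.2 ⟨Finset.mem_of_mem_erase (hyl x hx), hux⟩⟩
  refine ⟨u, huU.1, huU.2, ?_, ?_⟩
  · by_cases hB : ∃ a ∈ U.filter (R u), a ∈ C'
    · have := exists_isPeelDegree_of_two_nbrs hR hirr (k := k) hC' hl hdisj hy hmax' hlen
        (D := U.filter (R u)) (by
          intro x hx
          rw [Finset.mem_filter] at hx
          rw [hmem]
          exact ⟨hx.2, hnb x hx.1 hx.2⟩) hB hd
      obtain ⟨h1, h2, T, hT, h3, h4, h5, h6⟩ := this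
      rw [hperm.length_eq] at h4 h5
      refine ⟨h1, h2, T, ?_, h3, h4, h5, h6⟩
      intro x hx
      have := hT hx
      rw [List.mem_toFinset] at this ⊢
      exact (hmem x).1 this
    · push Not at hB
      have hsub : U.filter (R u) ⊆ (l ++ [y]).toFinset.filter (R u) := by
        intro x hx
        have hx' := Finset.mem_filter.1 hx
        refine Finset.mem_filter.2 ⟨?_, hx'.2⟩
        rw [List.mem_toFinset, List.mem_append, List.mem_singleton]
        rcases hnb x hx'.1 hx'.2 with h | h
        · rw [← hmem, List.mem_cons] at h
          rcases h with h | h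
          · exact Or.inr h
          · exact absurd h (hB x hx)
        · exact Or.inl h
      have hsub' := Finset.card_le_card hsub
      obtain ⟨C'', h1, h2, h3⟩ := exists_cycle_of_degree hR hly (hd.trans hsub')
      have h4 := hmax C'' h1 (by
        intro x hx
        rcases List.mem_cons.1 (h2 x hx) with rfl | h
        · exact huU.1
        · exact Finset.mem_of_mem_erase (hyl x h))
      have h5 : (U.filter (R u)).card ≤ l.length + 1 := by
        have h6 := Finset.card_filter_le (l ++ [y]).toFinset (R u)
        have h7 := List.toFinset_card_le (l ++ [y])
        simp only [List.length_append, List.length_singleton] at h7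
        omega
      rw [hperm.length_eq, List.length_cons] at hlen
      refine ⟨hd, by omega, ?_⟩
      by_cases hN : C.length + (U.filter (R u)).card + 1 ≤ k
      · exact ⟨∅, by simp, by simp, by simp; omega, by simpa using hN, by simp⟩
      · refine ⟨{y}, by simpa using hyC, by simpa using hirr y, ?_, ?_, ?_⟩ <;>
          simp only [Finset.card_singleton] <;> omega
  · intro X hX hXne hXC
    obtain ⟨x, hx, w, hw, hxw⟩ := hatt X (hX.trans (Finset.erase_subset _ _)) hXne hXC
    rw [Finset.mem_sdiff] at hw
    by_cases hwu : w = u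
    · subst hwu
      have hxU := Finset.mem_erase.1 (hX hx)
      have hxl : x ∈ l := (hnb x hxU.2 (hR _ _ hxw)).resolve_left (hXC x hx)
      obtain ⟨a, ha, b, hb, haX, hbX, hab⟩ := exists_crossing_of_chain (· ∈ X) (isPathList_cons.1 hly).1.1
        (List.mem_append_left _ hxl) hx (by
          intro x' hx'
          rw [List.getLast?_concat] at hx'
          simp only [Option.mem_def, Option.some.injEq] at hx'
          subst hx'
          exact fun h => hXC _ h hyC)
      exact ⟨a, haX, b, Finset.mem_sdiff.2 ⟨hyl b hb, hbX⟩, hab⟩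
    · exact ⟨x, hx, w, Finset.mem_sdiff.2 ⟨Finset.mem_erase.2 ⟨hwu, hw.1⟩, hw.2⟩, hxw⟩

theorem weight_le_of_attached (hR : ∀ x y, R x y → R y x) (hirr : ∀ x, ¬ R x x)
    {w : Finset α → ℕ} {M : ℕ → ℕ} (hM : Monotone M)
    (hpeel : ∀ W v, v ∈ W → w W ≤ w (W.erase v) + M (W.filter (R v)).card)
    {k : ℕ} {C : List α} (hC : IsCycleList R C) (n : ℕ) (U : Finset α)
    (hn : U.card = C.length + n) (hCU : ∀ x ∈ C, x ∈ U)
    (hmax : ∀ C', IsCycleList R C' → (∀ x ∈ C', x ∈ U) → C'.length ≤ C.length)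
    (hpath : ∀ l, IsPathList R l → (∀ x ∈ l, x ∈ U) → l.length ≤ k)
    (hatt : ∀ X ⊆ U, X.Nonempty → (∀ x ∈ X, x ∉ C) → ∃ x ∈ X, ∃ y ∈ U \ X, R x y) :
    w U ≤ w C.toFinset ∧ n = 0 ∨
      ∃ d, IsPeelDegree R k C d ∧ w U ≤ w C.toFinset + n * M d := by
  induction n generalizing U with
  | zero =>
    left
    have : C.toFinset = U := by
      apply Finset.eq_of_subset_of_card_le
      · intro x hx; exact hCU x (List.mem_toFinset.1 hx)
      · rw [List.toFinset_card_of_nodup hC.1.2]; omega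
    rw [this]
    simp
  | succ n ih =>
    right
    obtain ⟨u, huU, huC, hgood, hatt'⟩ := exists_isPeelDegree_vertex hR hirr hCU hC hmax hpath hatt (by
      by_contra hcon
      push Not at hcon
      have h1 : U ⊆ C.toFinset := fun x hx => List.mem_toFinset.2 (hcon x hx)
      have h2 := Finset.card_le_card h1
      rw [List.toFinset_card_of_nodup hC.1.2] at h2
      omega)
    have hp := hpeel U u huU
    have hsub : ∀ x, x ∈ U.erase u → x ∈ U := fun x => Finset.mem_of_mem_erase
    have := ih (U.erase u) (by rw [Finset.card_erase_of_mem huU]; omega)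
      (fun x hx => Finset.mem_erase.2 ⟨fun h => huC (h ▸ hx), hCU x hx⟩)
      (fun C' h1 h2 => hmax C' h1 fun x hx => hsub x (h2 x hx))
      (fun l h1 h2 => hpath l h1 fun x hx => hsub x (h2 x hx)) hatt'
    rcases this with ⟨h1, h2⟩ | ⟨d, hd, h1⟩
    · refine ⟨_, hgood, ?_⟩
      subst h2
      omega
    · rcases le_total d (U.filter (R u)).card with h | h
      · refine ⟨_, hgood, ?_⟩
        have := Nat.mul_le_mul_left n (hM h)
        rw [Nat.succ_mul]
        omega
      · refine ⟨_, hd, ?_⟩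
        have := hM h
        rw [Nat.succ_mul]
        omega

theorem weight_le_of_connected (hR : ∀ x y, R x y → R y x) (hirr : ∀ x, ¬ R x x)
    {w : Finset α → ℕ} {M : ℕ → ℕ} (hM : Monotone M) (hw0 : w ∅ = 0)
    (hpeel : ∀ W v, v ∈ W → w W ≤ w (W.erase v) + M (W.filter (R v)).card)
    {k : ℕ} (hk : 2 ≤ k) (U : Finset α) (hU : k ≤ U.card)
    (hcyc : ∀ C, IsCycleList R C → (∀ x ∈ C, x ∈ U) → C.length + 1 ≤ k)
    (hpath : ∀ l, IsPathList R l → (∀ x ∈ l, x ∈ U) → l.length ≤ k)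
    (hconn : ∀ X ⊆ U, X.Nonempty → X ≠ U → ∃ x ∈ X, ∃ y ∈ U \ X, R x y) :
    ∃ d N, 1 ≤ d ∧ d ≤ N ∧ N + d + 1 = k ∧
      w U ≤ ∑ j ∈ Finset.range N, M j + d * M N + (U.card - N - d) * M d := by
  obtain ⟨C, ⟨hC, hCU⟩, hmax⟩ := exists_longest_path
    (fun C => IsCycleList R C ∧ ∀ x ∈ C, x ∈ U) k (fun C h => by have := hcyc C h.1 h.2; omega)
    ⟨[], by simp [IsCycleList, IsPathList]⟩
  have hc := hcyc C hC hCU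
  have hCne : C ≠ [] := by
    obtain ⟨x, hx⟩ : U.Nonempty := Finset.card_pos.1 (by omega)
    obtain ⟨x', hx', y, hy, hxy⟩ := hconn {x} (by simpa using hx) (by simp) (by
      intro h; rw [← h] at hU; simp at hU; omega)
    rw [Finset.mem_singleton] at hx'
    subst hx'
    rw [Finset.mem_sdiff, Finset.mem_singleton] at hy
    have := hmax [x', y] (by
      simp only [IsCycleList, IsPathList]
      refine ⟨⟨⟨by simpa using hxy, by simp [Ne.symm hy.2]⟩, ?_⟩, ?_⟩
      · simpa using hR _ _ hxy
      · simp [hx, hy.1])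
    rintro rfl
    simp at this
  have hcard : C.length ≤ U.card := by omega
  have hatt : ∀ X ⊆ U, X.Nonempty → (∀ x ∈ X, x ∉ C) → ∃ x ∈ X, ∃ y ∈ U \ X, R x y := by
    intro X hX hne hXC
    refine hconn X hX hne ?_
    rintro rfl
    obtain ⟨y, hy⟩ := List.exists_mem_of_ne_nil C hCne
    exact hXC y (hCU y hy) hy
  rcases weight_le_of_attached hR hirr hM hpeel hC (U.card - C.length) U (by omega) hCU
    (fun C' h1 h2 => hmax C' ⟨h1, h2⟩) hpath hatt with ⟨_, h⟩ | ⟨d, ⟨hd1, hd2, T, hT, hind, h3, h4, h5⟩, hw⟩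
  · omega
  · refine ⟨d, k - 1 - d, hd1, by omega, by omega, ?_⟩
    obtain ⟨N, hN⟩ : ∃ N, N = k - 1 - d := ⟨_, rfl⟩
    rw [← hN]
    have hCc : C.toFinset.card = C.length := List.toFinset_card_of_nodup hC.1.2
    have e1 := weight_le_sdiff_add hM hpeel C.toFinset T hT hind
    have e2 := weight_le_sum_range hM hw0 hirr hpeel (C.toFinset \ T)
    rw [Finset.card_sdiff_of_subset hT] at e2
    rw [hCc] at e1 e2
    obtain ⟨a, ha⟩ : ∃ a, C.length = a + T.card := ⟨C.length - T.card, by omega⟩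
    rw [ha, Nat.add_sub_cancel] at e1 e2
    have haN : a ≤ N := by omega
    have hda : d ≤ a := by omega
    have e3 : ∑ j ∈ Finset.range a, M j + (N - a) * M d ≤ ∑ j ∈ Finset.range N, M j := by
      rw [← Finset.sum_range_add_sum_Ico _ haN]
      apply Nat.add_le_add_left
      have := Finset.card_nsmul_le_sum (Finset.Ico a N) M (M d) (fun j hj => hM (by
        have := Finset.mem_Ico.1 hj; omega))
      simpa using this
    have e4 : T.card * M a + (d - T.card) * M d ≤ d * M N := by
      have h6 := Nat.mul_le_mul_left T.card (hM haN)
      have h7 := Nat.mul_le_mul_left (d - T.card) (hM (hda.trans haN))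
      have h8 : d * M N = T.card * M N + (d - T.card) * M N := by
        rw [← Nat.add_mul]; congr 1; omega
      omega
    have e5 : (U.card - C.length) * M d =
        (N - a) * M d + (d - T.card) * M d + (U.card - N - d) * M d := by
      rw [← Nat.add_mul, ← Nat.add_mul]; congr 1; omega
    omega
end

section
variable {α : Type*} [DecidableEq α] {R : α → α → Prop} [DecidableRel R]

theorem weight_le_weightBound (hR : ∀ x y, R x y → R y x) (hirr : ∀ x, ¬ R x x)
    {r k : ℕ} (hr : 3 ≤ r) (hk : r + 3 ≤ k) {w : Finset α → ℕ} (hw0 : w ∅ = 0)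
    (hpeel : ∀ W v, v ∈ W → w W ≤ w (W.erase v) + vertexWeight r (W.filter (R v)).card)
    (hsplit : ∀ W X, X ⊆ W → (∀ x ∈ X, ∀ y ∈ W \ X, ¬ R x y) → w W ≤ w X + w (W \ X))
    (U : Finset α) (hcyc : ∀ C, IsCycleList R C → (∀ x ∈ C, x ∈ U) → C.length + 1 ≤ k)
    (hpath : ∀ l, IsPathList R l → (∀ x ∈ l, x ∈ U) → l.length ≤ k) :
    w U ≤ weightBound r k U.card ∧
      (k ≤ U.card → w U + r.choose 2 ≤ weightBound r k U.card + 1) := by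
  induction U using Finset.strongInduction with
  | H U ih =>
  have hr2 : 1 ≤ r.choose 2 := Nat.choose_pos (by omega)
  by_cases hconn : ∀ X ⊆ U, X.Nonempty → X ≠ U → ∃ x ∈ X, ∃ y ∈ U \ X, R x y
  · rcases lt_or_ge U.card k with h | h
    · refine ⟨?_, fun h' => absurd h (not_lt.2 h')⟩
      rw [weightBound_of_lt h]
      exact weight_le_sum_range (monotone_vertexWeight r) hw0 hirr hpeel U
    · obtain ⟨d, N, hd, hdN, hN, hw⟩ := weight_le_of_connected hR hirr (monotone_vertexWeight r) hw0
        hpeel (by omega) U h hcyc hpath hconn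
      have := peel_sum_le_weightBound hr hk hd hdN hN h
      exact ⟨by omega, fun _ => by omega⟩
  · push Not at hconn
    obtain ⟨X, hXU, hXne, hX, hXR⟩ := hconn
    have hssub : X ⊂ U := Finset.ssubset_iff_subset_ne.2 ⟨hXU, hX⟩
    have hssub' : U \ X ⊂ U := Finset.sdiff_ssubset hXU hXne
    have ih1 := ih X hssub (fun C h1 h2 => hcyc C h1 fun x hx => hssub.1 (h2 x hx))
      (fun C h1 h2 => hpath C h1 fun x hx => hssub.1 (h2 x hx))
    have ih2 := ih _ hssub' (fun C h1 h2 => hcyc C h1 fun x hx => hssub'.1 (h2 x hx))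
      (fun C h1 h2 => hpath C h1 fun x hx => hssub'.1 (h2 x hx))
    have h1 := hsplit U X hXU hXR
    have hc : U.card = X.card + (U \ X).card := by
      rw [Finset.card_sdiff_of_subset hXU]
      have := Finset.card_le_card hXU
      omega
    have h2 := weightBound_superadditive hr hk X.card (U \ X).card
    rw [hc]
    refine ⟨by omega, fun hkU => ?_⟩
    rcases lt_or_ge X.card k with h3 | h3
    · rcases lt_or_ge (U \ X).card k with h4 | h4
      · have := weightBound_add_of_lt hr hk h3 h4 hkU
        omega
      · have := ih2.2 h4
        omega
    · have := ih1.2 h3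
      omega
end

section Incidence

variable {α β : Type*}

/-- The incidence relation of the family `N` of sets, on vertices and indices of sets. -/
def Inc (N : α → Finset β) : β ⊕ α → β ⊕ α → Prop
  | .inl b, .inr a => b ∈ N a
  | .inr a, .inl b => b ∈ N a
  | _, _ => False

variable {N : α → Finset β}

@[simp] theorem inc_inl_inr {b : β} {a : α} : Inc N (.inl b) (.inr a) ↔ b ∈ N a := Iff.rfl
@[simp] theorem inc_inr_inl {b : β} {a : α} : Inc N (.inr a) (.inl b) ↔ b ∈ N a := Iff.rfl
@[simp] theorem not_inc_inl_inl {b b' : β} : ¬ Inc N (.inl b) (.inl b') := id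
@[simp] theorem not_inc_inr_inr {a a' : α} : ¬ Inc N (.inr a) (.inr a') := id

theorem inc_symm : ∀ x y, Inc N x y → Inc N y x
  | .inl _, .inr _, h => h
  | .inr _, .inl _, h => h
  | .inl _, .inl _, h => h
  | .inr _, .inr _, h => h

theorem Inc.isRight_eq {x y : β ⊕ α} (h : Inc N x y) : y.isRight = !x.isRight := by
  rcases x with x | x <;> rcases y with y | y <;> simp_all

theorem isRight_getElem {l : List (β ⊕ α)} (h : l.IsChain (Inc N)) {i : ℕ} (hi : i < l.length) :
    l[i].isRight = ((l[0]'(by omega)).isRight ^^ decide (i % 2 = 1)) := by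
  induction i with
  | zero => simp
  | succ i ih =>
    have h1 := (List.isChain_iff_getElem.1 h i hi).isRight_eq
    rw [h1, ih (by omega)]
    rcases Nat.mod_two_eq_zero_or_one i with h2 | h2
    · rw [show (i + 1) % 2 = 1 by omega, h2]; simp
    · rw [show (i + 1) % 2 = 0 by omega, h2]; simp

theorem exists_inl_getElem {l : List (β ⊕ α)} (h : l.IsChain (Inc N)) {i : ℕ} (hi : i < l.length)
    (h0 : (l[0]'(by omega)).isRight = decide (i % 2 = 1)) : ∃ b, l[i] = .inl b := by
  have := isRight_getElem h hi
  rw [h0] at this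
  rcases hx : l[i] with b | a
  · exact ⟨b, rfl⟩
  · simp [hx] at this

theorem exists_inr_getElem {l : List (β ⊕ α)} (h : l.IsChain (Inc N)) {i : ℕ} (hi : i < l.length)
    (h0 : (l[0]'(by omega)).isRight = decide (i % 2 = 0)) : ∃ a, l[i] = .inr a := by
  have := isRight_getElem h hi
  rw [h0] at this
  rcases hx : l[i] with b | a
  · rw [hx] at this
    rcases Nat.mod_two_eq_zero_or_one i with h2 | h2 <;> simp [h2] at this
  · exact ⟨a, rfl⟩

theorem IsCycleList.even_length {l : List (β ⊕ α)} (h : IsCycleList (Inc N) l) :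
    l.length % 2 = 0 := by
  rcases Nat.eq_zero_or_pos l.length with h0 | h0
  · simp [h0]
  have h1 := isRight_getElem h.1.1 (i := l.length - 1) (by omega)
  have h2 := (h.2 l[l.length - 1] (by simp [List.getLast?_eq_getElem?]) l[0]
    (by simp [List.head?_eq_getElem?])).isRight_eq
  rw [h1] at h2
  rcases Nat.mod_two_eq_zero_or_one (l.length - 1) with h3 | h3
  · rw [h3] at h2
    rcases hb : l[0].isRight <;> simp [hb] at h2
  · omega

theorem hasBergePath_of_isPathList {V : Type*} {E : Finset (Finset V)} {k : ℕ}
    {l : List (V ⊕ Finset V)} (h : IsPathList (Inc id) l) (hE : ∀ e, Sum.inr e ∈ l → e ∈ E)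
    (hlen : 2 * k + 1 ≤ l.length) (h0 : l[0].isRight = false) : HasBergePath E k := by
  have hv : ∀ i : Fin (k + 1), ∃ x, l[2 * (i : ℕ)]'(by omega) = .inl x := fun i =>
    exists_inl_getElem h.1 (by omega) (by simp [h0])
  have he : ∀ i : Fin k, ∃ e, l[2 * (i : ℕ) + 1]'(by omega) = .inr e := fun i =>
    exists_inr_getElem h.1 (by omega) (by rw [h0]; simp)
  choose v hv using hv
  choose e he using he
  refine ⟨v, e, ?_, ?_, ?_, ?_⟩
  · intro i j hij
    have h1 := (h.2.getElem_inj_iff (hi := by omega) (hj := by omega)).1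
      ((hv i).trans ((congrArg _ hij).trans (hv j).symm))
    exact Fin.ext (by omega)
  · intro i j hij
    have h1 := (h.2.getElem_inj_iff (hi := by omega) (hj := by omega)).1
      ((he i).trans ((congrArg _ hij).trans (he j).symm))
    exact Fin.ext (by omega)
  · intro i
    exact hE _ (by rw [← he i]; exact List.getElem_mem _)
  · intro i
    have h1 := List.isChain_iff_getElem.1 h.1 (2 * (i : ℕ)) (by omega)
    have h2 := List.isChain_iff_getElem.1 h.1 (2 * (i : ℕ) + 1) (by omega)
    have h3 := hv i.castSucc
    have h4 := hv i.succ
    simp only [Fin.val_castSucc, Fin.val_succ] at h3 h4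
    rw [h3, he i] at h1
    have h5 : l[2 * (i : ℕ) + 1 + 1]'(by omega) = .inl (v i.succ) := h4
    rw [h5, he i] at h2
    exact ⟨h1, h2⟩

/-- In a connected hypergraph on more than `k` vertices, a Berge cycle of length at least `k`
yields a Berge path of length `k`. -/
theorem hasBergePath_of_isCycleList {V : Type*} [DecidableEq V] {E : Finset (Finset V)} {k : ℕ}
    {U : Finset V} (hk : 2 ≤ k) (hkU : k < U.card)
    (hconn : ∀ X ⊆ U, X.Nonempty → X ≠ U → ∃ e ∈ E, ∃ x ∈ X, ∃ y ∈ U \ X, x ∈ e ∧ y ∈ e)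
    {l : List (V ⊕ Finset V)} (h : IsCycleList (Inc id) l) (hE : ∀ e, Sum.inr e ∈ l → e ∈ E)
    (hU : ∀ x, Sum.inl x ∈ l → x ∈ U)
    (hlen : 2 * k ≤ l.length) : HasBergePath E k := by
  have hev := h.even_length
  obtain ⟨x, hx⟩ : ∃ x, Sum.inl x ∈ l := by
    rcases h0 : l[0].isRight with _ | _
    · obtain ⟨x, hx⟩ := exists_inl_getElem h.1.1 (i := 0) (by omega) (by simpa using h0)
      exact ⟨x, hx ▸ List.getElem_mem _⟩
    · obtain ⟨x, hx⟩ := exists_inl_getElem h.1.1 (i := 1) (by omega) (by simpa using h0)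
      exact ⟨x, hx ▸ List.getElem_mem _⟩
  rcases Nat.lt_or_ge (2 * k) l.length with hl | hl
  · obtain ⟨l', hl', hp⟩ := h.exists_cons hx
    refine hasBergePath_of_isPathList hl'.1 (fun e he => hE e (hp.mem_iff.1 he)) ?_ rfl
    rw [hp.length_eq]; omega
  · classical
    have hle : l.length = 2 * k := le_antisymm hl hlen
    obtain ⟨l₀, hl₀, hp₀⟩ := h.exists_cons hx
    set X := U.filter fun x => Sum.inl x ∈ l with hX
    have hXU : X ≠ U := by
      intro hXU
      have hXk : X.card ≤ k := by
        have hsub : X.card ≤ (Finset.range k).card := by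
          have hc : ∀ y ∈ X, ∃ j, j < k ∧ (Sum.inl x :: l₀)[2 * j]? = some (Sum.inl y) := by
            intro y hy
            have h1 := hp₀.mem_iff.2 (Finset.mem_filter.1 hy).2
            obtain ⟨i, hi, hiy⟩ := List.getElem_of_mem h1
            have h2 := isRight_getElem hl₀.1.1 hi
            rw [hiy] at h2
            rw [hp₀.length_eq] at hi
            have h3 : i % 2 = 0 := by
              by_contra h3
              simp [show i % 2 = 1 by omega] at h2
            refine ⟨i / 2, by omega, ?_⟩
            rw [show 2 * (i / 2) = i by omega, ← hiy]
            simp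
          choose! j hj hj2 using hc
          refine Finset.card_le_card_of_injOn j (fun y hy => by simpa using hj y hy) ?_
          intro y hy z hz hyz
          have := hj2 y hy
          rw [hyz, hj2 z hz] at this
          simpa using this.symm
        simpa using hsub
      rw [hXU] at hXk
      omega
    obtain ⟨e, he, u, hu, w, hw, hue, hwe⟩ := hconn X (Finset.filter_subset _ _)
      ⟨x, by simp [hX, hx, hU x hx]⟩ hXU
    have hul : Sum.inl u ∈ l := (Finset.mem_filter.1 hu).2
    have hwl : Sum.inl w ∉ l := by
      simp only [hX, Finset.mem_sdiff, Finset.mem_filter] at hw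
      tauto
    by_cases hel : Sum.inr e ∈ l
    · obtain ⟨l', hl', hp⟩ := h.exists_cons hel
      refine hasBergePath_of_isPathList (l := Sum.inl w :: Sum.inr e :: l') ?_ ?_ ?_ rfl
      · rw [isPathList_cons]
        exact ⟨hl'.1, fun hmem => hwl (hp.mem_iff.1 hmem), by simpa using hwe⟩
      · intro e' he'
        exact hE e' (hp.mem_iff.1 (by simpa using he'))
      · rw [List.length_cons, hp.length_eq]; omega
    · obtain ⟨l', hl', hp⟩ := h.exists_cons hul
      refine hasBergePath_of_isPathList (l := Sum.inl w :: Sum.inr e :: Sum.inl u :: l') ?_ ?_ ?_ rfl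
      · rw [isPathList_cons, isPathList_cons]
        refine ⟨⟨hl'.1, fun hmem => hel (hp.mem_iff.1 hmem), by simpa using hue⟩, ?_,
          by simpa using hwe⟩
        intro hmem
        exact hwl (hp.mem_iff.1 (by simpa using hmem))
      · intro e' he'
        rcases List.mem_cons.1 he' with h1 | h1
        · simp at h1
        rcases List.mem_cons.1 h1 with h1 | h1
        · simp only [Sum.inr.injEq] at h1; exact h1 ▸ he
        · exact hE e' (hp.mem_iff.1 h1)
      · rw [List.length_cons, List.length_cons, hp.length_eq]; omega

end Incidence

section RedBlue

theorem exists_injOn_of_hall {ι α : Type*} [DecidableEq α] [Nonempty α] (D : Finset ι)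
    (t : ι → Finset α) (h : ∀ S ⊆ D, S.card ≤ (S.biUnion t).card) :
    ∃ f : ι → α, Set.InjOn f D ∧ ∀ x ∈ D, f x ∈ t x := by
  classical
  obtain ⟨f, hf, hft⟩ := (Finset.all_card_le_biUnion_card_iff_exists_injective
    (fun x : D => t x)).1 (fun s => by
      have := h (s.map (Function.Embedding.subtype _)) (by
        intro x hx
        obtain ⟨y, -, rfl⟩ := Finset.mem_map.1 hx
        exact y.2)
      rw [Finset.card_map] at this
      refine this.trans (Finset.card_le_card ?_)
      intro y hy
      simp only [Finset.mem_biUnion, Finset.mem_map] at hy ⊢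
      obtain ⟨_, ⟨x, hx, rfl⟩, hy⟩ := hy
      exact ⟨x, hx, hy⟩)
  refine ⟨fun x => if hx : x ∈ D then f ⟨x, hx⟩ else Classical.arbitrary α, ?_, ?_⟩
  · intro x hx y hy hxy
    have hx' : x ∈ D := hx
    have hy' : y ∈ D := hy
    simp only [hx', hy', dif_pos] at hxy
    simpa using hf hxy
  · intro x hx
    simp only [hx, dif_pos]
    exact hft ⟨x, hx⟩

variable {V : Type*} [DecidableEq V]

/-- The pairs of vertices contained in some member of `A`. -/
def pairShadow (A : Finset (Finset V)) : Finset (Finset V) := A.biUnion (Finset.powersetCard 2)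

theorem mem_pairShadow {A : Finset (Finset V)} {p : Finset V} :
    p ∈ pairShadow A ↔ p.card = 2 ∧ ∃ e ∈ A, p ⊆ e := by
  simp only [pairShadow, Finset.mem_biUnion, Finset.mem_powersetCard]
  constructor
  · rintro ⟨e, he, h1, h2⟩; exact ⟨h2, e, he, h1⟩
  · rintro ⟨h2, e, he, h1⟩; exact ⟨e, he, h1, h2⟩

/-- The red-blue graph of a hypergraph: the members of `P` are the red edges, the members of
`pairShadow A` are the blue ones. -/
theorem exists_red_blue (E : Finset (Finset V)) : ∃ (A P : Finset (Finset V))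
    (φ : Finset V → Finset V), A ⊆ E ∧ P.card + A.card = E.card ∧ (∀ p ∈ P, p.card = 2) ∧
      Disjoint P (pairShadow A) ∧ Set.InjOn φ (P ∪ pairShadow A : Finset (Finset V)) ∧
      ∀ p ∈ P ∪ pairShadow A, φ p ∈ E ∧ p ⊆ φ p := by
  obtain ⟨A, hA, hmax⟩ := Finset.exists_max_image E.powerset
    (fun A => (A.card : ℤ) - (pairShadow A).card) ⟨∅, by simp⟩
  rw [Finset.mem_powerset] at hA
  obtain ⟨f, hf, hft⟩ := exists_injOn_of_hall (E \ A)
    (fun e => Finset.powersetCard 2 e \ pairShadow A) (by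
      intro S hS
      have hdis : Disjoint A S := Finset.disjoint_left.2 fun x hx hxS =>
        (Finset.mem_sdiff.1 (hS hxS)).2 hx
      have h1 := hmax (A ∪ S) (Finset.mem_powerset.2 (Finset.union_subset hA
        (hS.trans Finset.sdiff_subset)))
      have h2 : pairShadow (A ∪ S) ⊆ pairShadow A ∪
          S.biUnion fun e => Finset.powersetCard 2 e \ pairShadow A := by
        intro p hp
        by_cases hpA : p ∈ pairShadow A
        · exact Finset.mem_union_left _ hpA
        · obtain ⟨hp2, e, he, hpe⟩ := mem_pairShadow.1 hp
          refine Finset.mem_union_right _ (Finset.mem_biUnion.2 ⟨e, ?_, ?_⟩)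
          · rcases Finset.mem_union.1 he with he | he
            · exact absurd (mem_pairShadow.2 ⟨hp2, e, he, hpe⟩) hpA
            · exact he
          · simp [hpA, hpe, hp2]
      have h3 := (Finset.card_le_card h2).trans (Finset.card_union_le _ _)
      rw [Finset.card_union_of_disjoint hdis] at h1
      push_cast at h1
      omega)
  obtain ⟨g, hg, hgt⟩ := exists_injOn_of_hall (pairShadow A)
    (fun p => A.filter (p ⊆ ·)) (by
      intro S hS
      set T := S.biUnion fun p => A.filter (p ⊆ ·) with hT
      have hTA : T ⊆ A := Finset.biUnion_subset.2 fun p _ => Finset.filter_subset _ _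
      have h1 := hmax (A \ T) (Finset.mem_powerset.2 (Finset.sdiff_subset.trans hA))
      have h2 : pairShadow (A \ T) ⊆ pairShadow A \ S := by
        intro p hp
        obtain ⟨hp2, e, he, hpe⟩ := mem_pairShadow.1 hp
        rw [Finset.mem_sdiff] at he
        refine Finset.mem_sdiff.2 ⟨mem_pairShadow.2 ⟨hp2, e, he.1, hpe⟩, fun hpS => he.2 ?_⟩
        exact Finset.mem_biUnion.2 ⟨p, hpS, Finset.mem_filter.2 ⟨he.1, hpe⟩⟩
      have h3 := Finset.card_le_card h2
      rw [Finset.card_sdiff_of_subset hS] at h3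
      rw [Finset.card_sdiff_of_subset hTA] at h1
      have h4 := Finset.card_le_card hS
      have h5 := Finset.card_le_card hTA
      push_cast [h5] at h1
      omega)
  have hfP : ∀ p ∈ (E \ A).image f, p.card = 2 ∧ p ∉ pairShadow A ∧ ∃ e ∈ E \ A, f e = p ∧ p ⊆ e := by
    intro p hp
    obtain ⟨e, he, rfl⟩ := Finset.mem_image.1 hp
    have := hft e he
    simp only [Finset.mem_sdiff, Finset.mem_powersetCard] at this
    exact ⟨this.1.2, this.2, e, he, rfl, this.1.1⟩
  have hdisj : Disjoint ((E \ A).image f) (pairShadow A) :=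
    Finset.disjoint_left.2 fun p hp => (hfP p hp).2.1
  have hψ : ∀ p, ∃ e, (p ∈ pairShadow A → e = g p) ∧
      (p ∈ (E \ A).image f → e ∈ E \ A ∧ f e = p ∧ p ⊆ e) := by
    intro p
    by_cases hp : p ∈ pairShadow A
    · exact ⟨g p, fun _ => rfl, fun hp' => absurd hp (hfP p hp').2.1⟩
    · by_cases hp' : p ∈ (E \ A).image f
      · obtain ⟨e, he⟩ := (hfP p hp').2.2
        exact ⟨e, fun h => absurd h hp, fun _ => he⟩
      · exact ⟨∅, fun h => absurd h hp, fun h => absurd h hp'⟩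
  choose φ hφ1 hφ2 using hψ
  have hgA : ∀ p ∈ pairShadow A, φ p ∈ A ∧ p ⊆ φ p := by
    intro p hp
    rw [hφ1 p hp]
    simpa using hgt p hp
  refine ⟨A, (E \ A).image f, φ, hA, ?_, fun p hp => (hfP p hp).1, hdisj, ?_, ?_⟩
  · rw [Finset.card_image_of_injOn hf, Finset.card_sdiff_of_subset hA]
    have := Finset.card_le_card hA
    omega
  · intro p hp q hq hpq
    rcases Finset.mem_union.1 (Finset.mem_coe.1 hp) with hp | hp <;>
      rcases Finset.mem_union.1 (Finset.mem_coe.1 hq) with hq | hq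
    · rw [← (hφ2 p hp).2.1, hpq, (hφ2 q hq).2.1]
    · exact absurd (hgA q hq).1 (hpq ▸ (Finset.mem_sdiff.1 (hφ2 p hp).1).2)
    · exact absurd (hgA p hp).1 (hpq ▸ (Finset.mem_sdiff.1 (hφ2 q hq).1).2)
    · rw [hφ1 p hp, hφ1 q hq] at hpq
      exact hg hp hq hpq
  · intro p hp
    rcases Finset.mem_union.1 hp with hp | hp
    · exact ⟨(Finset.mem_sdiff.1 (hφ2 p hp).1).1, (hφ2 p hp).2.2⟩
    · exact ⟨hA (hgA p hp).1, (hgA p hp).2⟩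

/-- The incidence path obtained from a path in a graph on pairs whose edges are represented by
hyperedges. -/
def weave (φ : Finset V → Finset V) : List V → List (V ⊕ Finset V)
  | [] => []
  | [x] => [.inl x]
  | x :: y :: l => .inl x :: .inr (φ {x, y}) :: weave φ (y :: l)

theorem inl_mem_weave {φ : Finset V → Finset V} {x : V} :
    ∀ {l : List V}, Sum.inl x ∈ weave φ l ↔ x ∈ l
  | [] => by simp [weave]
  | [y] => by simp [weave]
  | y :: z :: l => by
    have := inl_mem_weave (φ := φ) (x := x) (l := z :: l)
    simp only [weave, List.mem_cons, Sum.inl.injEq, reduceCtorEq, false_or, this]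

theorem length_weave_cons {φ : Finset V → Finset V} :
    ∀ (x : V) (l : List V), (weave φ (x :: l)).length = 2 * l.length + 1
  | x, [] => by simp [weave]
  | x, y :: l => by
    have := length_weave_cons (φ := φ) y l
    simp only [weave, List.length_cons, this]
    ring

theorem head?_weave {φ : Finset V → Finset V} (x : V) (l : List V) :
    (weave φ (x :: l)).head? = some (.inl x) := by
  cases l <;> simp [weave]

theorem getLast?_weave {φ : Finset V → Finset V} :
    ∀ l : List V, (weave φ l).getLast? = l.getLast?.map .inl
  | [] => by simp [weave]
  | [x] => by simp [weave]
  | x :: y :: l => by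
    have := getLast?_weave (φ := φ) (y :: l)
    have h0 : weave φ (y :: l) ≠ [] := by
      have := length_weave_cons (φ := φ) y l
      intro h; simp [h] at this
    simp only [weave, List.getLast?_cons_cons]
    rw [← this, List.getLast?_cons, List.getLast?_eq_some_getLast h0]
    simp

theorem inr_mem_weave {φ : Finset V → Finset V} {R : V → V → Prop} {e : Finset V} :
    ∀ {l : List V}, IsPathList R l → Sum.inr e ∈ weave φ l →
      ∃ x ∈ l, ∃ y ∈ l, R x y ∧ e = φ {x, y} ∧ some x ≠ l.getLast? ∧
        (some x = l.head? → some y = l[1]?) ∧ some y ≠ l.head?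
  | [], _, h => by simp [weave] at h
  | [x], _, h => by simp [weave] at h
  | x :: y :: l, h, he => by
    have hp := isPathList_cons.1 h
    simp only [weave, List.mem_cons, reduceCtorEq, Sum.inr.injEq, false_or] at he
    have hxy : x ≠ y := fun hxy => hp.2.1 (by simp [hxy])
    rcases he with rfl | he
    · refine ⟨x, by simp, y, by simp, hp.2.2 y (by simp), rfl, ?_, by simp, by simpa using hxy.symm⟩
      rw [List.getLast?_cons_cons]
      intro h1
      exact hp.2.1 (List.mem_of_getLast? h1.symm)
    · obtain ⟨a, ha, b, hb, h1, h2, h3, -, h5⟩ := inr_mem_weave hp.1 he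
      refine ⟨a, by simp [ha], b, by simp [hb], h1, h2, ?_, ?_, ?_⟩
      · rwa [List.getLast?_cons_cons]
      · intro hax
        simp only [List.head?_cons, Option.some.injEq] at hax
        exact absurd ha (hax ▸ hp.2.1)
      · intro hbx
        simp only [List.head?_cons, Option.some.injEq] at hbx
        exact absurd hb (hbx ▸ hp.2.1)

theorem isPathList_weave {φ : Finset V → Finset V} {P : Finset (Finset V)} (hφ : Set.InjOn φ P)
    (hsub : ∀ p ∈ P, p ⊆ φ p) :
    ∀ {l : List V}, IsPathList (fun x y => {x, y} ∈ P) l → IsPathList (Inc id) (weave φ l)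
  | [], _ => by simp [weave, IsPathList]
  | [x], _ => by simp [weave, IsPathList]
  | x :: y :: l, h => by
    have hp := isPathList_cons.1 h
    have hxy : {x, y} ∈ P := hp.2.2 y (by simp)
    have hs := hsub _ hxy
    have ih := isPathList_weave hφ hsub hp.1
    rw [weave, isPathList_cons, isPathList_cons]
    refine ⟨⟨ih, ?_, ?_⟩, ?_, ?_⟩
    · intro hmem
      obtain ⟨a, ha, b, hb, h1, h2, -⟩ := inr_mem_weave hp.1 hmem
      have h3 := hφ hxy h1 h2
      have hx : x ∈ ({a, b} : Finset V) := h3 ▸ by simp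
      rcases Finset.mem_insert.1 hx with rfl | hx
      · exact hp.2.1 ha
      · rw [Finset.mem_singleton.1 hx] at hp
        exact hp.2.1 hb
    · intro z hz
      rw [head?_weave] at hz
      simp only [Option.mem_def, Option.some.injEq] at hz
      subst hz
      exact hs (by simp)
    · intro hmem
      simp only [List.mem_cons, reduceCtorEq, false_or, inl_mem_weave] at hmem
      exact hp.2.1 (by simpa using hmem)
    · intro z hz
      simp only [List.head?_cons, Option.mem_def, Option.some.injEq] at hz
      subst hz
      exact hs (by simp)

end RedBlue

section RedBlue

theorem add_choose_le_vertexWeight {r : ℕ} (hr : 3 ≤ r) (a b : ℕ) :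
    a + b.choose (r - 1) ≤ vertexWeight r (a + b) := by
  unfold vertexWeight
  rcases Nat.lt_or_ge b (r - 1) with h | h
  · rw [Nat.choose_eq_zero_of_lt h]; exact le_max_of_le_left (by omega)
  · refine le_max_of_le_right ?_
    have h1 := choose_add_ge b (r - 2) a
    have h2 : 1 ≤ b.choose (r - 2) := Nat.choose_pos (by omega)
    rw [show r - 2 + 1 = r - 1 by omega] at h1
    have := Nat.mul_le_mul_left a h2
    rw [Nat.add_comm a b]
    omega

variable {V : Type*} [DecidableEq V]

theorem isCycleList_weave {φ : Finset V → Finset V} {P : Finset (Finset V)} (hφ : Set.InjOn φ P)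
    (hsub : ∀ p ∈ P, p ⊆ φ p) {l : List V} (h : IsCycleList (fun x y => {x, y} ∈ P) l)
    (hl : 3 ≤ l.length) : ∃ e, IsCycleList (Inc id) (weave φ l ++ [.inr e]) ∧ e ∈ P.image φ := by
  have hlast : l[l.length - 1] ∈ l.getLast? := by simp [List.getLast?_eq_getElem?]
  have hhead : l[0] ∈ l.head? := by simp [List.head?_eq_getElem?]
  have hP := h.2 _ hlast _ hhead
  have hs := hsub _ hP
  refine ⟨φ {l[l.length - 1], l[0]}, ⟨isPathList_append.2 ⟨isPathList_weave hφ hsub h.1,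
    isPathList_singleton _, ?_, ?_⟩, ?_⟩, Finset.mem_image_of_mem _ hP⟩
  · rw [List.disjoint_singleton]
    intro hmem
    obtain ⟨a, ha, b, hb, h1, h2, h3, h4, h5⟩ := inr_mem_weave h.1 hmem
    have h6 := hφ hP h1 h2
    have hx : l[0] ∈ ({a, b} : Finset V) := h6 ▸ by simp
    have hy : l[l.length - 1] ∈ ({a, b} : Finset V) := h6 ▸ by simp
    simp only [List.getLast?_eq_getElem?, List.head?_eq_getElem?,
      List.getElem?_eq_getElem (show 0 < l.length by omega),
      List.getElem?_eq_getElem (show l.length - 1 < l.length by omega),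
      List.getElem?_eq_getElem (show 1 < l.length by omega), Option.some.injEq, ne_eq] at h3 h4 h5
    simp only [Finset.mem_insert, Finset.mem_singleton] at hx hy
    have hxa : l[0] = a := hx.resolve_right fun h => h5 h.symm
    have hyb : l[l.length - 1] = b := hy.resolve_left fun h => h3 h.symm
    have h7 := h4 hxa.symm
    rw [← hyb, h.1.2.getElem_inj_iff] at h7
    omega
  · intro x hx y hy
    rw [getLast?_weave, hlast] at hx
    simp only [Option.map_some, Option.mem_def, Option.some.injEq, List.head?_cons] at hx hy
    subst hx hy
    exact hs (by simp)
  · intro x hx y hy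
    obtain ⟨z, l', rfl⟩ := List.exists_cons_of_ne_nil (l := l) (by rintro rfl; simp at hl)
    simp only [List.head?_append, head?_weave, Option.some_or, List.getLast?_append,
      List.getLast?_singleton, Option.mem_def, Option.some.injEq] at hx hy
    subst hx hy
    exact hs (by simp)

theorem card_le_of_connected_large {r k : ℕ} (hr : 3 ≤ r) (hk : r + 3 ≤ k) {E : Finset (Finset V)}
    {U : Finset V} (hE : ∀ e ∈ E, e ⊆ U ∧ e.card = r) (hkU : k < U.card)
    (hconn : ∀ X ⊆ U, X.Nonempty → X ≠ U → ∃ e ∈ E, ∃ x ∈ X, ∃ y ∈ U \ X, x ∈ e ∧ y ∈ e)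
    (hpath : ¬ HasBergePath E k) :
    E.card ≤ U.card / k * k.choose r + (U.card % k).choose r := by
  obtain ⟨A, P, φ, hA, hcard, hP2, hdisj, hφ, hφE⟩ := exists_red_blue E
  set G := P ∪ pairShadow A with hG
  have hG2 : ∀ p ∈ G, p.card = 2 := by
    intro p hp
    rcases Finset.mem_union.1 hp with hp | hp
    · exact hP2 p hp
    · exact (mem_pairShadow.1 hp).1
  have hGU : ∀ p ∈ G, p ⊆ U := fun p hp => (hφE p hp).2.trans (hE _ (hφE p hp).1).1
  have hpair : ∀ {p : Finset V} {x y : V}, p.card = 2 → x ∈ p → y ∈ p → x ≠ y → p = {x, y} := by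
    intro p x y hp hx hy hxy
    refine (Finset.eq_of_subset_of_card_le ?_ ?_).symm
    · intro z hz
      simp only [Finset.mem_insert, Finset.mem_singleton] at hz
      rcases hz with rfl | rfl <;> assumption
    · rw [hp, Finset.card_pair hxy]
  have hinr : ∀ {l : List V} {e : Finset V}, IsPathList (fun x y => {x, y} ∈ G) l →
      Sum.inr e ∈ weave φ l → e ∈ E := by
    intro l e hl he
    obtain ⟨x, -, y, -, h1, rfl, -⟩ := inr_mem_weave hl he
    exact (hφE _ h1).1
  have hirr : ∀ x : V, ({x, x} : Finset V) ∉ G := by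
    intro x hx
    simpa using hG2 _ hx
  let w : Finset V → ℕ := fun W => (P.filter (· ⊆ W)).card + (A.filter (· ⊆ W)).card
  have key := weight_le_weightBound (R := fun x y => ({x, y} : Finset V) ∈ G)
    (fun x y h => by rwa [Finset.pair_comm]) hirr hr hk (w := w) ?_ ?_ ?_ U ?_ ?_
  · have h1 : w U = E.card := by
      have h2 : P.filter (· ⊆ U) = P :=
        Finset.filter_true_of_mem fun p hp => hGU p (Finset.mem_union_left _ hp)
      have h3 : A.filter (· ⊆ U) = A := Finset.filter_true_of_mem fun e he => (hE e (hA he)).1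
      simp only [w, h2, h3, hcard]
    have h2 := key.2 hkU.le
    have h3 := weightBound_le (r := r) (k := k) (n := U.card) hr
    omega
  · simp only [w, Finset.subset_empty, Nat.add_eq_zero_iff, Finset.card_eq_zero,
      Finset.filter_eq_empty_iff]
    refine ⟨fun p hp h => ?_, fun e he h => ?_⟩
    · simpa [h] using hP2 p hp
    · have := (hE e (hA he)).2
      rw [h] at this
      simp at this
      omega
  · intro W v hv
    have hcount : ∀ B : Finset (Finset V), (B.filter (· ⊆ W)).card =
        (B.filter (· ⊆ W.erase v)).card + (B.filter fun e => e ⊆ W ∧ v ∈ e).card := by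
      intro B
      rw [← Finset.card_filter_add_card_filter_not (s := B.filter (· ⊆ W)) (fun e => v ∉ e),
        Finset.filter_filter, Finset.filter_filter]
      simp only [not_not]
      congr 3
      ext e
      simp [Finset.subset_erase]
    have hred : (P.filter fun e => e ⊆ W ∧ v ∈ e).card ≤
        (W.filter fun y => ({v, y} : Finset V) ∈ P).card := by
      refine (Finset.card_le_card ?_).trans
        (Finset.card_image_le (f := fun y => ({v, y} : Finset V)))
      intro p hp
      obtain ⟨hp, hpW, hvp⟩ := Finset.mem_filter.1 hp
      have hp2 := hP2 p hp
      obtain ⟨y, hy, hyv⟩ := Finset.exists_mem_ne (s := p) (by omega) v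
      have := hpair hp2 hvp hy hyv.symm
      exact Finset.mem_image.2 ⟨y, Finset.mem_filter.2 ⟨hpW hy, this ▸ hp⟩, this.symm⟩
    have hblue : (A.filter fun e => e ⊆ W ∧ v ∈ e).card ≤
        (W.filter fun y => ({v, y} : Finset V) ∈ pairShadow A).card.choose (r - 1) := by
      rw [← Finset.card_powersetCard]
      refine Finset.card_le_card_of_injOn (fun e => e.erase v) ?_ ?_
      · intro e he
        obtain ⟨he, heW, hve⟩ := Finset.mem_filter.1 he
        rw [Finset.mem_coe, Finset.mem_powersetCard, Finset.card_erase_of_mem hve, (hE e (hA he)).2]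
        refine ⟨fun y hy => ?_, rfl⟩
        obtain ⟨hyv, hye⟩ := Finset.mem_erase.1 hy
        refine Finset.mem_filter.2 ⟨heW hye, mem_pairShadow.2 ⟨Finset.card_pair hyv.symm, e, he, ?_⟩⟩
        simp [Finset.insert_subset_iff, hve, hye]
      · intro e he f hf hef
        have h1 := (Finset.mem_filter.1 he).2.2
        have h2 := (Finset.mem_filter.1 hf).2.2
        rw [← Finset.insert_erase h1, ← Finset.insert_erase h2]
        exact congrArg _ hef
    have hdeg : (W.filter fun y => ({v, y} : Finset V) ∈ G).card =
        (W.filter fun y => ({v, y} : Finset V) ∈ P).card +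
        (W.filter fun y => ({v, y} : Finset V) ∈ pairShadow A).card := by
      rw [← Finset.card_union_of_disjoint, ← Finset.filter_or]
      · simp only [hG, Finset.mem_union]
      · exact Finset.disjoint_filter.2 fun y _ h1 h2 => Finset.disjoint_left.1 hdisj h1 h2
    rw [hdeg]
    have := add_choose_le_vertexWeight hr (W.filter fun y => ({v, y} : Finset V) ∈ P).card
      (W.filter fun y => ({v, y} : Finset V) ∈ pairShadow A).card
    simp only [w, hcount]
    omega
  · intro W X hXW hX
    have hcount : ∀ B : Finset (Finset V), (∀ e ∈ B, ∀ x ∈ e, ∀ y ∈ e, x ≠ y → {x, y} ∈ G) →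
        (B.filter (· ⊆ W)).card ≤ (B.filter (· ⊆ X)).card + (B.filter (· ⊆ W \ X)).card := by
      intro B hB
      refine (Finset.card_le_card ?_).trans (Finset.card_union_le _ _)
      intro e he
      obtain ⟨he, heW⟩ := Finset.mem_filter.1 he
      by_cases heX : e ⊆ X
      · exact Finset.mem_union_left _ (Finset.mem_filter.2 ⟨he, heX⟩)
      · obtain ⟨y, hy, hyX⟩ := Finset.not_subset.1 heX
        refine Finset.mem_union_right _ (Finset.mem_filter.2 ⟨he, fun x hx => ?_⟩)
        refine Finset.mem_sdiff.2 ⟨heW hx, fun hxX => ?_⟩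
        exact hX x hxX y (Finset.mem_sdiff.2 ⟨heW hy, hyX⟩)
          (hB e he x hx y hy (by rintro rfl; exact hyX hxX))
    have h1 := hcount P (fun p hp x hx y hy hxy =>
      Finset.mem_union_left _ (hpair (hP2 p hp) hx hy hxy ▸ hp))
    have h2 := hcount A (fun e he x hx y hy hxy => Finset.mem_union_right _
      (mem_pairShadow.2 ⟨Finset.card_pair hxy, e, he, by simp [Finset.insert_subset_iff, hx, hy]⟩))
    simp only [w]
    omega
  · intro C hC hCU
    by_contra hlen
    obtain ⟨e, hcyc, he⟩ := isCycleList_weave hφ (fun p hp => (hφE p hp).2) hC (by omega)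
    refine hpath (hasBergePath_of_isCycleList (by omega) hkU hconn hcyc ?_ ?_ ?_)
    · intro f hf
      rcases List.mem_append.1 hf with hf | hf
      · exact hinr hC.1 hf
      · simp only [List.mem_singleton, Sum.inr.injEq] at hf
        obtain ⟨p, hp, rfl⟩ := Finset.mem_image.1 he
        exact hf ▸ (hφE p hp).1
    · intro x hx
      simp only [List.mem_append, inl_mem_weave, List.mem_singleton, reduceCtorEq, or_false] at hx
      exact hCU x hx
    · obtain ⟨z, l', rfl⟩ := List.exists_cons_of_ne_nil (l := C) (by rintro rfl; simp at hlen; omega)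
      rw [List.length_append, length_weave_cons]
      simp only [List.length_cons, List.length_nil] at hlen ⊢
      omega
  · intro l hl hlU
    by_contra hlen
    obtain ⟨z, l', rfl⟩ := List.exists_cons_of_ne_nil (l := l) (by rintro rfl; simp at hlen)
    have h1 := length_weave_cons (φ := φ) z l'
    simp only [List.length_cons] at hlen
    refine hpath (hasBergePath_of_isPathList
      (isPathList_weave hφ (fun p hp => (hφE p hp).2) hl) (fun e he => hinr hl he) (by omega) ?_)
    have h2 := head?_weave (φ := φ) z l'
    rw [List.head?_eq_getElem?, List.getElem?_eq_getElem (by omega)] at h2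
    simp only [Option.some.injEq] at h2
    rw [h2]; rfl

end RedBlue

section Components

variable {V : Type*} [DecidableEq V]

theorem HasBergePath.mono {E F : Finset (Finset V)} {k : ℕ} (h : HasBergePath E k) (hEF : E ⊆ F) :
    HasBergePath F k := by
  obtain ⟨v, e, h1, h2, h3, h4⟩ := h
  exact ⟨v, e, h1, h2, fun i => hEF (h3 i), h4⟩

theorem card_le_of_forall_connected {r k : ℕ} (hr : 1 ≤ r) (hk : 0 < k)
    (hcon : ∀ (U : Finset V) (E : Finset (Finset V)), (∀ e ∈ E, e ⊆ U ∧ e.card = r) → k < U.card →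
      (∀ X ⊆ U, X.Nonempty → X ≠ U → ∃ e ∈ E, ∃ x ∈ X, ∃ y ∈ U \ X, x ∈ e ∧ y ∈ e) →
      ¬ HasBergePath E k → E.card ≤ U.card / k * k.choose r + (U.card % k).choose r)
    (U : Finset V) (E : Finset (Finset V)) (hE : ∀ e ∈ E, e ⊆ U ∧ e.card = r)
    (hpath : ¬ HasBergePath E k) :
    E.card ≤ U.card / k * k.choose r + (U.card % k).choose r := by
  induction U using Finset.strongInduction generalizing E with
  | H U ih =>
  by_cases h : ∀ X ⊆ U, X.Nonempty → X ≠ U → ∃ e ∈ E, ∃ x ∈ X, ∃ y ∈ U \ X, x ∈ e ∧ y ∈ e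
  · rcases Nat.lt_or_ge k U.card with hU | hU
    · exact hcon U E hE hU h hpath
    · have h1 : E.card ≤ U.card.choose r := by
        rw [← Finset.card_powersetCard]
        exact Finset.card_le_card fun e he => Finset.mem_powersetCard.2 (hE e he)
      rcases hU.eq_or_lt with h2 | h2
      · rw [h2] at h1 ⊢
        rw [Nat.div_self hk, Nat.one_mul]
        omega
      · rw [Nat.div_eq_of_lt h2, Nat.mod_eq_of_lt h2]
        omega
  · push Not at h
    obtain ⟨X, hXU, hX, hne, hno⟩ := h
    have hX' : X ⊂ U := hXU.ssubset_of_ne hne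
    have hY' : U \ X ⊂ U := Finset.sdiff_ssubset hXU hX
    have h1 := ih X hX' (E.filter (· ⊆ X))
      (fun e he => ⟨(Finset.mem_filter.1 he).2, (hE e (Finset.mem_filter.1 he).1).2⟩)
      (fun h => hpath (h.mono (Finset.filter_subset _ _)))
    have h2 := ih (U \ X) hY' (E.filter (· ⊆ U \ X))
      (fun e he => ⟨(Finset.mem_filter.1 he).2, (hE e (Finset.mem_filter.1 he).1).2⟩)
      (fun h => hpath (h.mono (Finset.filter_subset _ _)))
    have h3 : E.card ≤ (E.filter (· ⊆ X)).card + (E.filter (· ⊆ U \ X)).card := by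
      refine (Finset.card_le_card ?_).trans (Finset.card_union_le _ _)
      intro e he
      by_cases heX : e ⊆ X
      · exact Finset.mem_union_left _ (Finset.mem_filter.2 ⟨he, heX⟩)
      · obtain ⟨y, hy, hyX⟩ := Finset.not_subset.1 heX
        refine Finset.mem_union_right _ (Finset.mem_filter.2 ⟨he, fun x hx => ?_⟩)
        refine Finset.mem_sdiff.2 ⟨(hE e he).1 hx, fun hxX => ?_⟩
        exact hno e he x hxX y (Finset.mem_sdiff.2 ⟨(hE e he).1 hy, hyX⟩) hx hy
    have h4 := blockChoose_superadditive hk hr X.card (U \ X).card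
    have h5 := Finset.card_sdiff_add_card_eq_card hXU
    rw [show X.card + (U \ X).card = U.card by omega] at h4
    omega

end Components

section EdgePaths

variable {α β : Type*} [DecidableEq α] [DecidableEq β] {N : α → Finset β} {A : Finset α}

/-- The vertices on a list of vertices and hyperedges. -/
def lefts (l : List (β ⊕ α)) : Finset β := (l.filterMap Sum.getLeft?).toFinset

/-- The hyperedges on a list of vertices and hyperedges. -/
def rights (l : List (β ⊕ α)) : Finset α := (l.filterMap Sum.getRight?).toFinset

@[simp] theorem mem_lefts {l : List (β ⊕ α)} {b : β} : b ∈ lefts l ↔ Sum.inl b ∈ l := by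
  simp [lefts, Sum.getLeft?_eq_some_iff]

@[simp] theorem mem_rights {l : List (β ⊕ α)} {a : α} : a ∈ rights l ↔ Sum.inr a ∈ l := by
  simp [rights, Sum.getRight?_eq_some_iff]

theorem List.Perm.lefts_eq {l l' : List (β ⊕ α)} (h : l.Perm l') : lefts l = lefts l' := by
  ext b; simp [h.mem_iff]

theorem card_lefts_cons_inl {l : List (β ⊕ α)} {b : β} (h : Sum.inl b ∉ l) :
    (lefts (.inl b :: l)).card = (lefts l).card + 1 := by
  have : lefts (.inl b :: l) = insert b (lefts l) := by ext; simp
  rw [this, Finset.card_insert_of_notMem (by simpa using h)]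

theorem card_rights_cons_inr {l : List (β ⊕ α)} {a : α} (h : Sum.inr a ∉ l) :
    (rights (.inr a :: l)).card = (rights l).card + 1 := by
  have : rights (.inr a :: l) = insert a (rights l) := by ext; simp
  rw [this, Finset.card_insert_of_notMem (by simpa using h)]

theorem lefts_cons_inr {l : List (β ⊕ α)} {a : α} : lefts (.inr a :: l) = lefts l := by
  ext; simp

theorem rights_cons_inl {l : List (β ⊕ α)} {b : β} : rights (.inl b :: l) = rights l := by
  ext; simp

theorem card_lefts_rights_of_isPathList {l : List (β ⊕ α)} (h : IsPathList (Inc N) l) :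
    ((∀ x ∈ l.head?, x.isRight = true) →
      (lefts l).card = l.length / 2 ∧ (rights l).card = (l.length + 1) / 2) ∧
    ((∀ x ∈ l.head?, x.isRight = false) →
      (lefts l).card = (l.length + 1) / 2 ∧ (rights l).card = l.length / 2) := by
  induction l with
  | nil => simp [lefts, rights]
  | cons x l ih =>
    obtain ⟨h1, h2, h3⟩ := isPathList_cons.1 h
    have ih := ih h1
    rcases x with b | a
    · refine ⟨fun h => by simp at h, fun _ => ?_⟩
      have := ih.1 fun y hy => by simpa using (h3 y hy).isRight_eq
      rw [card_lefts_cons_inl h2, rights_cons_inl, List.length_cons]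
      omega
    · refine ⟨fun _ => ?_, fun h => by simp at h⟩
      have := ih.2 fun y hy => by simpa using (h3 y hy).isRight_eq
      rw [card_rights_cons_inr h2, lefts_cons_inr, List.length_cons]
      omega

/-- An incidence path which starts and ends with a hyperedge, all hyperedges being in `A`. -/
structure IsEdgePath (N : α → Finset β) (A : Finset α) (l : List (β ⊕ α)) : Prop where
  path : IsPathList (Inc N) l
  mem : ∀ a, Sum.inr a ∈ l → a ∈ A
  odd : l.length % 2 = 1
  head : ∀ x ∈ l.head?, x.isRight = true

namespace IsEdgePath

variable {l : List (β ⊕ α)}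

theorem pos (h : IsEdgePath N A l) : 0 < l.length := by have := h.odd; omega

theorem zero_isRight (h : IsEdgePath N A l) : (l[0]'h.pos).isRight = true :=
  h.head _ (by simp [List.head?_eq_getElem?])

theorem exists_inl (h : IsEdgePath N A l) {i : ℕ} (hi : i < l.length) (hi2 : i % 2 = 1) :
    ∃ b, l[i] = .inl b :=
  exists_inl_getElem h.path.1 hi (by simp [h.zero_isRight, hi2])

theorem exists_inr (h : IsEdgePath N A l) {i : ℕ} (hi : i < l.length) (hi2 : i % 2 = 0) :
    ∃ a ∈ A, l[i] = .inr a := by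
  obtain ⟨a, ha⟩ := exists_inr_getElem h.path.1 hi (by simp [h.zero_isRight, hi2])
  exact ⟨a, h.mem a (ha ▸ List.getElem_mem _), ha⟩

theorem odd_of_inl (h : IsEdgePath N A l) {i : ℕ} (hi : i < l.length) {b : β}
    (hb : l[i] = .inl b) : i % 2 = 1 := by
  by_contra h2
  obtain ⟨a, -, ha⟩ := h.exists_inr hi (by omega)
  simp [ha] at hb

theorem card_lefts (h : IsEdgePath N A l) : (lefts l).card = l.length / 2 :=
  ((card_lefts_rights_of_isPathList h.path).1 h.head).1

theorem card_rights (h : IsEdgePath N A l) : (rights l).card = l.length / 2 + 1 := by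
  have := ((card_lefts_rights_of_isPathList h.path).1 h.head).2
  have := h.odd
  omega

theorem rights_subset (h : IsEdgePath N A l) : rights l ⊆ A := fun a ha => h.mem a (by simpa using ha)

theorem length_le (h : IsEdgePath N A l) : l.length ≤ 2 * A.card := by
  have := Finset.card_le_card h.rights_subset
  rw [h.card_rights] at this
  have := h.odd
  omega

theorem reverse (h : IsEdgePath N A l) : IsEdgePath N A l.reverse := by
  refine ⟨h.path.reverse inc_symm, fun a ha => h.mem a (by simpa using ha), by simpa using h.odd, ?_⟩
  intro x hx
  have hodd := h.odd
  obtain ⟨a, -, ha⟩ := h.exists_inr (i := l.length - 1) (by omega) (by omega)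
  simp only [List.head?_reverse, List.getLast?_eq_getElem?, Option.mem_def] at hx
  rw [List.getElem?_eq_getElem (by omega), ha] at hx
  simp only [Option.some.injEq] at hx
  subst hx; rfl

theorem singleton {a : α} (ha : a ∈ A) : IsEdgePath N A [.inr a] :=
  ⟨isPathList_singleton _, by simpa using ha, by simp, by simp⟩

theorem cons (h : IsEdgePath N A l) {a g : α} {b : β} (hl : l[0]'h.pos = .inr a) (hba : b ∈ N a)
    (hbl : Sum.inl b ∉ l) (hbg : b ∈ N g) (hgl : Sum.inr g ∉ l) (hg : g ∈ A) :
    IsEdgePath N A (.inr g :: .inl b :: l) := by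
  refine ⟨?_, ?_, ?_, by simp⟩
  · rw [isPathList_cons, isPathList_cons]
    refine ⟨⟨h.path, hbl, fun y hy => ?_⟩, by simpa using hgl, by simpa using hbg⟩
    rw [List.head?_eq_getElem?, List.getElem?_eq_getElem h.pos, hl] at hy
    simp only [Option.mem_def, Option.some.injEq] at hy
    subst hy
    simpa using hba
  · intro a' ha'
    simp only [List.mem_cons, Sum.inr.injEq, reduceCtorEq, false_or] at ha'
    rcases ha' with rfl | ha'
    exacts [hg, h.mem _ ha']
  · have := h.odd
    simp only [List.length_cons]
    omega

theorem perm (h : IsEdgePath N A l) {l' : List (β ⊕ α)} (hp : l'.Perm l)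
    (hl : IsPathList (Inc N) l') (hhead : ∀ x ∈ l'.head?, x.isRight = true) : IsEdgePath N A l' :=
  ⟨hl, fun a ha => h.mem a (hp.mem_iff.1 ha), by rw [hp.length_eq]; exact h.odd, hhead⟩

theorem mono (h : IsEdgePath N A l) {A' : Finset α} (hA : A ⊆ A') : IsEdgePath N A' l :=
  ⟨h.path, fun a ha => hA (h.mem a ha), h.odd, h.head⟩

theorem mem_nbr_of_inl_mem (h : IsEdgePath N A l) {b : β} (hb : Sum.inl b ∈ l) :
    ∃ a, Sum.inr a ∈ l ∧ b ∈ N a := by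
  obtain ⟨i, hi, hib⟩ := List.getElem_of_mem hb
  have hodd := h.odd_of_inl hi hib
  obtain ⟨a, -, ha⟩ := h.exists_inr (i := i - 1) (by omega) (by omega)
  have := List.isChain_iff_getElem.1 h.path.1 (i - 1) (by omega)
  rw [ha] at this
  simp only [show i - 1 + 1 = i by omega, hib] at this
  exact ⟨a, ha ▸ List.getElem_mem _, this⟩

/-- An incidence path to whose ends a hyperedge `g` can be attached, reached along a path `t`
which starts at `g`. -/
theorem attach_drop (h : IsEdgePath N A l) {t : List (β ⊕ α)} (ht : IsEdgePath N A t)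
    (hdis : t.Disjoint l) {g : α} (hg : t[0]'ht.pos = .inr g) {i : ℕ} (hi : i < l.length) {b : β}
    (hb : l[i] = .inl b) (hbg : b ∈ N g) : IsEdgePath N A (t.reverse ++ l.drop i) := by
  refine ⟨isPathList_append.2 ⟨ht.path.reverse inc_symm, h.path.drop i, ?_, ?_⟩, ?_, ?_, ?_⟩
  · intro x hx hx'
    exact hdis (by simpa using hx) (List.mem_of_mem_drop hx')
  · intro x hx y hy
    rw [eq_getElem_of_mem_head?_drop hy hi, hb]
    simp only [List.getLast?_reverse, List.head?_eq_getElem?, List.getElem?_eq_getElem ht.pos, hg,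
      Option.mem_def, Option.some.injEq] at hx
    subst hx
    exact hbg
  · intro a ha
    rcases List.mem_append.1 ha with ha | ha
    · exact ht.mem a (by simpa using ha)
    · exact h.mem a (List.mem_of_mem_drop ha)
  · have := h.odd_of_inl hi hb
    have := h.odd
    have := ht.odd
    simp only [List.length_append, List.length_reverse, List.length_drop]
    omega
  · intro x hx
    refine ht.reverse.head x ?_
    rw [List.head?_append] at hx
    have h0 := ht.reverse.pos
    rw [List.head?_eq_getElem?, List.getElem?_eq_getElem h0] at hx ⊢
    simpa using hx

/-- A longest path meets the hyperedges outside it only in central vertices. -/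
theorem card_inter_lefts_of_longest (h : IsEdgePath N A l)
    (hmax : ∀ l', IsEdgePath N A l' → l'.length ≤ l.length) {t : List (β ⊕ α)}
    (ht : IsEdgePath N A t) (hdis : t.Disjoint l) {g : α} (hg : t[0]'ht.pos = .inr g)
    (hne : (N g ∩ lefts l).Nonempty) :
    (N g ∩ lefts l).card + t.length ≤ l.length / 2 + 1 := by
  have hodd := h.odd
  have htodd := ht.odd
  have key : ∀ b ∈ N g ∩ lefts l, ∃ j, 2 * j + 1 < l.length ∧ l[2 * j + 1]? = some (.inl b) ∧
      t.length ≤ 2 * j + 1 ∧ 2 * j + 1 + t.length + 1 ≤ l.length := by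
    intro b hb
    obtain ⟨hbg, hbl⟩ := Finset.mem_inter.1 hb
    obtain ⟨i, hi, hib⟩ := List.getElem_of_mem (mem_lefts.1 hbl)
    have hi2 := h.odd_of_inl hi hib
    have h1 := hmax _ (h.attach_drop ht hdis hg hi hib hbg)
    have h2 := hmax _ (h.reverse.attach_drop ht (by simpa [List.Disjoint] using hdis) hg
      (i := l.length - 1 - i) (by rw [List.length_reverse]; omega) (b := b)
      (by simp only [List.getElem_reverse, ← hib]; congr 1; omega) hbg)
    simp only [List.length_append, List.length_reverse, List.length_drop] at h1 h2
    refine ⟨i / 2, ?_⟩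
    rw [show 2 * (i / 2) + 1 = i by omega]
    exact ⟨hi, by rw [List.getElem?_eq_getElem hi, hib], by omega, by omega⟩
  choose! j hj using key
  obtain ⟨b₀, hb₀⟩ := hne
  have h0 := hj b₀ hb₀
  have hle : (N g ∩ lefts l).card ≤ (Finset.Icc (t.length / 2) (l.length / 2 - 1 - t.length / 2)).card := by
    refine Finset.card_le_card_of_injOn j ?_ ?_
    · intro b hb
      have := hj b hb
      simp only [Finset.coe_Icc, Set.mem_Icc]
      omega
    · intro b hb c hc hbc
      have h1 := (hj b hb).2.1
      rw [hbc, (hj c hc).2.1] at h1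
      simpa using h1.symm
  rw [Nat.card_Icc] at hle
  omega

end IsEdgePath

theorem exists_longest_edgePath (hA : A.Nonempty) : ∃ l, IsEdgePath N A l ∧
    ∀ l', IsEdgePath N A l' → l'.length ≤ l.length := by
  obtain ⟨a, ha⟩ := hA
  exact exists_longest_path (IsEdgePath N A) _ (fun l hl => hl.length_le) ⟨_, .singleton ha⟩

end EdgePaths

section Cycles

theorem IsCycleList.exists_split {α : Type*} {R : α → α → Prop} {l : List α} (h : IsCycleList R l)
    {p q : ℕ} (hp : 0 < p) (hpq : p < q) (hq : q < l.length) :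
    ∃ s t, IsCycleList R (s ++ t) ∧ (s ++ t).Perm l ∧ s.head? = l[q]? ∧ s.getLast? = l[p - 1]? ∧
      t.head? = l[p]? ∧ t.getLast? = l[q - 1]? := by
  have hl : (l.take p ++ (l.take q).drop p) ++ l.drop q = l := by
    have : l.take p = (l.take q).take p := by rw [List.take_take, min_eq_left hpq.le]
    rw [this, List.take_append_drop, List.take_append_drop]
  refine ⟨l.drop q ++ l.take p, (l.take q).drop p, ?_, ?_, ?_, ?_, ?_, ?_⟩
  · rw [List.append_assoc]
    refine IsCycleList.comm_append ?_
    rwa [hl]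
  · rw [List.append_assoc]
    refine List.perm_append_comm.trans ?_
    rw [hl]
  · rw [List.head?_append, List.head?_drop, List.getElem?_eq_getElem hq]
    rfl
  · rw [List.getLast?_append, List.getLast?_take, if_neg (by omega),
      List.getElem?_eq_getElem (by omega)]
    rfl
  · rw [List.head?_drop, List.getElem?_take, if_pos hpq]
  · rw [List.getLast?_drop, List.length_take, if_neg (by omega), List.getLast?_take,
      if_neg (by omega), List.getElem?_eq_getElem (by omega)]
    rfl

variable {α β : Type*} [DecidableEq α] [DecidableEq β] {N : α → Finset β} {A : Finset α}

/-- The positions of the vertices of an edge path which belong to the hyperedge `g`. -/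
def nbrPos (N : α → Finset β) (l : List (β ⊕ α)) (g : α) : Finset ℕ :=
  (Finset.range (l.length / 2)).filter fun j => ∃ b ∈ N g, l[2 * j + 1]? = some (.inl b)

theorem mem_nbrPos {l : List (β ⊕ α)} {g : α} {j : ℕ} :
    j ∈ nbrPos N l g ↔ ∃ b ∈ N g, l[2 * j + 1]? = some (.inl b) := by
  simp only [nbrPos, Finset.mem_filter, Finset.mem_range, and_iff_right_iff_imp]
  rintro ⟨b, -, hb⟩
  obtain ⟨h, -⟩ := List.getElem?_eq_some_iff.1 hb
  omega

theorem nbrPos_subset {l : List (β ⊕ α)} {g : α} : nbrPos N l g ⊆ Finset.range (l.length / 2) :=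
  Finset.filter_subset _ _

namespace IsEdgePath

variable {l : List (β ⊕ α)}

theorem card_inter_lefts_le (h : IsEdgePath N A l) (g : α) :
    (N g ∩ lefts l).card ≤ (nbrPos N l g).card := by
  have key : ∀ b ∈ N g ∩ lefts l, ∃ j, l[2 * j + 1]? = some (.inl b) := by
    intro b hb
    obtain ⟨i, hi, hib⟩ := List.getElem_of_mem (mem_lefts.1 (Finset.mem_inter.1 hb).2)
    have hi2 := h.odd_of_inl hi hib
    refine ⟨i / 2, ?_⟩
    rw [show 2 * (i / 2) + 1 = i by omega, List.getElem?_eq_getElem hi, hib]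
  choose! j hj using key
  refine Finset.card_le_card_of_injOn j ?_ ?_
  · intro b hb
    exact mem_nbrPos.2 ⟨b, (Finset.mem_inter.1 hb).1, hj b hb⟩
  · intro b hb c hc hbc
    have h1 := hj b hb
    rw [hbc, hj c hc] at h1
    simpa using h1.symm

theorem exists_cycle_of_not_disjoint (h : IsEdgePath N A l) {g g' : α}
    (hg : l[0]'h.pos = .inr g) (hg' : l[l.length - 1]'(Nat.sub_lt h.pos one_pos) = .inr g')
    (hd : ¬ Disjoint (nbrPos N l g) ((nbrPos N l g').image (· + 1))) :
    ∃ j, 1 ≤ j ∧ 2 * j + 1 < l.length ∧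
      IsCycleList (Inc N) (l.drop (2 * j + 1) ++ (l.take (2 * j)).reverse) := by
  obtain ⟨j, hj, hj'⟩ := Finset.not_disjoint_iff.1 hd
  obtain ⟨i, hi, rfl⟩ := Finset.mem_image.1 hj'
  obtain ⟨b, hb, hlb⟩ := mem_nbrPos.1 hj
  obtain ⟨c, hc, hlc⟩ := mem_nbrPos.1 hi
  obtain ⟨hj1, hlb⟩ := List.getElem?_eq_some_iff.1 hlb
  obtain ⟨hi1, hlc⟩ := List.getElem?_eq_some_iff.1 hlc
  refine ⟨i + 1, by omega, hj1, ?_⟩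
  refine h.path.cycle_of_crossing inc_symm (by omega) (by omega) hj1 ?_ ?_
  · rw [hg, hlb]; exact hb
  · simp only [show 2 * (i + 1) - 1 = 2 * i + 1 by omega]
    rw [hg', hlc]; exact hc

end IsEdgePath

theorem card_nbrPos_add_le {l : List (β ⊕ α)} {g g' : α}
    (hd : Disjoint (nbrPos N l g) ((nbrPos N l g').image (· + 1))) :
    (nbrPos N l g).card + (nbrPos N l g').card ≤ l.length / 2 + 1 := by
  rw [← Finset.card_image_of_injective (nbrPos N l g') (add_left_injective 1),
    ← Finset.card_union_of_disjoint hd, ← Finset.card_range (l.length / 2 + 1)]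
  refine Finset.card_le_card (Finset.union_subset ?_ (Finset.image_subset_iff.2 ?_))
  · intro j hj
    have := nbrPos_subset hj
    simp only [Finset.mem_range] at this ⊢
    omega
  · intro j hj
    have := nbrPos_subset hj
    simp only [Finset.mem_range] at this ⊢
    omega

/-- If no edge path has more hyperedges than the cycle `C`, then the hyperedges of `C` are disjoint
from all the others. -/
theorem IsCycleList.disjoint_of_longest {C : List (β ⊕ α)} (hC : IsCycleList (Inc N) C)
    (hCA : ∀ a, Sum.inr a ∈ C → a ∈ A) (hmax : ∀ l, IsEdgePath N A l → l.length ≤ C.length) {g c : α}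
    (hg : g ∈ A) (hgC : Sum.inr g ∉ C) (hc : Sum.inr c ∈ C) : Disjoint (N g) (N c) := by
  have hev := hC.even_length
  refine Finset.disjoint_left.2 fun b hbg hbc => ?_
  by_cases hb : Sum.inl b ∈ C
  · obtain ⟨l, hl, hp⟩ := hC.exists_cons hb
    have : IsEdgePath N A (Sum.inr g :: Sum.inl b :: l) := by
      refine ⟨?_, ?_, ?_, by simp⟩
      · rw [isPathList_cons]
        exact ⟨hl.1, fun hmem => hgC (hp.mem_iff.1 hmem), by simpa using hbg⟩
      · intro a ha
        rcases List.mem_cons.1 ha with ha | ha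
        · simp only [Sum.inr.injEq] at ha; exact ha ▸ hg
        · exact hCA _ (hp.mem_iff.1 ha)
      · rw [List.length_cons, hp.length_eq]; omega
    have := hmax _ this
    rw [List.length_cons, hp.length_eq] at this
    omega
  · obtain ⟨l, hl, hp⟩ := hC.exists_cons hc
    have hlen := hp.length_eq
    have hsub : ∀ {x}, x ∈ (Sum.inr c :: l).take l.length → x ∈ C := fun hx =>
      hp.mem_iff.1 (List.mem_of_mem_take hx)
    have hl0 : l.length ≠ 0 := by
      intro h0
      simp only [List.length_cons] at hlen
      omega
    have : IsEdgePath N A (Sum.inr g :: Sum.inl b :: (Sum.inr c :: l).take l.length) := by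
      refine ⟨?_, ?_, ?_, by simp⟩
      · rw [isPathList_cons, isPathList_cons]
        refine ⟨⟨hl.1.take _, fun hmem => hb (hsub hmem), ?_⟩, ?_, by simpa using hbg⟩
        · intro y hy
          rw [eq_getElem_of_mem_head?_take hy (by simp)]
          exact hbc
        · intro hmem
          rcases List.mem_cons.1 hmem with h | h
          · simp at h
          · exact hgC (hsub h)
      · intro a ha
        rcases List.mem_cons.1 ha with ha | ha
        · simp only [Sum.inr.injEq] at ha; exact ha ▸ hg
        · rcases List.mem_cons.1 ha with ha | ha
          · simp at ha
          · exact hCA _ (hsub ha)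
      · simp only [List.length_cons, List.length_take] at hlen ⊢; omega
    have := hmax _ this
    simp only [List.length_cons, List.length_take] at hlen this
    omega

theorem IsCycleList.exists_edgePath_of_mem {C : List (β ⊕ α)} (hC : IsCycleList (Inc N) C)
    (hCA : ∀ a, Sum.inr a ∈ C → a ∈ A) {g : α} (hg : g ∈ A) (hgC : Sum.inr g ∉ C) {b : β}
    (hbg : b ∈ N g) (hb : Sum.inl b ∈ C) :
    ∃ l, IsEdgePath N A l ∧ l.head? = some (.inr g) ∧ l.Perm (.inr g :: C) := by
  have hev := hC.even_length
  obtain ⟨l, hl, hp⟩ := hC.exists_cons hb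
  refine ⟨Sum.inr g :: Sum.inl b :: l, ⟨?_, ?_, ?_, by simp⟩, rfl, hp.cons _⟩
  · rw [isPathList_cons]
    exact ⟨hl.1, fun hmem => hgC (hp.mem_iff.1 hmem), by simpa using hbg⟩
  · intro a ha
    rcases List.mem_cons.1 ha with ha | ha
    · simp only [Sum.inr.injEq] at ha; exact ha ▸ hg
    · exact hCA _ (hp.mem_iff.1 ha)
  · rw [List.length_cons, hp.length_eq]; omega

/-- Opening a cycle at the vertex where the omitted hyperedge `g` gets attached. -/
theorem IsCycleList.edgePath_of_getLast? {C D : List (β ⊕ α)} (hD : IsCycleList (Inc N) D)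
    (hp : D.Perm C) (hCA : ∀ a, Sum.inr a ∈ C → a ∈ A) {g : α} (hg : g ∈ A) (hgC : Sum.inr g ∉ C)
    {b : β} (hbg : b ∈ N g) (hb : D.getLast? = some (.inl b)) :
    IsEdgePath N A (D ++ [Sum.inr g]) ∧ (D ++ [Sum.inr g]).Perm (Sum.inr g :: C) := by
  have hev := hD.even_length
  have hP : (D ++ [Sum.inr g]).Perm (Sum.inr g :: C) :=
    (List.perm_append_comm (l₂ := [Sum.inr g])).trans (hp.cons _)
  have hD0 : 0 < D.length := by
    rcases D with _ | ⟨x, D⟩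
    · simp at hb
    · simp
  refine ⟨⟨isPathList_append.2 ⟨hD.1, isPathList_singleton _, ?_, ?_⟩, ?_, ?_, ?_⟩, hP⟩
  · rw [List.disjoint_singleton]
    exact fun h => hgC (hp.mem_iff.1 h)
  · intro x hx y hy
    rw [hb] at hx
    simp only [Option.mem_def, Option.some.injEq, List.head?_cons] at hx hy
    subst hx hy
    exact hbg
  · intro a ha
    rcases List.mem_append.1 ha with ha | ha
    · exact hCA _ (hp.mem_iff.1 ha)
    · simp only [List.mem_singleton, Sum.inr.injEq] at ha
      exact ha ▸ hg
  · simp only [List.length_append, List.length_singleton]; omega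
  · intro x hx
    rw [List.head?_append, List.head?_eq_getElem?, List.getElem?_eq_getElem hD0] at hx
    simp only [Option.some_or, Option.mem_def, Option.some.injEq] at hx
    subst hx
    have h1 := hD.2 (.inl b) (by simp [hb]) D[0]
      (by rw [List.head?_eq_getElem?, List.getElem?_eq_getElem hD0]; rfl)
    simpa using h1.isRight_eq

end Cycles

section Disjointification

variable {α β : Type*} [DecidableEq α] [DecidableEq β]

theorem Inc.of_sdiff {N : α → Finset β} {W : Finset β} {x y : β ⊕ α}
    (h : Inc (fun a => N a \ W) x y) : Inc N x y := by
  rcases x with x | x <;> rcases y with y | y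
  · exact h
  · exact (Finset.mem_sdiff.1 h).1
  · exact (Finset.mem_sdiff.1 h).1
  · exact h

/-- An edge path of the traces outside a vertex set is an edge path avoiding this vertex set. -/
theorem IsEdgePath.of_sdiff {N : α → Finset β} {W : Finset β} {A A' : Finset α}
    {t : List (β ⊕ α)} (h : IsEdgePath (fun a => N a \ W) A' t) (hA : A' ⊆ A) :
    IsEdgePath N A t ∧ ∀ b, Sum.inl b ∈ t → b ∉ W := by
  refine ⟨⟨⟨h.path.1.imp fun x y hxy => hxy.of_sdiff, h.path.2⟩, fun a ha => hA (h.mem a ha),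
    h.odd, h.head⟩, ?_⟩
  intro b hb
  obtain ⟨a, -, ha⟩ := h.mem_nbr_of_inl_mem hb
  exact (Finset.mem_sdiff.1 ha).2

theorem IsEdgePath.disjoint_of_sdiff {N : α → Finset β} {A : Finset α} {l t : List (β ⊕ α)}
    (h : IsEdgePath (fun a => N a \ lefts l) (A \ rights l) t) : t.Disjoint l := by
  intro x hx hxl
  rcases x with b | a
  · exact (h.of_sdiff Finset.sdiff_subset).2 b hx (by simpa using hxl)
  · have := h.mem a hx
    simp only [Finset.mem_sdiff, mem_rights] at this
    exact this.2 hxl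

/-- Passing to the traces outside a longest edge path preserves degree conditions. -/
theorem IsEdgePath.length_le_card_sdiff {N : α → Finset β} {A : Finset α} {l t : List (β ⊕ α)}
    (h : IsEdgePath N A l) (hmax : ∀ l', IsEdgePath N A l' → l'.length ≤ l.length)
    (ht : IsEdgePath (fun a => N a \ lefts l) (A \ rights l) t) {g : α}
    (hg : t[0]'ht.pos = .inr g) {M : ℕ} (h1 : min t.length M ≤ (N g).card)
    (h2 : (N g ∩ lefts l).Nonempty → l.length / 2 + 1 ≤ (N g).card) :
    min t.length M ≤ (N g \ lefts l).card := by
  have hc := Finset.card_sdiff_add_card_inter (N g) (lefts l)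
  rcases (N g ∩ lefts l).eq_empty_or_nonempty with h0 | h0
  · rw [h0, Finset.card_empty] at hc
    omega
  · have h3 := h.card_inter_lefts_of_longest hmax (ht.of_sdiff Finset.sdiff_subset).1
      ht.disjoint_of_sdiff hg h0
    have := h2 h0
    omega

theorem IsEdgePath.exists_mem_notMem {N : α → Finset β} {A : Finset α} {l : List (β ⊕ α)}
    (h : IsEdgePath N A l) {g : α} (hg : l.length / 2 + 1 ≤ (N g).card) :
    ∃ x ∈ N g, Sum.inl x ∉ l := by
  obtain ⟨x, hx, hxl⟩ := Finset.exists_mem_notMem_of_card_lt_card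
    (s := lefts l) (t := N g) (by rw [h.card_lefts]; omega)
  exact ⟨x, hx, by simpa using hxl⟩

/-- A family of sets with no long edge path and large degrees at the ends of its edge paths has
at most as many members as vertices. -/
theorem card_le_card_of_edgePaths (M : ℕ) (A : Finset α) : ∀ (N : α → Finset β) (B : Finset β),
    (∀ a ∈ A, N a ⊆ B) → (∀ l, IsEdgePath N A l → l.length < 2 * M) →
    (∀ t (ht : IsEdgePath N A t) (g : α), t[0]'ht.pos = .inr g → min t.length M ≤ (N g).card) →
    A.card ≤ B.card := by
  induction A using Finset.strongInduction with
  | H A ih =>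
  intro N B hNB hM hdeg
  rcases A.eq_empty_or_nonempty with rfl | hA
  · simp
  obtain ⟨l, hl, hmax⟩ := exists_longest_edgePath (N := N) hA
  obtain ⟨h₀, hh₀A, hh₀⟩ := hl.exists_inr hl.pos rfl
  have hodd := hl.odd
  have hlM := hM l hl
  have hN0 := hdeg l hl h₀ hh₀
  obtain ⟨x, hx, hxl⟩ := hl.exists_mem_notMem (g := h₀) (by omega)
  have hxA : ∀ a ∈ A \ rights l, x ∉ N a := by
    intro a ha hxa
    obtain ⟨haA, hal⟩ := Finset.mem_sdiff.1 ha
    have := hmax _ (hl.cons hh₀ hx hxl hxa (by simpa using hal) haA)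
    simp only [List.length_cons] at this
    omega
  have hlt : A \ rights l ⊂ A := by
    refine Finset.sdiff_ssubset hl.rights_subset (Finset.card_pos.1 ?_)
    rw [hl.card_rights]; omega
  have key := ih (A \ rights l) hlt (fun a => N a \ lefts l) (B \ insert x (lefts l)) ?_ ?_ ?_
  · have hsub : insert x (lefts l) ⊆ B := by
      refine Finset.insert_subset (hNB _ hh₀A hx) fun b hb => ?_
      obtain ⟨a, ha, hab⟩ := hl.mem_nbr_of_inl_mem (mem_lefts.1 hb)
      exact hNB a (hl.mem a ha) hab
    have h1 := Finset.card_sdiff_add_card_eq_card hsub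
    have h2 := Finset.card_sdiff_add_card_eq_card hl.rights_subset
    rw [Finset.card_insert_of_notMem (by simpa using hxl), hl.card_lefts] at h1
    rw [hl.card_rights] at h2
    omega
  · intro a ha b hb
    obtain ⟨hb1, hb2⟩ := Finset.mem_sdiff.1 hb
    refine Finset.mem_sdiff.2 ⟨hNB a (Finset.mem_sdiff.1 ha).1 hb1, ?_⟩
    rw [Finset.mem_insert, not_or]
    exact ⟨fun h => hxA a ha (h ▸ hb1), hb2⟩
  · intro t ht
    exact hM t (ht.of_sdiff Finset.sdiff_subset).1
  · intro t ht g hg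
    have ht' := (ht.of_sdiff Finset.sdiff_subset).1
    refine hl.length_le_card_sdiff hmax ht hg (hdeg t ht' g hg) ?_
    rintro ⟨b, hb⟩
    obtain ⟨hbg, hbl⟩ := Finset.mem_inter.1 hb
    obtain ⟨i, hi, hib⟩ := List.getElem_of_mem (mem_lefts.1 hbl)
    have hi2 := hl.odd_of_inl hi hib
    have hgA : g ∈ A \ rights l := ht.mem g (hg ▸ List.getElem_mem _)
    have hsing : IsEdgePath N A [Sum.inr g] := .singleton (Finset.mem_sdiff.1 hgA).1
    have hdis : ([Sum.inr g] : List (β ⊕ α)).Disjoint l := by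
      rw [List.singleton_disjoint]
      simpa using (Finset.mem_sdiff.1 hgA).2
    have e1 := hl.attach_drop hsing hdis rfl hi hib hbg
    have e2 := hl.reverse.attach_drop hsing (by simpa [List.Disjoint] using hdis) rfl
      (i := l.length - 1 - i) (by rw [List.length_reverse]; omega) (b := b)
      (by simp only [List.getElem_reverse, ← hib]; congr 1; omega) hbg
    have h1 := hdeg _ e1 g (by simp)
    have h2 := hdeg _ e2 g (by simp)
    simp only [List.length_append, List.length_reverse, List.length_drop, List.length_singleton]
      at h1 h2
    omega

/-- Counting the vertices outside a cycle through which the omitted hyperedge, or an end of an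
edge path obtained by rerouting, can leave. -/
theorem card_le_of_omitted {N : α → Finset β} {A : Finset α} {C : List (β ⊕ α)} {g₀ : α}
    (hC : IsCycleList (Inc N) C) (hCA : ∀ a, Sum.inr a ∈ C → a ∈ A) (hg₀ : g₀ ∈ A)
    (hgC : Sum.inr g₀ ∉ C)
    (hno : ∀ C', IsCycleList (Inc N) C' → (∀ a, Sum.inr a ∈ C' → a ∈ A) →
      C'.length ≠ C.length + 2)
    (hout : ∀ a, Sum.inr a ∈ C → ∃ x ∈ N a, Sum.inl x ∉ C) {S : Finset β}
    (hS : ∀ l a, IsEdgePath N A l → l.Perm (.inr g₀ :: C) → l.head? = some (.inr a) →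
      N a \ lefts C ⊆ S) (hmeet : ∃ b ∈ N g₀, Sum.inl b ∈ C) :
    (N g₀).card ≤ S.card := by
  obtain ⟨b₀, hb₀, hb₀C⟩ := hmeet
  -- start the cycle at a vertex
  obtain ⟨L, hL, hp⟩ : ∃ L, IsCycleList (Inc N) L ∧ L.Perm C ∧
      ∀ x ∈ L.head?, x.isRight = false := by
    obtain ⟨L, hL, hp⟩ := hC.exists_cons hb₀C
    exact ⟨_, hL, hp, by simp⟩
  obtain ⟨hp, hhead⟩ := hp
  have hev := hL.even_length
  have hL0 : 0 < L.length := List.length_pos_of_mem (hp.mem_iff.2 hb₀C)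
  have hL0' : L[0].isRight = false := hhead _ (by simp [List.head?_eq_getElem?, hL0])
  have key : ∀ b ∈ N g₀, Sum.inl b ∈ C → ∃ i a x, L[2 * i]? = some (.inl b) ∧
      L[2 * i + 1]? = some (.inr a) ∧ 2 * i + 1 < L.length ∧ x ∈ N a ∧ Sum.inl x ∉ C ∧ x ∈ S ∧
      x ∉ N g₀ := by
    intro b hb hbC
    obtain ⟨i, hi, hib⟩ := List.getElem_of_mem (hp.mem_iff.2 hbC)
    have hi2 : i % 2 = 0 := by
      have := isRight_getElem hL.1.1 hi
      rw [hib, hL0'] at this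
      rcases Nat.mod_two_eq_zero_or_one i with h | h
      · exact h
      · simp [h] at this
    obtain ⟨a, ha⟩ := exists_inr_getElem hL.1.1 (i := i + 1) (by omega)
      (by rw [hL0']; simp only [Bool.false_eq, decide_eq_false_iff_not]; omega)
    have haC : Sum.inr a ∈ C := hp.mem_iff.1 (ha ▸ List.getElem_mem _)
    obtain ⟨x, hx, hxC⟩ := hout a haC
    -- the path from `a` around the cycle to `b`, then to `g₀`
    have hD : IsCycleList (Inc N) (L.drop (i + 1) ++ L.take (i + 1)) :=
      IsCycleList.comm_append (by rwa [List.take_append_drop])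
    have hDp : (L.drop (i + 1) ++ L.take (i + 1)).Perm C := by
      refine List.perm_append_comm.trans ?_
      rwa [List.take_append_drop]
    have hDh : (L.drop (i + 1) ++ L.take (i + 1)).head? = some (.inr a) := by
      rw [List.head?_append, List.head?_drop, List.getElem?_eq_getElem (by omega), ha]
      rfl
    have hDl : (L.drop (i + 1) ++ L.take (i + 1)).getLast? = some (.inl b) := by
      rw [List.getLast?_append, List.getLast?_take, if_neg (by omega),
        show i + 1 - 1 = i by omega, List.getElem?_eq_getElem hi, hib]
      rfl
    obtain ⟨hP, hPp⟩ := hD.edgePath_of_getLast? hDp hCA hg₀ hgC hb hDl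
    refine ⟨i / 2, a, x, ?_, ?_, by omega, hx, hxC, ?_, ?_⟩
    · rw [show 2 * (i / 2) = i by omega, List.getElem?_eq_getElem hi, hib]
    · rw [show 2 * (i / 2) = i by omega, List.getElem?_eq_getElem (by omega), ha]
    · refine hS _ a hP hPp ?_ (Finset.mem_sdiff.2 ⟨hx, by simpa using hxC⟩)
      rw [List.head?_append, hDh]; rfl
    · intro hxg
      refine hno (Sum.inl x :: ((L.drop (i + 1) ++ L.take (i + 1)) ++ [Sum.inr g₀])) ?_ ?_ ?_
      · refine ⟨isPathList_cons.2 ⟨hP.path, ?_, ?_⟩, ?_⟩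
        · intro h
          exact hxC (by simpa using hPp.mem_iff.1 h)
        · intro y hy
          rw [List.head?_append, hDh] at hy
          simp only [Option.some_or, Option.mem_def, Option.some.injEq] at hy
          subst hy; exact hx
        · intro y hy z hz
          rw [List.getLast?_cons, List.getLast?_append] at hy
          simp only [List.getLast?_singleton, Option.some_or, Option.getD_some, Option.mem_def,
            Option.some.injEq, List.head?_cons] at hy hz
          subst hy hz; exact hxg
      · intro c hc
        exact hP.mem c (by simpa only [List.mem_cons, reduceCtorEq, false_or] using hc)
      · rw [List.length_cons, hPp.length_eq]; rfl
  choose! i a x h1 h2 h3 h4 h5 h6 h7 using key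
  have hlt : ∀ b ∈ N g₀, Sum.inl b ∈ C → ∀ c ∈ N g₀, Sum.inl c ∈ C → i b < i c → x b ≠ x c := by
    intro b hb hbC c hc hcC hlt hx
    obtain ⟨s, t, hst, hstp, e1, e2, e3, e4⟩ := hL.exists_split (p := 2 * i b + 1)
      (q := 2 * i c + 1) (by omega) (by omega) (h3 c hc hcC)
    rw [h2 c hc hcC] at e1
    rw [show 2 * i b + 1 - 1 = 2 * i b by omega, h1 b hb hbC] at e2
    rw [h2 b hb hbC] at e3
    rw [show 2 * i c + 1 - 1 = 2 * i c by omega, h1 c hc hcC] at e4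
    have hstC := hstp.trans hp
    obtain ⟨ps, pt, hdis, -⟩ := isPathList_append.1 hst.1
    have hP : (t ++ [Sum.inr g₀] ++ s.reverse).Perm (Sum.inr g₀ :: C) := by
      rw [List.append_assoc]
      refine List.perm_append_comm.trans ?_
      simp only [List.cons_append]
      exact (((s.reverse_perm).append_right t).trans hstC).cons _
    refine hno (Sum.inl (x b) :: (t ++ [Sum.inr g₀] ++ s.reverse)) ⟨?_, ?_⟩ ?_ ?_
    · rw [isPathList_cons, isPathList_append, isPathList_append]
      refine ⟨⟨⟨pt, isPathList_singleton _, ?_, ?_⟩, ps.reverse inc_symm, ?_, ?_⟩, ?_, ?_⟩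
      · rw [List.disjoint_singleton]
        exact fun h => hgC (hstC.mem_iff.1 (List.mem_append_right _ h))
      · intro y hy z hz
        rw [e4] at hy
        simp only [Option.mem_def, Option.some.injEq, List.head?_cons] at hy hz
        subst hy hz; exact hc
      · intro y hy hys
        rw [List.mem_reverse] at hys
        rcases List.mem_append.1 hy with hy | hy
        · exact hdis hys hy
        · rw [List.mem_singleton] at hy
          subst hy
          exact hgC (hstC.mem_iff.1 (List.mem_append_left _ hys))
      · intro y hy z hz
        rw [List.head?_reverse, e2] at hz
        simp only [List.getLast?_append, List.getLast?_singleton, Option.some_or, Option.mem_def,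
          Option.some.injEq] at hy hz
        subst hy hz; exact hb
      · intro h
        exact h5 b hb hbC (by simpa using hP.mem_iff.1 h)
      · intro y hy
        simp only [List.append_assoc, List.head?_append, e3, Option.some_or, Option.mem_def,
          Option.some.injEq] at hy
        subst hy; exact h4 b hb hbC
    · intro y hy z hz
      rw [List.getLast?_cons, List.getLast?_append, List.getLast?_reverse, e1] at hy
      simp only [Option.some_or, Option.getD_some, Option.mem_def,
        Option.some.injEq, List.head?_cons] at hy hz
      subst hy hz
      rw [hx]
      exact h4 c hc hcC
    · intro d hd
      have hd' : Sum.inr d ∈ Sum.inr g₀ :: C :=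
        hP.mem_iff.1 (by simpa only [List.mem_cons, reduceCtorEq, false_or] using hd)
      rcases List.mem_cons.1 hd' with hd' | hd'
      · simp only [Sum.inr.injEq] at hd'; exact hd' ▸ hg₀
      · exact hCA _ hd'
    · rw [List.length_cons, hP.length_eq]; rfl
  classical
  refine Finset.card_le_card_of_injOn (fun b => if Sum.inl b ∈ C then x b else b) ?_ ?_
  · intro b hb
    simp only
    split_ifs with hbC
    · exact h6 b hb hbC
    · obtain ⟨l, hl, hh, hlp⟩ := hC.exists_edgePath_of_mem hCA hg₀ hgC hb₀ hb₀C
      exact hS l g₀ hl hlp hh (Finset.mem_sdiff.2 ⟨hb, by simpa using hbC⟩)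
  · intro b hb c hc hbc
    simp only at hbc
    split_ifs at hbc with hbC hcC hcC
    · rcases lt_trichotomy (i b) (i c) with h | h | h
      · exact absurd hbc (hlt b hb hbC c hc hcC h)
      · have := h1 b hb hbC
        rw [h, h1 c hc hcC] at this
        simpa using this.symm
      · exact absurd hbc.symm (hlt c hc hcC b hb hbC h)
    · exact absurd (hbc ▸ hc) (h7 b hb hbC)
    · exact absurd (hbc ▸ hb) (h7 c hc hcC)
    · exact hbc

end Disjointification

section Ends

variable {α β : Type*} [DecidableEq α] [DecidableEq β] {N : α → Finset β} {A : Finset α}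

theorem IsCycleList.mem_nbr_of_inl_mem {C : List (β ⊕ α)} (hC : IsCycleList (Inc N) C) {b : β}
    (hb : Sum.inl b ∈ C) : ∃ a, Sum.inr a ∈ C ∧ b ∈ N a := by
  obtain ⟨l, hl, hp⟩ := hC.exists_cons hb
  have hev := hl.even_length
  rcases l with _ | ⟨x, l⟩
  · simp at hev
  · have h1 := (isPathList_cons.1 hl.1).2.2 x (by simp)
    rcases x with x | a
    · exact h1.elim
    · exact ⟨a, hp.mem_iff.1 (by simp), h1⟩

theorem IsCycleList.card_rights {C : List (β ⊕ α)} (hC : IsCycleList (Inc N) C) :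
    (rights C).card = C.length / 2 := by
  have h := card_lefts_rights_of_isPathList hC.1
  have hev := hC.even_length
  rcases C with _ | ⟨x, C⟩
  · simp [rights]
  · rcases x with b | a
    · exact (h.2 (by simp)).2
    · have := (h.1 (by simp)).2
      omega

theorem IsCycleList.card_lefts {C : List (β ⊕ α)} (hC : IsCycleList (Inc N) C) :
    (lefts C).card = C.length / 2 := by
  have h := card_lefts_rights_of_isPathList hC.1
  have hev := hC.even_length
  rcases C with _ | ⟨x, C⟩
  · simp [lefts]
  · rcases x with b | a
    · have := (h.2 (by simp)).1
      omega
    · exact (h.1 (by simp)).1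

namespace IsEdgePath

variable {l : List (β ⊕ α)}

theorem take (h : IsEdgePath N A l) {i : ℕ} (hi : i % 2 = 1) (hil : i ≤ l.length) :
    IsEdgePath N A (l.take i) := by
  refine ⟨h.path.take i, fun a ha => h.mem a (List.mem_of_mem_take ha), ?_, ?_⟩
  · rw [List.length_take, min_eq_left hil]; exact hi
  · intro x hx
    rw [eq_getElem_of_mem_head?_take hx h.pos]
    exact h.zero_isRight

theorem cons_vertex (h : IsEdgePath N A l) {a : α} (ha : l[0]'h.pos = .inr a) {x : β} (hx : x ∈ N a)
    (hxl : Sum.inl x ∉ l) : IsPathList (Inc N) (.inl x :: l) := by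
  refine isPathList_cons.2 ⟨h.path, hxl, fun y hy => ?_⟩
  rw [List.head?_eq_getElem?, List.getElem?_eq_getElem h.pos, ha] at hy
  simp only [Option.mem_def, Option.some.injEq] at hy
  subst hy
  exact hx

theorem cycle_of_common (h : IsEdgePath N A l) {a c : α} (ha : l[0]'h.pos = .inr a)
    (hc : l[l.length - 1]'(Nat.sub_lt h.pos one_pos) = .inr c) {x : β} (hx : x ∈ N a)
    (hx' : x ∈ N c) (hxl : Sum.inl x ∉ l) : IsCycleList (Inc N) (.inl x :: l) := by
  refine ⟨h.cons_vertex ha hx hxl, ?_⟩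
  intro y hy z hz
  rw [List.getLast?_cons, List.getLast?_eq_getElem?,
    List.getElem?_eq_getElem (Nat.sub_lt h.pos one_pos), hc] at hy
  simp only [Option.getD_some, Option.mem_def, Option.some.injEq, List.head?_cons] at hy hz
  subst hy hz
  exact hx'

/-- Without long paths and cycles, only one end of a long edge path leaves the path. -/
theorem subset_lefts_of_out (h : IsEdgePath N A l)
    (hcyc : ∀ C, IsCycleList (Inc N) C → (∀ a, Sum.inr a ∈ C → a ∈ A) → C.length ≠ l.length + 1)
    (hpath : ∀ l', IsPathList (Inc N) l' → (∀ a, Sum.inr a ∈ l' → a ∈ A) →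
      (∀ x ∈ l'.head?, x.isRight = false) → l'.length ≠ l.length + 2)
    {a c : α} (ha : l[0]'h.pos = .inr a)
    (hc : l[l.length - 1]'(Nat.sub_lt h.pos one_pos) = .inr c) {x : β} (hx : x ∈ N a)
    (hxl : Sum.inl x ∉ l) : N c ⊆ lefts l := by
  intro y hy
  rw [mem_lefts]
  by_contra hyl
  by_cases hxy : x = y
  · subst hxy
    refine hcyc _ (h.cycle_of_common ha hc hx hy hxl) (fun b hb => ?_) (by simp)
    exact h.mem b (by simpa only [List.mem_cons, reduceCtorEq, false_or] using hb)
  · refine hpath ((.inl x :: l) ++ [.inl y]) ?_ ?_ (by simp) (by simp)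
    · refine isPathList_append.2 ⟨h.cons_vertex ha hx hxl, isPathList_singleton _, ?_, ?_⟩
      · rw [List.disjoint_singleton]
        simp only [List.mem_cons, Sum.inl.injEq, not_or]
        exact ⟨fun h => hxy h.symm, hyl⟩
      · intro u hu v hv
        rw [List.getLast?_cons, List.getLast?_eq_getElem?,
          List.getElem?_eq_getElem (Nat.sub_lt h.pos one_pos), hc] at hu
        simp only [Option.getD_some, Option.mem_def, Option.some.injEq, List.head?_cons] at hu hv
        subst hu hv
        exact hy
    · intro b hb
      simp only [List.mem_append, List.mem_cons, reduceCtorEq, false_or,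
        or_false, List.not_mem_nil] at hb
      exact h.mem b hb

/-- A crossing yields a cycle through all the vertices of the path and all but one of its
hyperedges. -/
theorem exists_omitted (h : IsEdgePath N A l) {g g' : α}
    (hg : l[0]'h.pos = .inr g) (hg' : l[l.length - 1]'(Nat.sub_lt h.pos one_pos) = .inr g')
    (hd : ¬ Disjoint (nbrPos N l g) ((nbrPos N l g').image (· + 1))) :
    ∃ C g₀, IsCycleList (Inc N) C ∧ (Sum.inr g₀ :: C).Perm l ∧ ∃ b ∈ N g₀, Sum.inl b ∈ C := by
  obtain ⟨j, hj, hjl, hC⟩ := h.exists_cycle_of_not_disjoint hg hg' hd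
  obtain ⟨g₀, -, hg₀⟩ := h.exists_inr (i := 2 * j) (by omega) (by omega)
  obtain ⟨b, hb⟩ := h.exists_inl (i := 2 * j - 1) (by omega) (by omega)
  refine ⟨_, g₀, hC, ?_, b, ?_, ?_⟩
  · have h1 : l = l.take (2 * j) ++ l[2 * j] :: l.drop (2 * j + 1) := by
      rw [← List.drop_eq_getElem_cons, List.take_append_drop]
    conv_rhs => rw [h1, hg₀]
    refine List.Perm.trans ?_ List.perm_append_comm
    rw [List.cons_append]
    exact ((List.reverse_perm _).append_left _).cons _
  · have := List.isChain_iff_getElem.1 h.path.1 (2 * j - 1) (by omega)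
    rw [hb] at this
    simp only [show 2 * j - 1 + 1 = 2 * j by omega, hg₀] at this
    exact this
  · refine List.mem_append_right _ (List.mem_reverse.2 ?_)
    rw [← hb, List.mem_take_iff_getElem]
    exact ⟨2 * j - 1, by omega, rfl⟩

end IsEdgePath

end Ends

section Uniform

variable {V : Type*} [DecidableEq V] {E : Finset (Finset V)} {r : ℕ}

theorem IsEdgePath.not_subset_lefts {l : List (V ⊕ Finset V)} (hr : 2 ≤ r)
    (hE : ∀ e ∈ E, e.card = r)
    (hcyc : ∀ C, IsCycleList (Inc id) C → (∀ a, Sum.inr a ∈ C → a ∈ E) → C.length ≠ 2 * r + 2)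
    (hpath : ∀ l', IsPathList (Inc id) l' → (∀ a, Sum.inr a ∈ l' → a ∈ E) →
      (∀ x ∈ l'.head?, x.isRight = false) → l'.length ≠ 2 * r + 3)
    (h : IsEdgePath id E l) (hlen : l.length = 2 * r + 1) {a : Finset V}
    (ha : l[0]'h.pos = .inr a) : ¬ a ⊆ lefts l := by
  intro hsub
  have hcard : (lefts l).card = r := by rw [h.card_lefts]; omega
  have huniq : ∀ e, Sum.inr e ∈ l → e ⊆ lefts l → e = lefts l := fun e he hel =>
    Finset.eq_of_subset_of_card_le hel (by rw [hcard, hE e (h.mem e he)])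
  have haV : a = lefts l := huniq a (ha ▸ List.getElem_mem _) hsub
  have hnd : ∀ {i} (hi : i < l.length), i ≠ 0 → ∀ {e}, l[i] = .inr e → ¬ e ⊆ lefts l := by
    intro i hi hi0 e he hel
    have h1 := huniq e (he ▸ List.getElem_mem _) hel
    rw [← haV] at h1
    exact hi0 ((h.path.2.getElem_inj_iff).1 (he.trans (by rw [h1, ← ha])))
  obtain ⟨c, -, hc⟩ := h.exists_inr (i := 2 * r) (by omega) (by omega)
  obtain ⟨e, -, he⟩ := h.exists_inr (i := 2) (by omega) (by omega)
  obtain ⟨b, hb⟩ := h.exists_inl (i := 3) (by omega) (by omega)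
  obtain ⟨x, hx, hxl⟩ := Finset.not_subset.1 (hnd (by omega) (by omega) hc)
  rw [mem_lefts] at hxl
  have hp : ((l.take 3).reverse ++ l.drop 3).Perm l :=
    ((List.reverse_perm _).append_right _).trans (by rw [List.take_append_drop])
  have hlen' := hp.length_eq
  have h0 : ((l.take 3).reverse ++ l.drop 3)[0]'(by omega) = .inr e := by
    rw [List.getElem_append_left (by simp; omega), List.getElem_reverse, List.getElem_take, ← he]
    congr 1
    simp; omega
  have hlast : ((l.take 3).reverse ++ l.drop 3)[2 * r]'(by omega) = .inr c := by
    rw [List.getElem_append_right (by simp; omega), List.getElem_drop, ← hc]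
    congr 1
    simp; omega
  have hP : IsEdgePath id E ((l.take 3).reverse ++ l.drop 3) := by
    refine h.perm hp (h.path.rotate inc_symm (by omega) ?_) ?_
    · rw [ha, hb, inc_inr_inl, id, haV, mem_lefts, ← hb]
      exact List.getElem_mem _
    · intro y hy
      rw [List.head?_eq_getElem?, List.getElem?_eq_getElem (by omega), h0] at hy
      simp only [Option.mem_def, Option.some.injEq] at hy
      subst hy; rfl
  refine hnd (by omega) (by omega) he ?_
  rw [← hp.lefts_eq, ← (List.reverse_perm _).lefts_eq]
  refine hP.reverse.subset_lefts_of_out (a := c) (x := x) ?_ ?_ ?_ ?_ hx ?_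
  · simpa only [List.length_reverse, hlen', hlen] using hcyc
  · simpa only [List.length_reverse, hlen', hlen] using hpath
  · rw [List.getElem_reverse, ← hlast]
    congr 1; omega
  · rw [List.getElem_reverse, ← h0]
    congr 1; rw [List.length_reverse]; omega
  · rwa [List.mem_reverse, hp.mem_iff]

theorem IsEdgePath.length_lt_of_uniform {l : List (V ⊕ Finset V)} (hr : 2 ≤ r)
    (hE : ∀ e ∈ E, e.card = r)
    (hcyc : ∀ C, IsCycleList (Inc id) C → (∀ a, Sum.inr a ∈ C → a ∈ E) → C.length ≠ 2 * r + 2)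
    (hpath : ∀ l', IsPathList (Inc id) l' → (∀ a, Sum.inr a ∈ l' → a ∈ E) →
      (∀ x ∈ l'.head?, x.isRight = false) → l'.length ≠ 2 * r + 3)
    (h : IsEdgePath id E l) : l.length < 2 * r + 1 := by
  by_contra! hlen
  have ht := h.take (i := 2 * r + 1) (by omega) hlen
  have htl : (l.take (2 * r + 1)).length = 2 * r + 1 := by simpa using hlen
  generalize l.take (2 * r + 1) = t at ht htl
  obtain ⟨a, -, ha⟩ := ht.exists_inr ht.pos rfl
  obtain ⟨c, -, hc⟩ := ht.exists_inr (Nat.sub_lt ht.pos one_pos) (by omega)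
  obtain ⟨x, hx, hxl⟩ := Finset.not_subset.1 (ht.not_subset_lefts hr hE hcyc hpath htl ha)
  refine ht.reverse.not_subset_lefts hr hE hcyc hpath (by simpa using htl) (a := c) ?_ ?_
  · simpa only [List.getElem_reverse, Nat.sub_zero] using hc
  · rw [(List.reverse_perm t).lefts_eq]
    refine ht.subset_lefts_of_out (by rwa [htl]) (by rwa [htl]) ha hc hx (by simpa using hxl)

end Uniform

section Connected

variable {V : Type*} [DecidableEq V] {E : Finset (Finset V)} {U : Finset V} {r : ℕ}

theorem IsCycleList.length_lt_of_not_hasBergePath {k : ℕ} (hk : 2 ≤ k) (hE : ∀ e ∈ E, e ⊆ U)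
    (hkU : k < U.card)
    (hconn : ∀ X ⊆ U, X.Nonempty → X ≠ U → ∃ e ∈ E, ∃ x ∈ X, ∃ y ∈ U \ X, x ∈ e ∧ y ∈ e)
    (hpath : ¬ HasBergePath E k) {C : List (V ⊕ Finset V)} (hC : IsCycleList (Inc id) C)
    (hCE : ∀ a, Sum.inr a ∈ C → a ∈ E) : C.length < 2 * k := by
  by_contra! hlen
  refine hpath (hasBergePath_of_isCycleList hk hkU hconn hC hCE (fun x hx => ?_) hlen)
  obtain ⟨a, ha, hxa⟩ := hC.mem_nbr_of_inl_mem hx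
  exact hE a (hCE a ha) hxa

theorem IsPathList.length_lt_of_not_hasBergePath {k : ℕ} (hpath : ¬ HasBergePath E k)
    {l : List (V ⊕ Finset V)} (hl : IsPathList (Inc id) l) (hlE : ∀ a, Sum.inr a ∈ l → a ∈ E)
    (h0 : ∀ x ∈ l.head?, x.isRight = false) : l.length < 2 * k + 1 := by
  by_contra! hlen
  refine hpath (hasBergePath_of_isPathList hl hlE hlen ?_)
  exact h0 _ (by rw [List.head?_eq_getElem?, List.getElem?_eq_getElem]; rfl)

/-- In a connected hypergraph no cycle closes up a longest path. -/
theorem IsCycleList.length_ne_of_longest (hE : ∀ e ∈ E, e ⊆ U ∧ e.Nonempty)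
    (hconn : ∀ X ⊆ U, X.Nonempty → X ≠ U → ∃ e ∈ E, ∃ x ∈ X, ∃ y ∈ U \ X, x ∈ e ∧ y ∈ e)
    {l C : List (V ⊕ Finset V)} (hmax : ∀ l', IsEdgePath id E l' → l'.length ≤ l.length)
    (hl : l.length + 1 < 2 * E.card)
    (hC : IsCycleList (Inc id) C) (hCE : ∀ a, Sum.inr a ∈ C → a ∈ E) :
    C.length ≠ l.length + 1 := by
  intro hlen
  have hdis : ∀ g ∈ E, Sum.inr g ∉ C → ∀ c, Sum.inr c ∈ C → Disjoint g c := fun g hg hgC c hc =>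
    hC.disjoint_of_longest hCE (fun l' hl' => by have := hmax l' hl'; omega) hg hgC hc
  have hcr := hC.card_rights
  obtain ⟨g, hg, hgC⟩ := Finset.exists_mem_notMem_of_card_lt_card (s := rights C) (t := E)
    (by omega)
  rw [mem_rights] at hgC
  obtain ⟨c, hc⟩ : (rights C).Nonempty := by
    rw [← Finset.card_pos]
    have := hC.even_length
    omega
  rw [mem_rights] at hc
  obtain ⟨y, hy⟩ := (hE g hg).2
  obtain ⟨z, hz⟩ := (hE c (hCE c hc)).2
  have hmem : ∀ {x}, x ∈ (rights C).biUnion id ↔ ∃ a, Sum.inr a ∈ C ∧ x ∈ a := by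
    intro x; simp
  obtain ⟨e, he, x, hx, w, hw, hxe, hwe⟩ := hconn ((rights C).biUnion id)
    (fun x hx => by
      obtain ⟨a, ha, hxa⟩ := hmem.1 hx
      exact (hE a (hCE a ha)).1 hxa)
    ⟨z, hmem.2 ⟨c, hc, hz⟩⟩
    (fun h => by
      have : y ∈ (rights C).biUnion id := h ▸ (hE g hg).1 hy
      obtain ⟨a, ha, hya⟩ := hmem.1 this
      exact Finset.disjoint_left.1 (hdis g hg hgC a ha) hy hya)
  obtain ⟨a, ha, hxa⟩ := hmem.1 hx
  rw [Finset.mem_sdiff, hmem] at hw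
  by_cases heC : Sum.inr e ∈ C
  · exact hw.2 ⟨e, heC, hwe⟩
  · exact Finset.disjoint_left.1 (hdis e he heC a ha) hxe hxa

theorem card_add_le_of_longest (hE : ∀ e ∈ E, e ⊆ U ∧ e.card = r)
    {l : List (V ⊕ Finset V)} (h : IsEdgePath id E l)
    (hmax : ∀ l', IsEdgePath id E l' → l'.length ≤ l.length) (hl : l.length < 2 * r)
    (hcyc : ∀ C, IsCycleList (Inc id) C → (∀ a, Sum.inr a ∈ C → a ∈ E) →
      C.length ≠ l.length + 1) :
    E.card + r ≤ U.card + 1 := by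
  classical
  have hodd := h.odd
  set S : Finset V := {x ∈ U \ lefts l | ∃ l' a, IsEdgePath id E l' ∧ l'.Perm l ∧
    l'.head? = some (.inr a) ∧ x ∈ a} with hS
  have hSU : S ⊆ U \ lefts l := Finset.filter_subset _ _
  have hmemS : ∀ l' a, IsEdgePath id E l' → l'.Perm l → l'.head? = some (.inr a) →
      a \ lefts l ⊆ S := by
    intro l' a hl' hp hhd x hx
    rw [Finset.mem_sdiff] at hx
    have haE : a ∈ E := hl'.mem a (List.mem_of_mem_head? hhd)
    exact Finset.mem_filter.2 ⟨Finset.mem_sdiff.2 ⟨(hE a haE).1 hx.1, hx.2⟩, l', a, hl', hp, hhd,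
      hx.1⟩
  have hlU : lefts l ⊆ U := by
    intro x hx
    obtain ⟨a, ha, hxa⟩ := h.mem_nbr_of_inl_mem (mem_lefts.1 hx)
    exact (hE a (h.mem a ha)).1 hxa
  -- the vertices of `S` lie on no hyperedge outside the path
  have hBS : ∀ a ∈ E \ rights l, a \ lefts l ⊆ (U \ lefts l) \ S := by
    intro a ha x hx
    rw [Finset.mem_sdiff, mem_rights] at ha
    rw [Finset.mem_sdiff] at hx
    refine Finset.mem_sdiff.2 ⟨Finset.mem_sdiff.2 ⟨(hE a ha.1).1 hx.1, hx.2⟩, fun hxS => ?_⟩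
    obtain ⟨l', c, hl', hp, hhd, hxc⟩ := (Finset.mem_filter.1 hxS).2
    rw [List.head?_eq_getElem?, List.getElem?_eq_getElem hl'.pos, Option.some.injEq] at hhd
    have := hmax _ (hl'.cons (g := a) (b := x) hhd hxc (by rw [hp.mem_iff]; simpa using hx.2)
      hx.1 (by rw [hp.mem_iff]; exact ha.2) ha.1)
    simp only [List.length_cons, hp.length_eq] at this
    omega
  have hW := card_le_card_of_edgePaths (l.length / 2 + 1) (E \ rights l)
    (fun a => id a \ lefts l) ((U \ lefts l) \ S) hBS ?_ ?_
  · have hSr : r ≤ S.card := by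
      obtain ⟨a, haE, ha⟩ := h.exists_inr h.pos rfl
      obtain ⟨c, hcE, hc⟩ := h.exists_inr (Nat.sub_lt h.pos one_pos) (by omega)
      by_cases hd : Disjoint (nbrPos id l a) ((nbrPos id l c).image (· + 1))
      · have h1 := card_nbrPos_add_le hd
        have h2 := h.card_inter_lefts_le a
        have h3 := h.card_inter_lefts_le c
        have h4 := Finset.card_sdiff_add_card_inter a (lefts l)
        have h5 := Finset.card_sdiff_add_card_inter c (lefts l)
        rw [(hE a haE).2] at h4
        rw [(hE c hcE).2] at h5
        have h6 : Disjoint (a \ lefts l) (c \ lefts l) := by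
          rw [Finset.disjoint_left]
          intro x hx hx'
          rw [Finset.mem_sdiff, mem_lefts] at hx hx'
          refine hcyc _ (h.cycle_of_common ha hc hx.1 hx'.1 hx.2) (fun b hb => ?_) (by simp)
          exact h.mem b (by simpa only [List.mem_cons, reduceCtorEq, false_or] using hb)
        have h7 : (a \ lefts l) ∪ (c \ lefts l) ⊆ S := by
          refine Finset.union_subset (hmemS l a h (List.Perm.refl _) ?_)
            (hmemS _ c h.reverse (List.reverse_perm _) ?_)
          · rw [List.head?_eq_getElem?, List.getElem?_eq_getElem h.pos, ha]
          · rw [List.head?_reverse, List.getLast?_eq_getElem?,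
              List.getElem?_eq_getElem (Nat.sub_lt h.pos one_pos), hc]
        have h8 := Finset.card_le_card h7
        rw [Finset.card_union_of_disjoint h6] at h8
        simp only [id] at h1 h2 h3
        omega
      · obtain ⟨C, g₀, hC, hp, hmeet⟩ := h.exists_omitted ha hc hd
        have hlen := hp.length_eq
        rw [List.length_cons] at hlen
        have hlC : lefts C = lefts l := by rw [← hp.lefts_eq, lefts_cons_inr]
        have hCl : ∀ {y}, y ∈ C → y ∈ l := fun hy => hp.mem_iff.1 (List.mem_cons_of_mem _ hy)
        have hg₀ : g₀ ∈ E := h.mem g₀ (hp.mem_iff.1 (by simp))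
        rw [← (hE g₀ hg₀).2]
        refine card_le_of_omitted hC (fun a ha => h.mem a (hCl ha)) hg₀
          (List.nodup_cons.1 (hp.nodup_iff.2 h.path.2)).1
          (fun C' hC' hC'E => ?_) (fun a ha => ?_) (fun l' a hl' hp' hhd => ?_) hmeet
        · have := hcyc C' hC' hC'E
          omega
        · obtain ⟨x, hx, hxl⟩ := h.exists_mem_notMem (g := a)
            (by rw [id, (hE a (h.mem a (hCl ha))).2]; omega)
          exact ⟨x, hx, fun hxC => hxl (hCl hxC)⟩
        · rw [hlC]
          exact hmemS l' a hl' (hp'.trans hp) hhd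
    have h1 := Finset.card_sdiff_add_card_eq_card h.rights_subset
    have h2 := Finset.card_sdiff_add_card_eq_card hSU
    have h3 := Finset.card_sdiff_add_card_eq_card hlU
    rw [h.card_rights] at h1
    rw [h.card_lefts] at h3
    omega
  · intro t ht
    have := hmax t (ht.of_sdiff Finset.sdiff_subset).1
    omega
  · intro t ht g hg
    have hgE : g ∈ E := by
      have := ht.mem g (hg ▸ List.getElem_mem _)
      exact (Finset.mem_sdiff.1 this).1
    refine h.length_le_card_sdiff hmax ht hg ?_ fun _ => ?_
    · rw [id, (hE g hgE).2]; omega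
    · rw [id, (hE g hgE).2]; omega

/-- The bound for connected hypergraphs whose uniformity is one less than the path length. -/
theorem card_le_of_connected_succ (hr : 3 ≤ r) (hE : ∀ e ∈ E, e ⊆ U ∧ e.card = r)
    (hU : r + 1 < U.card)
    (hconn : ∀ X ⊆ U, X.Nonempty → X ≠ U → ∃ e ∈ E, ∃ x ∈ X, ∃ y ∈ U \ X, x ∈ e ∧ y ∈ e)
    (hpath : ¬ HasBergePath E (r + 1)) :
    E.card ≤ U.card / (r + 1) * (r + 1).choose r + (U.card % (r + 1)).choose r := by
  have hp1 : 1 ≤ U.card / (r + 1) := (Nat.one_le_div_iff (by omega)).2 (by omega)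
  have hn := Nat.div_add_mod U.card (r + 1)
  have hq := Nat.mod_lt U.card (show 0 < r + 1 by omega)
  rw [show (r + 1).choose r = r + 1 from Nat.choose_succ_self_right r]
  rw [mul_comm] at hn
  have hp2 : 1 * (r + 1) ≤ U.card / (r + 1) * (r + 1) := Nat.mul_le_mul_right _ hp1
  rcases le_or_gt E.card (r + 1) with hle | hgt
  · omega
  obtain ⟨l, hl, hmax⟩ := exists_longest_edgePath (N := id) (A := E)
    (Finset.card_pos.1 (by omega))
  have hlen : l.length < 2 * r + 1 := by
    refine hl.length_lt_of_uniform (by omega) (fun e he => (hE e he).2) (fun C hC hCE => ?_)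
      (fun l' hl' hl'E h0 => ?_)
    · have := hC.length_lt_of_not_hasBergePath (by omega) (fun e he => (hE e he).1) hU hconn hpath
        hCE
      omega
    · have := hl'.length_lt_of_not_hasBergePath hpath hl'E h0
      omega
  have hodd := hl.odd
  have := card_add_le_of_longest hE hl hmax (by omega) fun C hC hCE =>
    hC.length_ne_of_longest (fun e he => ⟨(hE e he).1, Finset.card_pos.1 (by rw [(hE e he).2]; omega)⟩)
      hconn hmax (by omega) hCE
  rcases Nat.lt_or_ge (U.card % (r + 1)) r with h | h
  · omega
  · rw [show U.card % (r + 1) = r by omega, Nat.choose_self]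
    omega

end Connected

section Rotation

variable {α β : Type*} [DecidableEq α] [DecidableEq β] {N : α → Finset β} {A : Finset α}

theorem IsEdgePath.exists_rotate {l : List (β ⊕ α)} (h : IsEdgePath N A l) {a : α} {b : β}
    (ha : l[0]'h.pos = .inr a) {i : ℕ} (hi : i < l.length) (hb : l[i] = .inl b) (hba : b ∈ N a) :
    ∃ l', IsEdgePath N A l' ∧ l'.Perm l ∧ (∀ j < i, l'[j]? = l[i - 1 - j]?) ∧
      ∀ j, i ≤ j → l'[j]? = l[j]? := by
  have hodd := h.odd_of_inl hi hb
  have hp : ((l.take i).reverse ++ l.drop i).Perm l :=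
    ((List.reverse_perm _).append_right _).trans (by rw [List.take_append_drop])
  have hlen := hp.length_eq
  have h1 : ∀ j < i, ((l.take i).reverse ++ l.drop i)[j]? = l[i - 1 - j]? := by
    intro j hj
    rw [List.getElem?_append_left (by simp; omega), List.getElem?_reverse (by simp; omega),
      List.getElem?_take_of_lt (by simp; omega)]
    congr 1
    simp; omega
  refine ⟨_, h.perm hp (h.path.rotate inc_symm hi ?_) fun x hx => ?_, hp, h1, fun j hj => ?_⟩
  · rw [ha, hb, inc_inr_inl]; exact hba
  · obtain ⟨e, -, he⟩ := h.exists_inr (i := i - 1) (by omega) (by omega)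
    rw [List.head?_eq_getElem?, h1 0 (by omega), Nat.sub_zero, List.getElem?_eq_getElem (by omega),
      he] at hx
    simp only [Option.mem_def, Option.some.injEq] at hx
    subst hx; rfl
  · rw [List.getElem?_append_right (by simp; omega), List.getElem?_drop]
    congr 1
    simp; omega

end Rotation

section AddTwo

variable {V : Type*} [DecidableEq V] {E : Finset (Finset V)} {r : ℕ}

/-- No Berge path of length `k` and no Berge cycle of length at least `k`, in terms of the
incidence graph. -/
def NoLongPathCycle (E : Finset (Finset V)) (k : ℕ) : Prop :=
  (∀ C, IsCycleList (Inc id) C → (∀ a, Sum.inr a ∈ C → a ∈ E) → C.length < 2 * k) ∧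
  ∀ l, IsPathList (Inc id) l → (∀ a, Sum.inr a ∈ l → a ∈ E) →
    (∀ x ∈ l.head?, x.isRight = false) → l.length < 2 * k + 1

theorem NoLongPathCycle.mono {E' : Finset (Finset V)} {k : ℕ} (h : NoLongPathCycle E k)
    (hE : E' ⊆ E) : NoLongPathCycle E' k :=
  ⟨fun C hC hCE => h.1 C hC fun a ha => hE (hCE a ha),
    fun l hl hlE => h.2 l hl fun a ha => hE (hlE a ha)⟩

theorem IsEdgePath.subset_lefts_of_noLong {k : ℕ} (hno : NoLongPathCycle E k)
    {l : List (V ⊕ Finset V)} (h : IsEdgePath id E l) (hlen : 2 * k ≤ l.length) {a : Finset V}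
    (ha : l[0]'h.pos = .inr a) : a ⊆ lefts l := by
  intro x hx
  rw [mem_lefts]
  by_contra hxl
  have := hno.2 _ (h.cons_vertex ha hx hxl)
    (fun b hb => h.mem b (by simpa only [List.mem_cons, reduceCtorEq, false_or] using hb)) (by simp)
  rw [List.length_cons] at this
  omega

theorem IsEdgePath.pred_notMem_nbrPos {k : ℕ} (hk : 0 < k) (hno : NoLongPathCycle E k)
    {l : List (V ⊕ Finset V)} (h : IsEdgePath id E l) (hlen : l.length = 2 * k + 1) {a : Finset V}
    (ha : l[0]'h.pos = .inr a) : k - 1 ∉ nbrPos id l a := by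
  intro hk1
  obtain ⟨b, hb, hlb⟩ := mem_nbrPos.1 hk1
  rw [show 2 * (k - 1) + 1 = 2 * k - 1 by omega] at hlb
  have hC : IsCycleList (Inc id) (l.take (2 * k)) := by
    refine ⟨h.path.take _, fun x hx y hy => ?_⟩
    rw [eq_getElem_of_mem_getLast?_take hx (by omega) (by omega),
      eq_getElem_of_mem_head?_take hy h.pos, ha]
    rw [List.getElem?_eq_getElem (by omega), Option.some.injEq] at hlb
    rw [hlb, inc_inl_inr]
    exact hb
  have := hno.1 _ hC fun c hc => h.mem c (List.mem_of_mem_take hc)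
  rw [List.length_take, min_eq_left (by omega)] at this
  omega

theorem IsEdgePath.nbrPos_eq_of_long (hr : 3 ≤ r) (hE : ∀ e ∈ E, e.card = r)
    (hno : NoLongPathCycle E (r + 2)) {l : List (V ⊕ Finset V)} (h : IsEdgePath id E l)
    (hlen : l.length = 2 * (r + 2) + 1) {a c : Finset V} (ha : l[0]'h.pos = .inr a)
    (hc : l[l.length - 1]'(Nat.sub_lt h.pos one_pos) = .inr c) :
    nbrPos id l a = Finset.range (r + 3) \ (nbrPos id l c).image (· + 1) ∧ 1 ∈ nbrPos id l a := by
  have hodd := h.odd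
  have haE : a ∈ E := h.mem a (ha ▸ List.getElem_mem _)
  have hcE : c ∈ E := h.mem c (hc ▸ List.getElem_mem _)
  have hcr : l.reverse[0]'h.reverse.pos = .inr c := by
    simpa only [List.getElem_reverse, Nat.sub_zero] using hc
  have haV := h.subset_lefts_of_noLong hno (by omega) ha
  have hcV := h.reverse.subset_lefts_of_noLong hno (by rw [List.length_reverse]; omega) hcr
  rw [(List.reverse_perm l).lefts_eq] at hcV
  have h1 := h.card_inter_lefts_le a
  have h2 := h.card_inter_lefts_le c
  rw [id, Finset.inter_eq_left.2 haV, hE a haE] at h1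
  rw [id, Finset.inter_eq_left.2 hcV, hE c hcE] at h2
  have h3 : 0 ∉ nbrPos id l c := by
    intro h0
    refine h.reverse.pred_notMem_nbrPos (by omega) hno (by simpa using hlen) hcr ?_
    obtain ⟨b, hb, hlb⟩ := mem_nbrPos.1 h0
    refine mem_nbrPos.2 ⟨b, hb, ?_⟩
    rw [List.getElem?_reverse (by omega), ← hlb]
    congr 1; omega
  have h4 := h.pred_notMem_nbrPos (by omega) hno hlen ha
  have hd : Disjoint (nbrPos id l a) ((nbrPos id l c).image (· + 1)) := by
    by_contra hd
    obtain ⟨C, g₀, hC, hp, -⟩ := h.exists_omitted ha hc hd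
    have h5 := hp.length_eq
    have h6 := hno.1 C hC fun e he => h.mem e (hp.mem_iff.1 (List.mem_cons_of_mem _ he))
    rw [List.length_cons] at h5
    omega
  have h5 : ((nbrPos id l c).image (· + 1)).card = (nbrPos id l c).card :=
    Finset.card_image_of_injective _ (add_left_injective 1)
  have hsub : nbrPos id l a ∪ (nbrPos id l c).image (· + 1) ⊆ Finset.range (r + 3) := by
    refine Finset.union_subset (fun j hj => ?_) (Finset.image_subset_iff.2 fun j hj => ?_)
    · have := nbrPos_subset hj
      rw [Finset.mem_range] at *
      omega
    · have := nbrPos_subset hj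
      rw [Finset.mem_range] at *
      omega
  have h6 := Finset.card_le_card hsub
  rw [Finset.card_union_of_disjoint hd, h5, Finset.card_range] at h6
  have heq := Finset.eq_of_subset_of_card_le hsub
    (by rw [Finset.card_union_of_disjoint hd, h5, Finset.card_range]; omega)
  refine ⟨?_, ?_⟩
  · rw [← heq, Finset.union_sdiff_cancel_right hd]
  · have h7 : 1 ∈ nbrPos id l a ∪ (nbrPos id l c).image (· + 1) := by
      rw [heq, Finset.mem_range]; omega
    rcases Finset.mem_union.1 h7 with h7 | h7
    · exact h7
    · obtain ⟨j, hj, hj1⟩ := Finset.mem_image.1 h7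
      obtain rfl : j = 0 := by omega
      exact absurd hj h3

theorem IsEdgePath.length_lt_of_noLong (hr : 3 ≤ r) (hE : ∀ e ∈ E, e.card = r)
    (hno : NoLongPathCycle E (r + 2)) {l : List (V ⊕ Finset V)} (h : IsEdgePath id E l) :
    l.length < 2 * (r + 2) + 1 := by
  by_contra! hlen
  have ht := h.take (i := 2 * (r + 2) + 1) (by omega) hlen
  have htl : (l.take (2 * (r + 2) + 1)).length = 2 * (r + 2) + 1 := by simpa using hlen
  generalize l.take (2 * (r + 2) + 1) = t at ht htl
  obtain ⟨a, haE, ha⟩ := ht.exists_inr ht.pos rfl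
  obtain ⟨c, -, hc⟩ := ht.exists_inr (Nat.sub_lt ht.pos one_pos) (by omega)
  obtain ⟨e, heE, he⟩ := ht.exists_inr (i := 2) (by omega) (by omega)
  obtain ⟨hS, h1⟩ := ht.nbrPos_eq_of_long hr hE hno htl ha hc
  obtain ⟨b, hb, hlb⟩ := mem_nbrPos.1 h1
  obtain ⟨h3, hlb⟩ := List.getElem?_eq_some_iff.1 hlb
  obtain ⟨t', ht', hp, hlo, hhi⟩ := ht.exists_rotate ha h3 hlb hb
  have hlen' := hp.length_eq
  have hget : ∀ j, t'[2 * j + 1]? = t[2 * j + 1]? := by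
    intro j
    rcases Nat.eq_zero_or_pos j with rfl | hj
    · exact hlo 1 (by omega)
    · exact hhi _ (by omega)
  have hnbr : ∀ g, nbrPos id t' g = nbrPos id t g := by
    intro g; ext j; rw [mem_nbrPos, mem_nbrPos, hget]
  have he' : t'[0]'ht'.pos = .inr e := by
    have := hlo 0 (by omega)
    rw [List.getElem?_eq_getElem ht'.pos, List.getElem?_eq_getElem (by omega),
      Option.some.injEq] at this
    exact this.trans he
  have hc' : t'[t'.length - 1]'(Nat.sub_lt ht'.pos one_pos) = .inr c := by
    have := hhi (t'.length - 1) (by omega)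
    rw [List.getElem?_eq_getElem (by omega), List.getElem?_eq_getElem (by omega),
      Option.some.injEq] at this
    rw [this, ← hc]
    congr 1; omega
  obtain ⟨hS', -⟩ := ht'.nbrPos_eq_of_long hr hE hno (by omega) he' hc'
  rw [hnbr, hnbr, ← hS] at hS'
  have hsub : e ⊆ a := by
    intro x hx
    have hxV := ht'.subset_lefts_of_noLong hno (by omega) he' hx
    rw [mem_lefts, hp.mem_iff] at hxV
    obtain ⟨i, hi, hix⟩ := List.getElem_of_mem hxV
    have hi2 := ht.odd_of_inl hi hix
    have hix' : t[2 * (i / 2) + 1]? = some (.inl x) := by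
      rw [show 2 * (i / 2) + 1 = i by omega, List.getElem?_eq_getElem hi, hix]
    have hmem : i / 2 ∈ nbrPos id t e := mem_nbrPos.2 ⟨x, hx, hix'⟩
    rw [hS'] at hmem
    obtain ⟨y, hy, hy'⟩ := mem_nbrPos.1 hmem
    rw [hix', Option.some.injEq, Sum.inl.injEq] at hy'
    exact hy' ▸ hy
  have hea : e = a := Finset.eq_of_subset_of_card_le hsub (by rw [hE a haE, hE e heE])
  have := ht.path.2.getElem_inj_iff.1 (he.trans (by rw [hea, ← ha]))
  omega

end AddTwo

section Select

variable {V : Type*} [DecidableEq V] {E : Finset (Finset V)} {r : ℕ}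

theorem IsEdgePath.exists_end_not_subset (hr : 3 ≤ r) (hE : ∀ e ∈ E, e.card = r)
    {l : List (V ⊕ Finset V)} (h : IsEdgePath id E l) (hlen : l.length = 2 * r + 3) :
    ∃ l' a, IsEdgePath id E l' ∧ l'.length = l.length ∧ l'.head? = some (.inr a) ∧
      ¬ a ⊆ lefts l' := by
  by_contra! hall
  obtain ⟨a, haE, ha⟩ := h.exists_inr h.pos rfl
  obtain ⟨c, hcE, hc⟩ := h.exists_inr (Nat.sub_lt h.pos one_pos) (by omega)
  have haV := hall l a h rfl (by rw [List.head?_eq_getElem?, List.getElem?_eq_getElem h.pos, ha])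
  have hcV := hall l.reverse c h.reverse (by simp) (by
    rw [List.head?_reverse, List.getLast?_eq_getElem?,
      List.getElem?_eq_getElem (Nat.sub_lt h.pos one_pos), hc])
  rw [(List.reverse_perm l).lefts_eq] at hcV
  have hd : ¬ Disjoint (nbrPos id l a) ((nbrPos id l c).image (· + 1)) := by
    intro hd
    have h1 := card_nbrPos_add_le hd
    have h2 := h.card_inter_lefts_le a
    have h3 := h.card_inter_lefts_le c
    rw [id, Finset.inter_eq_left.2 haV, hE a haE] at h2
    rw [id, Finset.inter_eq_left.2 hcV, hE c hcE] at h3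
    omega
  obtain ⟨C, g, hC, hp, b, hb, hbC⟩ := h.exists_omitted ha hc hd
  have hplen := hp.length_eq
  rw [List.length_cons] at hplen
  have hlC : lefts C = lefts l := by rw [← hp.lefts_eq, lefts_cons_inr]
  have hCE : ∀ e, Sum.inr e ∈ C → e ∈ E := fun e he =>
    h.mem e (hp.mem_iff.1 (List.mem_cons_of_mem _ he))
  have hgE : g ∈ E := h.mem g (hp.mem_iff.1 (by simp))
  have hgC : Sum.inr g ∉ C := (List.nodup_cons.1 (hp.nodup_iff.2 h.path.2)).1
  have hcard : (lefts C).card = r + 1 := by rw [hC.card_lefts]; omega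
  have hgV : g ⊆ lefts C := by
    obtain ⟨l', hl', hhd, hp'⟩ := hC.exists_edgePath_of_mem hCE hgE hgC hb hbC
    have := hall l' g hl' (by rw [hp'.length_eq, hp.length_eq]) hhd
    rwa [hp'.lefts_eq, lefts_cons_inr] at this
  -- a hyperedge of the cycle next to a vertex of `g` is an end of a path
  have key : ∀ D c b', IsCycleList (Inc id) D → D.Perm C → D.head? = some (.inr c) →
      D.getLast? = some (.inl b') → b' ∈ g → c ⊆ lefts C := by
    intro D c b' hD hDp hhd hlast hb'
    obtain ⟨hl', hp'⟩ := hD.edgePath_of_getLast? hDp hCE hgE hgC hb' hlast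
    have := hall _ c hl' (by rw [hp'.length_eq, hp.length_eq]) (by rw [List.head?_append, hhd]; rfl)
    rwa [hp'.lefts_eq, lefts_cons_inr] at this
  have hsub : ∀ c, Sum.inr c ∈ C → c ⊆ lefts C := by
    intro c hc
    obtain ⟨D, hD, hDp⟩ := hC.exists_cons hc
    have hDlen := hDp.length_eq
    rw [List.length_cons] at hDlen
    have hD1 := isPathList_cons.1 hD.1
    obtain ⟨b₁, hb₁⟩ : ∃ b₁, D[0]? = some (.inl b₁) := by
      have h0 : D[0]? = some (D[0]'(by omega)) := List.getElem?_eq_getElem (by omega)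
      have := hD1.2.2 (D[0]'(by omega)) (by rw [List.head?_eq_getElem?, h0]; rfl)
      rcases h1 : D[0]'(by omega) with b | e
      · exact ⟨b, by rw [h0, h1]⟩
      · rw [h1] at this; simp at this
    obtain ⟨b₂, hb₂⟩ : ∃ b₂, D[D.length - 1]? = some (.inl b₂) := by
      have h0 : D[D.length - 1]? = some (D[D.length - 1]'(by omega)) :=
        List.getElem?_eq_getElem (by omega)
      have := hD.2 (D[D.length - 1]'(by omega))
        (by rw [List.getLast?_cons, List.getLast?_eq_getElem?, h0]; rfl) (.inr c) (by simp)
      rcases h1 : D[D.length - 1]'(by omega) with b | e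
      · exact ⟨b, by rw [h0, h1]⟩
      · rw [h1] at this; simp at this
    have hne : b₁ ≠ b₂ := by
      rintro rfl
      have := (List.getElem?_inj (i := 0) (j := D.length - 1) (by omega) hD1.1.2).1
        (hb₁.trans hb₂.symm)
      omega
    have hmem : ∀ {b}, Sum.inl b ∈ D → b ∈ lefts C := fun hb =>
      mem_lefts.2 (hDp.mem_iff.1 (List.mem_cons_of_mem _ hb))
    have hb₁C := hmem (List.mem_of_getElem? hb₁)
    have hb₂C := hmem (List.mem_of_getElem? hb₂)
    by_cases hb₂g : b₂ ∈ g
    · exact key _ c b₂ hD hDp rfl (by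
        rw [List.getLast?_cons, List.getLast?_eq_getElem?, hb₂]; rfl) hb₂g
    · have hb₁g : b₁ ∈ g := by
        by_contra hb₁g
        have h1 : insert b₁ (insert b₂ g) ⊆ lefts C := by
          intro x hx
          simp only [Finset.mem_insert] at hx
          rcases hx with rfl | rfl | hx
          · exact hb₁C
          · exact hb₂C
          · exact hgV hx
        have h2 := Finset.card_le_card h1
        rw [Finset.card_insert_of_notMem (by simp [hne, hb₁g]), Finset.card_insert_of_notMem hb₂g,
          hE g hgE, hcard] at h2
        omega
      have hrev : IsCycleList (Inc id) (Sum.inr c :: D.reverse) := by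
        have := hD.reverse inc_symm
        rw [List.reverse_cons] at this
        exact this.comm_append
      refine key _ c b₁ hrev (((List.reverse_perm D).cons _).trans hDp) rfl ?_ hb₁g
      rw [List.getLast?_cons, List.getLast?_reverse, List.head?_eq_getElem?, hb₁]
      rfl
  have hle : rights l ⊆ (lefts l).powersetCard r := by
    intro e he
    rw [Finset.mem_powersetCard]
    refine ⟨?_, hE e (h.rights_subset he)⟩
    rw [mem_rights, ← hp.mem_iff, List.mem_cons] at he
    rw [← hlC]
    rcases he with he | he
    · rw [Sum.inr.injEq] at he; rwa [he]
    · exact hsub e he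
  have := Finset.card_le_card hle
  rw [Finset.card_powersetCard, h.card_rights, ← hlC, hcard, Nat.choose_succ_self_right] at this
  omega

theorem IsEdgePath.exists_good_end (hr : 3 ≤ r) (hE : ∀ e ∈ E, e.card = r)
    (hno : NoLongPathCycle E (r + 2)) {l : List (V ⊕ Finset V)} (h : IsEdgePath id E l)
    (hcyc : ∀ C, IsCycleList (Inc id) C → (∀ a, Sum.inr a ∈ C → a ∈ E) →
      C.length ≠ l.length + 1) :
    ∃ l' a c, IsEdgePath id E l' ∧ l'.length = l.length ∧ l'[0]? = some (.inr a) ∧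
      l'[l'.length - 1]? = some (.inr c) ∧ 1 ≤ (a \ lefts l').card ∧
      l'.length / 2 + (c \ lefts l').card ≤ r + (a \ lefts l').card := by
  have hlt := h.length_lt_of_noLong hr hE hno
  have hodd := h.odd
  rcases Nat.lt_or_ge l.length (2 * r + 3) with hlen | hlen
  · obtain ⟨a, haE, ha⟩ := h.exists_inr h.pos rfl
    obtain ⟨c, hcE, hc⟩ := h.exists_inr (Nat.sub_lt h.pos one_pos) (by omega)
    have ha' : l[0]? = some (.inr a) := by rw [List.getElem?_eq_getElem h.pos, ha]
    have hc' : l[l.length - 1]? = some (.inr c) := by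
      rw [List.getElem?_eq_getElem (Nat.sub_lt h.pos one_pos), hc]
    have hpos : 1 ≤ (a \ lefts l).card + (c \ lefts l).card := by
      by_contra! h0
      have ha0 : a ⊆ lefts l := by
        rw [← Finset.sdiff_eq_empty_iff_subset, ← Finset.card_eq_zero]; omega
      have hc0 : c ⊆ lefts l := by
        rw [← Finset.sdiff_eq_empty_iff_subset, ← Finset.card_eq_zero]; omega
      have hcard := h.card_lefts
      have h1 := Finset.eq_of_subset_of_card_le ha0 (by rw [hE a haE]; omega)
      have h2 := Finset.eq_of_subset_of_card_le hc0 (by rw [hE c hcE]; omega)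
      have h3 := h.path.2.getElem_inj_iff.1 (ha.trans (by rw [h1, ← h2, ← hc]))
      rw [← h1, hE a haE] at hcard
      omega
    rcases le_total (c \ lefts l).card (a \ lefts l).card with hle | hle
    · exact ⟨l, a, c, h, rfl, ha', hc', by omega, by omega⟩
    · refine ⟨l.reverse, c, a, h.reverse, by simp, ?_, ?_, ?_⟩
      · rw [List.getElem?_reverse h.pos, ← hc']; rfl
      · rw [List.length_reverse, List.getElem?_reverse (Nat.sub_lt h.pos one_pos), ← ha']
        congr 1; omega
      · rw [(List.reverse_perm l).lefts_eq, List.length_reverse]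
        omega
  · obtain ⟨l', a, h', hlen', hhd, hna⟩ := h.exists_end_not_subset hr hE (by omega)
    obtain ⟨x, hx, hxl⟩ := Finset.not_subset.1 hna
    rw [mem_lefts] at hxl
    obtain ⟨c, -, hc⟩ := h'.exists_inr (Nat.sub_lt h'.pos one_pos) (by omega)
    have ha := hhd
    rw [List.head?_eq_getElem?, List.getElem?_eq_getElem h'.pos, Option.some.injEq] at ha
    rw [List.head?_eq_getElem?] at hhd
    have hsub : c ⊆ lefts l' := h'.subset_lefts_of_out (by rwa [hlen']) (fun q hq hqE h0 => by
      have := hno.2 q hq hqE h0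
      omega) ha hc hx hxl
    refine ⟨l', a, c, h', hlen', hhd,
      by rw [List.getElem?_eq_getElem (Nat.sub_lt h'.pos one_pos), hc], ?_⟩
    rw [Finset.sdiff_eq_empty_iff_subset.2 hsub, Finset.card_empty]
    have : 0 < (a \ lefts l').card :=
      Finset.card_pos.2 ⟨x, Finset.mem_sdiff.2 ⟨hx, by simpa using hxl⟩⟩
    omega

end Select

section Peel

variable {V : Type*} [DecidableEq V] {E : Finset (Finset V)} {r : ℕ}

/-- If no cycle closes up a longest path, few hyperedges meet the private vertices of an end. -/
theorem IsEdgePath.card_filter_not_disjoint_add_le {l : List (V ⊕ Finset V)}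
    (h : IsEdgePath id E l) (hmax : ∀ l', IsEdgePath id E l' → l'.length ≤ l.length)
    (hcyc : ∀ C, IsCycleList (Inc id) C → (∀ a, Sum.inr a ∈ C → a ∈ E) →
      C.length ≠ l.length + 1)
    {a c : Finset V} (ha : l[0]? = some (.inr a)) (hc : l[l.length - 1]? = some (.inr c)) :
    (E.filter fun e => ¬ Disjoint e (a \ lefts l)).card + (c ∩ lefts l).card ≤
      l.length / 2 + 1 ∧ Disjoint c (a \ lefts l) := by
  have hodd := h.odd
  have hnocommon : ∀ l', IsEdgePath id E l' → l'.Perm l → ∀ e c, l'[0]? = some (.inr e) →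
      l'[l'.length - 1]? = some (.inr c) → ∀ x ∈ e, x ∈ c → Sum.inl x ∈ l := by
    intro l' hl' hp e c he hc x hxe hxc
    by_contra hxl
    rw [List.getElem?_eq_getElem hl'.pos, Option.some.injEq] at he
    rw [List.getElem?_eq_getElem (Nat.sub_lt hl'.pos one_pos), Option.some.injEq] at hc
    refine hcyc _ (hl'.cycle_of_common he hc hxe hxc (by rwa [hp.mem_iff])) (fun b hb => ?_)
      (by simp [hp.length_eq])
    exact hl'.mem b (by simpa only [List.mem_cons, reduceCtorEq, false_or] using hb)
  refine ⟨?_, ?_⟩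
  swap
  · rw [Finset.disjoint_left]
    intro x hxc hx
    rw [Finset.mem_sdiff, mem_lefts] at hx
    exact hx.2 (hnocommon l h (List.Perm.refl _) a c ha hc x hx.1 hxc)
  set H := E.filter fun e => ¬ Disjoint e (a \ lefts l) with hH
  have hHr : H ⊆ rights l := by
    intro e he
    obtain ⟨heE, he⟩ := Finset.mem_filter.1 he
    obtain ⟨x, hxe, hx⟩ := Finset.not_disjoint_iff.1 he
    rw [Finset.mem_sdiff, mem_lefts] at hx
    rw [mem_rights]
    by_contra hel
    rw [List.getElem?_eq_getElem h.pos, Option.some.injEq] at ha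
    have := hmax _ (h.cons ha hx.1 hx.2 hxe hel heE)
    simp only [List.length_cons] at this
    omega
  have key : ∀ j ∈ nbrPos id l c, ∃ e, e ∈ rights l \ H ∧ l[2 * j + 2]? = some (.inr e) := by
    intro j hj
    obtain ⟨b, hb, hlb⟩ := mem_nbrPos.1 hj
    obtain ⟨hj1, hlb⟩ := List.getElem?_eq_some_iff.1 hlb
    obtain ⟨e, heE, he⟩ := h.exists_inr (i := 2 * j + 2) (by omega) (by omega)
    have he' : l[2 * j + 2]? = some (.inr e) := by
      rw [List.getElem?_eq_getElem (by omega), he]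
    refine ⟨e, ?_, he'⟩
    rw [Finset.mem_sdiff, mem_rights]
    refine ⟨he ▸ List.getElem_mem _, fun heH => ?_⟩
    obtain ⟨x, hxe, hx⟩ := Finset.not_disjoint_iff.1 (Finset.mem_filter.1 heH).2
    rw [Finset.mem_sdiff, mem_lefts] at hx
    rw [List.getElem?_eq_getElem (Nat.sub_lt h.pos one_pos), Option.some.injEq] at hc
    obtain ⟨l', hl', hp, hlo, hhi⟩ := h.reverse.exists_rotate (a := c) (b := b)
      (i := l.length - 1 - (2 * j + 1))
      (by simpa only [List.getElem_reverse, Nat.sub_zero] using hc)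
      (by rw [List.length_reverse]; omega)
      (by
        rw [List.getElem_reverse, ← hlb]
        congr 1; omega) hb
    have hp' := hp.trans (List.reverse_perm l)
    refine hx.2 (hnocommon l' hl' hp' e a ?_ ?_ x hxe hx.1)
    · rw [hlo 0 (by omega), List.getElem?_reverse (by omega), ← he']
      congr 1; omega
    · rw [hhi _ (by rw [hp'.length_eq]; omega), List.getElem?_reverse (by rw [hp'.length_eq]; omega),
        ← ha, hp'.length_eq]
      congr 1; omega
  choose! f hf hfl using key
  have h1 : (nbrPos id l c).card ≤ (rights l \ H).card := by
    refine Finset.card_le_card_of_injOn f hf fun i hi j hj hij => ?_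
    have h2 := hfl i hi
    have h3 : 2 * i + 2 < l.length := (List.getElem?_eq_some_iff.1 h2).1
    rw [hij, ← hfl j hj] at h2
    have := (List.getElem?_inj h3 h.path.2).1 h2
    omega
  have h2 := Finset.card_sdiff_add_card_eq_card hHr
  have h3 := h.card_inter_lefts_le c
  rw [h.card_rights] at h2
  rw [id] at h3
  omega

/-- Two triples over a point together with all triples of a four-element set contain a Berge
cycle of length five. -/
theorem exists_isCycleList_of_powersetCard {N : Finset V} (hN : N.card = 4)
    (hNE : N.powersetCard 3 ⊆ E) {x : V} (hx : x ∉ N) {f g : Finset V} (hf : f ∈ E) (hg : g ∈ E)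
    (hfg : f ≠ g) (hcard : f.card = g.card) (hxf : x ∈ f) (hxg : x ∈ g) (hfN : f ⊆ insert x N)
    (hgN : g ⊆ insert x N) :
    ∃ C, IsCycleList (Inc id) C ∧ (∀ a, Sum.inr a ∈ C → a ∈ E) ∧ C.length = 10 := by
  obtain ⟨p, hp⟩ : (f \ g).Nonempty := by
    rw [Finset.sdiff_nonempty]
    exact fun h => hfg (Finset.eq_of_subset_of_card_le h hcard.ge)
  obtain ⟨q, hq⟩ : (g \ f).Nonempty := by
    rw [Finset.sdiff_nonempty]
    exact fun h => hfg (Finset.eq_of_subset_of_card_le h hcard.le).symm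
  rw [Finset.mem_sdiff] at hp hq
  have hpx : p ≠ x := fun h => hp.2 (h ▸ hxg)
  have hqx : q ≠ x := fun h => hq.2 (h ▸ hxf)
  have hpq : p ≠ q := fun h => hp.2 (h ▸ hq.1)
  have hpN : p ∈ N := (Finset.mem_insert.1 (hfN hp.1)).resolve_left hpx
  have hqN : q ∈ N := (Finset.mem_insert.1 (hgN hq.1)).resolve_left hqx
  have h2 : ((N.erase p).erase q).card = 2 := by
    rw [Finset.card_erase_of_mem (Finset.mem_erase.2 ⟨hpq.symm, hqN⟩), Finset.card_erase_of_mem hpN,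
      hN]
  obtain ⟨s, t, hst, hNst⟩ := Finset.card_eq_two.1 h2
  have hs : s ∈ (N.erase p).erase q := by rw [hNst]; simp
  have ht : t ∈ (N.erase p).erase q := by rw [hNst]; simp
  simp only [Finset.mem_erase] at hs ht
  have hmem : ∀ {u v w : V}, u ∈ N → v ∈ N → w ∈ N → u ≠ v → u ≠ w → v ≠ w →
      ({u, v, w} : Finset V) ∈ E ∧ x ∉ ({u, v, w} : Finset V) := by
    intro u v w hu hv hw huv huw hvw
    have hsub : ({u, v, w} : Finset V) ⊆ N := by
      intro y hy
      simp only [Finset.mem_insert, Finset.mem_singleton] at hy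
      rcases hy with rfl | rfl | rfl <;> assumption
    refine ⟨hNE (Finset.mem_powersetCard.2 ⟨hsub, Finset.card_eq_three.2 ⟨u, v, w, huv, huw, hvw,
      rfl⟩⟩), fun h => hx (hsub h)⟩
  have hA := hmem hpN hs.2.2 hqN hs.2.1.symm hpq hs.1
  have hB := hmem hs.2.2 ht.2.2 hpN hst hs.2.1 ht.2.1
  have hD := hmem ht.2.2 hqN hs.2.2 ht.1 hst.symm hs.1.symm
  have hAB : ({p, s, q} : Finset V) ≠ {s, t, p} := by
    intro h
    have : q ∈ ({s, t, p} : Finset V) := h ▸ by simp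
    simp [hs.1.symm, ht.1.symm, hpq.symm] at this
  have hAD : ({p, s, q} : Finset V) ≠ {t, q, s} := by
    intro h
    have : p ∈ ({t, q, s} : Finset V) := h ▸ by simp
    simp [hs.2.1.symm, ht.2.1.symm, hpq] at this
  have hBD : ({s, t, p} : Finset V) ≠ {t, q, s} := by
    intro h
    have : p ∈ ({t, q, s} : Finset V) := h ▸ by simp
    simp [hs.2.1.symm, ht.2.1.symm, hpq] at this
  have hne : ∀ {e e' : Finset V}, x ∈ e → x ∉ e' → e ≠ e' := fun h h' h'' => h' (h'' ▸ h)
  refine ⟨[.inl x, .inr f, .inl p, .inr {p, s, q}, .inl s, .inr {s, t, p}, .inl t,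
    .inr {t, q, s}, .inl q, .inr g], ⟨⟨?_, ?_⟩, ?_⟩, ?_, rfl⟩
  · simp [hxf, hp.1, hq.1]
  · simp [hpx.symm, hqx.symm, hpq, hst, hs.1, hs.2.1.symm, ht.1, ht.2.1.symm, hAB, hAD, hBD, hfg,
      hne hxf hA.2, hne hxf hB.2, hne hxf hD.2, (hne hxg hA.2).symm, (hne hxg hB.2).symm,
      (hne hxg hD.2).symm, show x ≠ s from fun h => hx (h ▸ hs.2.2),
      show x ≠ t from fun h => hx (h ▸ ht.2.2)]
  · simp [hxg]
  · intro e he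
    simp only [List.mem_cons, reduceCtorEq, Sum.inr.injEq, List.not_mem_nil, or_false,
      false_or] at he
    rcases he with rfl | rfl | rfl | rfl | rfl
    · exact hf
    · exact hA.1
    · exact hB.1
    · exact hD.1
    · exact hg

end Peel

section AddTwoBound

variable {V : Type*} [DecidableEq V] {r : ℕ}

theorem card_biUnion_ge_of_card_ge_two {F : Finset (Finset V)} (hF : ∀ e ∈ F, e.card = r)
    (h2 : 2 ≤ F.card) : r + 1 ≤ (F.biUnion id).card := by
  obtain ⟨a, ha, b, hb, hab⟩ := Finset.one_lt_card.1 h2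
  by_contra! hlt
  have h1 : ∀ e ∈ F, e = F.biUnion id := fun e he =>
    Finset.eq_of_subset_of_card_le (Finset.subset_biUnion_of_mem id he) (by rw [hF e he]; omega)
  exact hab ((h1 a ha).trans (h1 b hb).symm)

/-- A hypergraph without long paths and cycles has fewer hyperedges than twice its number of
vertices. -/
theorem card_add_le_two_mul_of_noLong (hr : 3 ≤ r) (E : Finset (Finset V)) :
    E.Nonempty → (∀ e ∈ E, e.card = r) → NoLongPathCycle E (r + 2) →
    E.card + (r + 1) ≤ 2 * (E.biUnion id).card ∧
    (r = 3 → E.card + 5 ≤ 2 * (E.biUnion id).card ∨ E.card = 4 ∧ (E.biUnion id).card = 4) := by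
  induction E using Finset.strongInduction with
  | H E ih =>
  intro hne hE hno
  obtain ⟨l, hl, hmax⟩ := exists_longest_edgePath (N := id) hne
  have hodd := hl.odd
  by_cases hcyc : ∃ C, IsCycleList (Inc id) C ∧ (∀ a, Sum.inr a ∈ C → a ∈ E) ∧
      C.length = l.length + 1
  · obtain ⟨C, hC, hCE, hlen⟩ := hcyc
    have hlt := hno.1 C hC hCE
    have hsub : rights C ⊆ E := fun a ha => hCE a (mem_rights.1 ha)
    have hcard := hC.card_rights
    have hdis : Disjoint ((rights C).biUnion id) ((E \ rights C).biUnion id) := by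
      simp only [Finset.disjoint_biUnion_left, Finset.disjoint_biUnion_right, id]
      intro g hg c hc
      rw [mem_rights] at hc
      rw [Finset.mem_sdiff, mem_rights] at hg
      exact (hC.disjoint_of_longest hCE (fun l' hl' => by have := hmax l' hl'; omega) hg.1 hg.2
        hc).symm
    have hU : (E.biUnion id).card =
        ((rights C).biUnion id).card + ((E \ rights C).biUnion id).card := by
      rw [← Finset.card_union_of_disjoint hdis, ← Finset.union_biUnion, Finset.union_sdiff_of_subset hsub]
    have hEc := Finset.card_sdiff_add_card_eq_card hsub
    have hpos := hl.pos
    have h1 : ∃ c, c ∈ rights C := Finset.card_pos.1 (by omega)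
    have h2 : r ≤ ((rights C).biUnion id).card := by
      obtain ⟨c, hc⟩ := h1
      rw [← hE c (hsub hc)]
      exact Finset.card_le_card (Finset.subset_biUnion_of_mem id hc)
    have h3 : 2 ≤ (rights C).card → r + 1 ≤ ((rights C).biUnion id).card :=
      card_biUnion_ge_of_card_ge_two fun e he => hE e (hsub he)
    rcases (E \ rights C).eq_empty_or_nonempty with h0 | h0
    · rw [h0, Finset.card_empty] at hEc
      simp only [h0, Finset.biUnion_empty, Finset.card_empty] at hU
      refine ⟨?_, ?_⟩
      · rcases Nat.lt_or_ge (rights C).card 2 with h | h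
        · omega
        · have := h3 h; omega
      · intro hr3
        rcases Nat.lt_or_ge (rights C).card 2 with h | h
        · omega
        · have := h3 h; omega
    · obtain ⟨i1, -⟩ := ih (E \ rights C)
        ((Finset.ssubset_iff_subset_ne.2 ⟨Finset.sdiff_subset, fun h => by
          rw [h] at hEc; omega⟩)) h0 (fun e he => hE e (Finset.sdiff_subset he))
        (hno.mono Finset.sdiff_subset)
      rcases Nat.lt_or_ge (rights C).card 2 with h | h
      · omega
      · have := h3 h; omega
  · push Not at hcyc
    obtain ⟨t, a, c, ht, htl, ha, hc, hs, hst⟩ := hl.exists_good_end hr hE hno hcyc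
    rw [← htl] at hmax hcyc
    obtain ⟨hH, hcX⟩ := ht.card_filter_not_disjoint_add_le hmax hcyc ha hc
    have haE : a ∈ E := ht.mem a (List.mem_of_getElem? ha)
    have hcE : c ∈ E := ht.mem c (List.mem_of_getElem? hc)
    have hcc := Finset.card_sdiff_add_card_inter c (lefts t)
    rw [hE c hcE] at hcc
    set X := a \ lefts t with hX
    have hsplit : (E.filter fun e => ¬ Disjoint e X).card + (E.filter fun e => Disjoint e X).card
        = E.card := by
      rw [add_comm]; exact Finset.card_filter_add_card_filter_not _
    set H := E.filter fun e => ¬ Disjoint e X with hHdef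
    set E' := E.filter fun e => Disjoint e X with hE'
    have hE'E : E' ⊆ E := Finset.filter_subset _ _
    have haX : ¬ Disjoint a X := by
      intro h
      have h0 := Finset.card_pos.1 hs
      obtain ⟨x, hx⟩ := h0
      exact Finset.disjoint_left.1 h (Finset.mem_sdiff.1 hx).1 hx
    have hss : E' ⊂ E := Finset.ssubset_iff_subset_ne.2 ⟨hE'E, fun h => by
      rw [← h] at haE
      exact haX (Finset.mem_filter.1 haE).2⟩
    have hdis : Disjoint (E'.biUnion id) X := by
      rw [Finset.disjoint_biUnion_left]
      exact fun e he => (Finset.mem_filter.1 he).2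
    have hXE : X ⊆ E.biUnion id := fun x hx =>
      Finset.mem_biUnion.2 ⟨a, haE, (Finset.mem_sdiff.1 hx).1⟩
    have hun : E'.biUnion id ∪ X ⊆ E.biUnion id :=
      Finset.union_subset (Finset.biUnion_subset_biUnion_of_subset_left _ hE'E) hXE
    have hcu := Finset.card_le_card hun
    rw [Finset.card_union_of_disjoint hdis] at hcu
    obtain ⟨i1, i2⟩ := ih E' hss ⟨c, Finset.mem_filter.2 ⟨hcE, hcX⟩⟩
      (fun e he => hE e (hE'E he)) (hno.mono hE'E)
    refine ⟨by omega, fun hr3 => ?_⟩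
    rcases i2 hr3 with i2 | ⟨i2, i3⟩
    · left; omega
    · by_contra! hcon
      have hX1 : X.card = 1 := by omega
      have hH2 : H.card = 2 := by omega
      have heq := Finset.eq_of_subset_of_card_le hun
        (by rw [Finset.card_union_of_disjoint hdis]; omega)
      obtain ⟨x, hx⟩ := Finset.card_eq_one.1 hX1
      obtain ⟨f, g, hfg, hHfg⟩ := Finset.card_eq_two.1 hH2
      have hmem : ∀ e ∈ H, e ∈ E ∧ x ∈ e ∧ e ⊆ insert x (E'.biUnion id) := by
        intro e he
        obtain ⟨h1, h2⟩ := Finset.mem_filter.1 he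
        rw [hx, Finset.disjoint_singleton_right, not_not] at h2
        refine ⟨h1, h2, ?_⟩
        rw [← Finset.union_singleton, ← hx, heq]
        exact Finset.subset_biUnion_of_mem id h1
      have hf := hmem f (by rw [hHfg]; simp)
      have hg := hmem g (by rw [hHfg]; simp)
      have hpow : (E'.biUnion id).powersetCard 3 = E' := by
        symm
        refine Finset.eq_of_subset_of_card_le (fun e he => ?_) ?_
        · rw [Finset.mem_powersetCard]
          exact ⟨Finset.subset_biUnion_of_mem id he, by rw [hE e (hE'E he), hr3]⟩
        · rw [Finset.card_powersetCard, i3, i2]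
          decide
      obtain ⟨C, hC, hCE, hlen⟩ := exists_isCycleList_of_powersetCard i3 (hpow.subset.trans hE'E)
        (x := x) (by
          rw [hx, Finset.disjoint_singleton_right] at hdis
          exact hdis) hf.1 hg.1 hfg (by rw [hE f hf.1, hE g hg.1]) hf.2.1 hg.2.1 hf.2.2 hg.2.2
      have := hno.1 C hC hCE
      omega

/-- The bound for connected hypergraphs whose uniformity is two less than the path length. -/
theorem card_le_of_connected_add_two {E : Finset (Finset V)} {U : Finset V} (hr : 3 ≤ r)
    (hE : ∀ e ∈ E, e ⊆ U ∧ e.card = r) (hU : r + 2 < U.card)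
    (hconn : ∀ X ⊆ U, X.Nonempty → X ≠ U → ∃ e ∈ E, ∃ x ∈ X, ∃ y ∈ U \ X, x ∈ e ∧ y ∈ e)
    (hpath : ¬ HasBergePath E (r + 2)) :
    E.card ≤ U.card / (r + 2) * (r + 2).choose r + (U.card % (r + 2)).choose r := by
  rcases E.eq_empty_or_nonempty with rfl | hne
  · simp
  obtain ⟨h1, h2⟩ := card_add_le_two_mul_of_noLong hr E hne (fun e he => (hE e he).2)
    ⟨fun C hC hCE => hC.length_lt_of_not_hasBergePath (by omega) (fun e he => (hE e he).1) hU hconn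
      hpath hCE, fun l hl hlE h0 => hl.length_lt_of_not_hasBergePath hpath hlE h0⟩
  have h3 : (E.biUnion id).card ≤ U.card := Finset.card_le_card
    (Finset.biUnion_subset.2 fun e he => (hE e he).1)
  have hp1 : 1 ≤ U.card / (r + 2) := (Nat.one_le_div_iff (by omega)).2 (by omega)
  have hn := Nat.div_add_mod U.card (r + 2)
  have hq := Nat.mod_lt U.card (show 0 < r + 2 by omega)
  generalize U.card / (r + 2) = p at *
  generalize U.card % (r + 2) = q at *
  have hchoose : 2 * (r + 2).choose r = (r + 2) * (r + 1) := by
    rw [← Nat.choose_symm_of_eq_add (show r + 2 = 2 + r by omega), Nat.choose_two_right,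
      Nat.mul_div_cancel' (Nat.even_mul_pred_self (r + 2)).two_dvd]
    rfl
  rcases Nat.lt_or_ge r 5 with hr5 | hr5
  · obtain rfl | rfl : r = 3 ∨ r = 4 := by omega
    · rw [show Nat.choose (3 + 2) 3 = 10 by decide]
      interval_cases q <;> simp [Nat.choose] at * <;> omega
    · rw [show Nat.choose (4 + 2) 4 = 15 by decide]
      interval_cases q <;> simp [Nat.choose] at * <;> omega
  · have h4 : 3 * (r + 2) ≤ (r + 2).choose r := by nlinarith
    have h5 : p * (3 * (r + 2)) ≤ p * (r + 2).choose r := Nat.mul_le_mul_left _ h4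
    have h6 : 1 * (r + 2) ≤ p * (r + 2) := Nat.mul_le_mul_right _ hp1
    have h7 : p * (3 * (r + 2)) = 3 * (p * (r + 2)) := by ring
    rw [mul_comm] at hn
    omega

end AddTwoBound

section Extremal

/-- The `j`-th block of `k` consecutive vertices. -/
def block (n k j : ℕ) : Finset (Fin n) := Finset.univ.filter fun i => i.val / k = j

theorem card_block {n k j : ℕ} (hk : 0 < k) : (block n k j).card = min k (n - j * k) := by
  have : (block n k j).map Fin.valEmbedding = Finset.Ico (j * k) (min n (j * k + k)) := by
    ext i
    simp only [block, Finset.mem_map, Finset.mem_filter, Finset.mem_univ, true_and,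
      Fin.valEmbedding_apply, Finset.mem_Ico, lt_min_iff]
    constructor
    · rintro ⟨i, hi, rfl⟩
      have h1 := Nat.div_add_mod i.val k
      have h2 := Nat.mod_lt i.val hk
      rw [hi, mul_comm] at h1
      have := i.isLt
      omega
    · rintro ⟨h1, h2, h3⟩
      exact ⟨⟨i, h2⟩, Nat.div_eq_of_lt_le h1 (by rw [add_mul, one_mul]; exact h3), rfl⟩
  rw [← Finset.card_map, this, Nat.card_Ico]
  omega

/-- All sets of size `r` inside the blocks. -/
def blockFamily (n k p r : ℕ) : Finset (Finset (Fin n)) :=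
  (Finset.range (p + 1)).biUnion fun j => (block n k j).powersetCard r

theorem mem_blockFamily {n k p r : ℕ} {e : Finset (Fin n)} :
    e ∈ blockFamily n k p r ↔ ∃ j < p + 1, e ⊆ block n k j ∧ e.card = r := by
  simp [blockFamily, Finset.mem_powersetCard]

theorem card_blockFamily {n k p q r : ℕ} (hr : 0 < r) (hn : n = p * k + q) (hq : q < k) :
    (blockFamily n k p r).card = p * k.choose r + q.choose r := by
  have hk : 0 < k := by omega
  rw [blockFamily, Finset.card_biUnion, Finset.sum_range_succ]
  · have h1 : ∀ j ∈ Finset.range p, ((block n k j).powersetCard r).card = k.choose r := by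
      intro j hj
      have h2 : (j + 1) * k ≤ p * k := Nat.mul_le_mul_right _ (Finset.mem_range.1 hj)
      rw [Finset.card_powersetCard, card_block hk, min_eq_left]
      rw [add_mul] at h2
      omega
    rw [Finset.sum_congr rfl h1, Finset.sum_const, Finset.card_range, smul_eq_mul,
      Finset.card_powersetCard, card_block hk, min_eq_right (by omega)]
    congr 2
    omega
  · intro i _ j _ hij
    rw [Function.onFun, Finset.disjoint_left]
    intro e hi hj
    rw [Finset.mem_powersetCard] at hi hj
    obtain ⟨x, hx⟩ := Finset.card_pos.1 (hi.2 ▸ hr)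
    exact hij ((Finset.mem_filter.1 (hi.1 hx)).2.symm.trans (Finset.mem_filter.1 (hj.1 hx)).2)

theorem not_hasBergePath_blockFamily {n k p r : ℕ} (hk : 0 < k) :
    ¬ HasBergePath (blockFamily n k p r) k := by
  rintro ⟨v, h, hv, -, hE, hinc⟩
  have hstep : ∀ i : Fin (k + 1), v i ∈ block n k ((v 0).val / k) := by
    intro i
    induction i using Fin.induction with
    | zero => simp [block]
    | succ i ih =>
      obtain ⟨j, -, hj, -⟩ := mem_blockFamily.1 (hE i)
      have h1 := (Finset.mem_filter.1 (hj (hinc i).1)).2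
      have h2 := (Finset.mem_filter.1 (hj (hinc i).2)).2
      have h3 := (Finset.mem_filter.1 ih).2
      exact Finset.mem_filter.2 ⟨Finset.mem_univ _, by rw [h2, ← h1, h3]⟩
  have hle := Finset.card_le_card_of_injOn (s := Finset.univ) v (fun i _ => hstep i) hv.injOn
  rw [Finset.card_univ, Fintype.card_fin, card_block hk] at hle
  omega

end Extremal

/-- Main theorem: for `r ≥ 3`, `k ≥ r+1` and `n = p·k + q` with `0 ≤ q < k`,
the maximum number of hyperedges of an `n`-vertex `r`-uniform hypergraph with
no Berge path of length `k` is `p·C(k,r) + C(q,r)`. -/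
theorem turan_berge_path (r k p q n : ℕ) (hr : 3 ≤ r) (hk : r + 1 ≤ k)
    (hn : n = p * k + q) (hq : q < k) :
    IsGreatest {m : ℕ | ∃ E : Finset (Finset (Fin n)),
        (∀ e ∈ E, e.card = r) ∧ ¬ HasBergePath E k ∧ E.card = m}
      (p * Nat.choose k r + Nat.choose q r) := by
  refine ⟨⟨blockFamily n k p r, fun e he => ?_, not_hasBergePath_blockFamily (by omega),
    card_blockFamily (by omega) hn hq⟩, ?_⟩
  · obtain ⟨j, -, -, h⟩ := mem_blockFamily.1 he
    exact h
  · rintro m ⟨E, hE, hpath, rfl⟩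
    have hdiv : n / k = p := by
      rw [hn]
      exact Nat.div_eq_of_lt_le (by omega) (by rw [add_mul]; omega)
    have hmod : n % k = q := by
      rw [hn, add_comm, Nat.add_mul_mod_self_right, Nat.mod_eq_of_lt hq]
    have := card_le_of_forall_connected (k := k) (r := r) (by omega) (by omega)
      (fun U E hE hU hconn hpath => ?_) Finset.univ E
      (fun e he => ⟨Finset.subset_univ e, hE e he⟩) hpath
    · rwa [Finset.card_univ, Fintype.card_fin, hdiv, hmod] at this
    · rcases Nat.lt_or_ge k (r + 3) with h | h
      · obtain rfl | rfl : k = r + 1 ∨ k = r + 2 := by omega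
        · exact card_le_of_connected_succ hr hE hU hconn hpath
        · exact card_le_of_connected_add_two hr hE hU hconn hpath
      · exact card_le_of_connected_large hr h hE hU hconn hpath
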